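/- For every integer r ≥ 1 there exists a constant c > 0 such that for every ε > 0 there exists C > 0 with: for all real Y ≥ 1, | ∑_{Δ fundamental discriminant, −Y ≤ Δ < 0} (NumberField.classNumber K_Δ)^r − c · Y^{r/2+1} | ≤ C · Y^{r/2 + 2/3 + ε}. -/

import Mathlib

/-!
Statement 1: moments of class numbers of imaginary quadratic fields
(Theorem `cor:classnumbers`, imaginary case).
-/

/-- `Δ` is a fundamental discriminant. -/
def IsFundamentalDiscriminant (Δ : ℤ) : Prop :=
  Δ ≠ 1 ∧ ((Δ % 4 = 1 ∧ Squarefree Δ) ∨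
    ∃ m : ℤ, Δ = 4 * m ∧ Squarefree m ∧ (m % 4 = 2 ∨ m % 4 = 3))


namespace CNM

open Finset

/-- the additive character `e(x) = exp(2πix)` -/
noncomputable def ee (x : ℝ) : ℂ := Complex.exp (2 * Real.pi * Complex.I * x)

lemma ee_add (x y : ℝ) : ee (x + y) = ee x * ee y := by
  unfold ee; rw [← Complex.exp_add]; push_cast; ring_nf

lemma norm_ee (x : ℝ) : ‖ee x‖ = 1 := by
  unfold ee
  rw [show (2 * Real.pi * Complex.I * x : ℂ) = ((2 * Real.pi * x : ℝ) : ℂ) * Complex.I by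
    push_cast; ring]
  exact Complex.norm_exp_ofReal_mul_I _

lemma ee_int (k : ℤ) : ee k = 1 := by
  unfold ee
  rw [Complex.exp_eq_one_iff]
  exact ⟨k, by push_cast; ring⟩

lemma ee_zero : ee 0 = 1 := by simpa using ee_int 0

lemma ee_neg (x : ℝ) : ee (-x) = (starRingEnd ℂ) (ee x) := by
  unfold ee
  rw [← Complex.exp_conj]
  congr 1
  simp only [map_mul, Complex.conj_ofReal, Complex.conj_I, map_ofNat]
  push_cast; ring

lemma exists_jac_neg {n p : ℕ} (hn : Odd n) (hsq : Squarefree n) (hp : p.Prime) (hpn : p ∣ n) :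
    ∃ y : ℤ, ((n / p : ℕ) : ℤ) ∣ y - 1 ∧ jacobiSym y n = -1 := by
  obtain ⟨m, rfl⟩ := hpn
  have : Fact p.Prime := ⟨hp⟩
  have hp2 : p ≠ 2 := by
    rintro rfl
    rw [Nat.odd_mul] at hn
    exact absurd hn.1 (by decide)
  have hcop : p.Coprime m := (Nat.squarefree_mul_iff.mp hsq).1
  obtain ⟨a, ha⟩ := FiniteField.exists_nonsquare (F := ZMod p) (by
    rw [ZMod.ringChar_zmod_n]; exact hp2)
  have ha0 : a ≠ 0 := by rintro rfl; exact ha ⟨0, by simp⟩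
  obtain ⟨k, hk1, hk2⟩ := Nat.chineseRemainder hcop a.val 1
  refine ⟨k, ?_, ?_⟩
  · rw [Nat.mul_div_cancel_left _ hp.pos]
    have := (Nat.modEq_iff_dvd.mp hk2.symm)
    simpa using this
  · have : NeZero p := ⟨hp.ne_zero⟩
    have : NeZero m := ⟨by rintro rfl; simp at hsq⟩
    rw [jacobiSym.mul_right]
    have h1 : jacobiSym (k : ℤ) p = -1 := by
      rw [← jacobiSym.legendreSym.to_jacobiSym, legendreSym.eq_neg_one_iff]
      have : ((k : ℤ) : ZMod p) = a := by
        have := (ZMod.natCast_eq_natCast_iff _ _ _).mpr hk1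
        rw [Int.cast_natCast, this, ZMod.natCast_zmod_val]
      rwa [this]
    have h2 : jacobiSym (k : ℤ) m = 1 := by
      rw [jacobiSym.mod_left]
      have : (k : ℤ) % m = (1 : ℤ) % m := by exact_mod_cast hk2
      rw [this, ← jacobiSym.mod_left, jacobiSym.one_left]
    rw [h1, h2]; norm_num

/-- Jacobi symbol as a function on `ZMod n` -/
noncomputable def jz (n : ℕ) (x : ZMod n) : ℂ := ((jacobiSym (x.val : ℤ) n : ℤ) : ℂ)

lemma jz_int (n : ℕ) [NeZero n] (a : ℤ) : jz n (a : ZMod n) = ((jacobiSym a n : ℤ) : ℂ) := by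
  unfold jz
  congr 1
  rw [ZMod.val_intCast, ← jacobiSym.mod_left]

lemma jz_mul (n : ℕ) [NeZero n] (x y : ZMod n) : jz n (x * y) = jz n x * jz n y := by
  rw [← ZMod.natCast_zmod_val x, ← ZMod.natCast_zmod_val y]
  have := jz_int n ((x.val : ℤ) * y.val)
  have h1 := jz_int n (x.val : ℤ)
  have h2 := jz_int n (y.val : ℤ)
  push_cast at this h1 h2
  rw [this, h1, h2, jacobiSym.mul_left]; push_cast; rfl

/-- the Gauss sum -/
noncomputable def gz (n : ℕ) [NeZero n] (x : ZMod n) : ℂ := ∑ h : ZMod n, jz n h * ZMod.stdAddChar (h * x)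

lemma jz_unit_sq (n : ℕ) [NeZero n] (y : (ZMod n)ˣ) : jz n y * jz n y = 1 := by
  have hy := ZMod.val_coe_unit_coprime y
  unfold jz
  have := jacobiSym.sq_one (a := ((y : ZMod n).val : ℤ)) (b := n) (by
    rw [Int.gcd_natCast_natCast]; exact hy)
  rw [← Int.cast_mul, ← sq, this]; simp

lemma gz_unit_mul (n : ℕ) [NeZero n] (y : (ZMod n)ˣ) (x : ZMod n) :
    gz n (y * x) = jz n y * gz n x := by
  unfold gz
  rw [Finset.mul_sum]
  rw [← Equiv.sum_comp (Units.mulRight y)  (fun h => jz n y * (jz n h * ZMod.stdAddChar (h * x)))]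
  apply Finset.sum_congr rfl
  intro h _
  simp only [Units.mulRight_apply]
  rw [jz_mul, show h * ((y : ZMod n) * x) = h * (y : ZMod n) * x by ring]
  have := jz_unit_sq n y
  linear_combination (-(jz n h * ZMod.stdAddChar (h * (y : ZMod n) * x))) * this

lemma gz_eq {n : ℕ} [NeZero n] (hn : Odd n) (hsq : Squarefree n) (x : ZMod n) :
    gz n x = jz n x * gz n 1 := by
  by_cases hx : IsUnit x
  · obtain ⟨y, rfl⟩ := hx
    simpa using gz_unit_mul n y 1
  · have hc : ¬ Nat.Coprime x.val n := by
      intro h; apply hx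
      have := (ZMod.isUnit_iff_coprime x.val n).mpr h
      rwa [ZMod.natCast_zmod_val] at this
    have hj : jz n x = 0 := by
      unfold jz
      rw [jacobiSym.eq_zero_iff_not_coprime.mpr (by rw [Int.gcd_natCast_natCast]; exact hc)]; simp
    rw [hj, zero_mul]
    obtain ⟨p, hp, hpx, hpn⟩ := Nat.Prime.not_coprime_iff_dvd.mp hc
    obtain ⟨y, hy1, hy2⟩ := exists_jac_neg hn hsq hp hpn
    have hyu : IsUnit ((y : ZMod n)) := by
      have : Int.gcd y n = 1 := by
        by_contra h
        rw [jacobiSym.eq_zero_iff_not_coprime.mpr h] at hy2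
        norm_num at hy2
      have := (ZMod.isUnit_iff_coprime y.natAbs n).mpr (by simpa [Int.gcd] using this)
      rcases Int.natAbs_eq y with h | h
      · rw [h, Int.cast_natCast]; exact this
      · rw [h, Int.cast_neg, Int.cast_natCast]; exact this.neg
    obtain ⟨u, hu⟩ := hyu
    have h1 := gz_unit_mul n u x
    have h2 : (u : ZMod n) * x = x := by
      rw [hu]
      have : ((y - 1 : ℤ) : ZMod n) * x = 0 := by
        rw [← ZMod.natCast_zmod_val x]
        have : (((y - 1) * (x.val : ℤ) : ℤ) : ZMod n) = 0 := by
          rw [ZMod.intCast_zmod_eq_zero_iff_dvd]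
          obtain ⟨m, rfl⟩ := hpn
          rw [Nat.mul_div_cancel_left _ hp.pos] at hy1
          have : ((p : ℤ)) ∣ (x.val : ℤ) := by exact_mod_cast hpx
          have := mul_dvd_mul hy1 this
          push_cast
          rwa [mul_comm (p : ℤ)]
        push_cast at this ⊢
        simpa using this
      push_cast at this
      linear_combination this
    rw [h2, hu, jz_int, hy2] at h1
    push_cast at h1
    have : (2 : ℂ) * gz n x = 0 := by linear_combination h1
    simpa using this

lemma jz_conj (n : ℕ) (x : ZMod n) : (starRingEnd ℂ) (jz n x) = jz n x := by
  unfold jz; simp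

lemma norm_gz_one {n : ℕ} [NeZero n] (hn : Odd n) (hsq : Squarefree n) :
    ‖gz n 1‖ ^ 2 = n := by
  have key : ∑ x : ZMod n, gz n x * (starRingEnd ℂ) (gz n x) = n * ∑ h : ZMod n, jz n h * jz n h := by
    have : ∀ x : ZMod n, gz n x * (starRingEnd ℂ) (gz n x) =
        ∑ h : ZMod n, ∑ k : ZMod n, jz n h * jz n k * ZMod.stdAddChar (x * (h - k)) := by
      intro x
      unfold gz
      rw [map_sum, Finset.sum_mul_sum]
      refine Finset.sum_congr rfl fun h _ => Finset.sum_congr rfl fun k _ => ?_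
      rw [RingHom.map_mul (starRingEnd ℂ), jz_conj, ← AddChar.map_neg_eq_conj, mul_mul_mul_comm, ← AddChar.map_add_eq_mul]
      congr 2; ring
    simp_rw [this]
    rw [Finset.sum_comm]
    rw [Finset.mul_sum]
    refine Finset.sum_congr rfl fun h _ => ?_
    rw [Finset.sum_comm]
    simp_rw [← Finset.mul_sum]
    have h2 : ∀ k : ZMod n, ∑ x : ZMod n, (ZMod.stdAddChar (x * (h - k)) : ℂ) = if h = k then (n : ℂ) else 0 := by
      intro k
      rw [AddChar.sum_mulShift _ (ZMod.isPrimitive_stdAddChar n)]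
      simp [sub_eq_zero, ZMod.card]
    simp_rw [h2]
    simp [mul_comm]
  have h3 : ∀ x : ZMod n, gz n x * (starRingEnd ℂ) (gz n x) = (jz n x * jz n x) * ((‖gz n 1‖ ^ 2 : ℝ) : ℂ) := by
    intro x
    rw [gz_eq hn hsq x, map_mul, jz_conj, mul_mul_mul_comm, Complex.mul_conj, Complex.normSq_eq_norm_sq]
  simp_rw [h3] at key
  rw [← Finset.sum_mul, mul_comm] at key
  have hne : ∑ h : ZMod n, jz n h * jz n h ≠ 0 := by
    have : ∑ h : ZMod n, jz n h * jz n h = ((∑ h : ZMod n, (jacobiSym (h.val : ℤ) n) ^ 2 : ℤ) : ℂ) := by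
      unfold jz; push_cast; refine Finset.sum_congr rfl fun h _ => by ring
    rw [this]
    have hpos : 0 < ∑ h : ZMod n, (jacobiSym (h.val : ℤ) n) ^ 2 := by
      apply Finset.sum_pos' (fun _ _ => sq_nonneg _)
      refine ⟨((1 : ℤ) : ZMod n), Finset.mem_univ _, ?_⟩
      rw [ZMod.val_intCast, ← jacobiSym.mod_left, jacobiSym.one_left]; norm_num
    exact_mod_cast hpos.ne'
  have := mul_right_cancel₀ hne key
  exact_mod_cast this

lemma std_eq (n : ℕ) [NeZero n] (a : ℤ) : ZMod.stdAddChar ((a : ℤ) : ZMod n) = ee ((a : ℝ) / n) := by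
  rw [ZMod.stdAddChar_coe]; unfold ee; push_cast; ring_nf

/-- sum over `ZMod n`, `n = 2 m + 1`, symmetric representatives -/
lemma sum_zmod_sym {n m : ℕ} [NeZero n] (hnm : n = 2 * m + 1) (f : ZMod n → ℂ) (h0 : f 0 = 0) :
    ∑ x, f x = ∑ h ∈ Icc 1 m, (f (h : ZMod n) + f (-(h : ZMod n))) := by
  have h1 : ∑ x, f x = ∑ h ∈ range n, f (h : ZMod n) := by
    rw [Finset.sum_range]
    symm
    apply Fintype.sum_bijective (fun i : Fin n => ((i : ℕ) : ZMod n))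
    · rw [Fintype.bijective_iff_injective_and_card]
      refine ⟨?_, by simp [ZMod.card]⟩
      intro i j hij
      simp only at hij
      rw [ZMod.natCast_eq_natCast_iff] at hij
      exact Fin.ext (Nat.ModEq.eq_of_lt_of_lt hij i.2 j.2)
    · intro i; rfl
  rw [h1, Finset.sum_add_distrib]
  have h2 : ∑ h ∈ Icc 1 m, f (-(h : ZMod n)) = ∑ h ∈ Icc (m + 1) (2 * m), f (h : ZMod n) := by
    apply Finset.sum_nbij' (fun h => n - h) (fun h => n - h)
    · intro h hh; simp at hh ⊢; omega
    · intro h hh; simp at hh ⊢; omega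
    · intro h hh; simp at hh ⊢; omega
    · intro h hh; simp at hh ⊢; omega
    · intro h hh; simp at hh
      rw [Nat.cast_sub (by omega)]; simp
  rw [h2]
  have h3 : range n = insert 0 (Icc 1 m ∪ Icc (m + 1) (2 * m)) := by
    ext x; simp; omega
  rw [h3, Finset.sum_insert (by simp), Finset.sum_union]
  · simp [h0]
  · rw [Finset.disjoint_left]; intro x; simp; omega

/-- completion formula in symmetric form -/
lemma completion {n m : ℕ} [NeZero n] (hnm : n = 2 * m + 1) (hm : 1 ≤ m) (hsq : Squarefree n) (x : ℤ) :
    gz n 1 * ((jacobiSym x n : ℤ) : ℂ) =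
      ∑ h ∈ Icc 1 m, ((jacobiSym h n : ℤ) : ℂ) *
        (ee ((h : ℝ) * x / n) + ((jacobiSym (-1) n : ℤ) : ℂ) * (starRingEnd ℂ) (ee ((h : ℝ) * x / n))) := by
  have hn : Odd n := ⟨m, hnm⟩
  have h1 : gz n 1 * ((jacobiSym x n : ℤ) : ℂ) = gz n (x : ZMod n) := by
    rw [gz_eq hn hsq (x : ZMod n), jz_int]; ring
  rw [h1]
  unfold gz
  rw [sum_zmod_sym hnm]
  · refine Finset.sum_congr rfl fun h _ => ?_
    have e1 : (h : ZMod n) = ((h : ℤ) : ZMod n) := by simp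
    have e2 : (h : ZMod n) * (x : ZMod n) = ((h * x : ℤ) : ZMod n) := by push_cast; ring
    have e3 : -(h : ZMod n) = ((-1 * h : ℤ) : ZMod n) := by push_cast; ring
    have e4 : -(h : ZMod n) * (x : ZMod n) = ((-(h * x) : ℤ) : ZMod n) := by push_cast; ring
    rw [e4, e2, e3, e1, std_eq, std_eq, jz_int, jz_int, jacobiSym.mul_left, ← ee_neg]
    push_cast
    ring_nf
  · have : jz n 0 = 0 := by
      have := jz_int n 0
      simp only [Int.cast_zero] at this
      rw [this, jacobiSym.zero_left (by omega)]; simp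
    rw [this, zero_mul]

end CNM


namespace CNM

open Finset

/-- Dirichlet kernel -/
noncomputable def DK (L : ℕ) (θ : ℝ) : ℂ := ∑ j ∈ range L, ee (j * θ)

lemma DK_mul (L : ℕ) (θ : ℝ) : DK L θ * (ee θ - 1) = ee (L * θ) - 1 := by
  unfold DK
  induction L with
  | zero => simp [ee_zero]
  | succ L ih =>
    rw [Finset.sum_range_succ, add_mul, ih]
    have : ee ((L + 1 : ℕ) * θ) = ee (L * θ) * ee θ := by
      rw [← ee_add]; congr 1; push_cast; ring
    rw [this]; ring

lemma norm_ee_sub_one (x : ℝ) : ‖ee x - 1‖ = 2 * |Real.sin (Real.pi * x)| := by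
  unfold ee
  rw [show (2 * Real.pi * Complex.I * x : ℂ) = Complex.I * ((2 * Real.pi * x : ℝ) : ℂ) by
    push_cast; ring]
  rw [Complex.norm_exp_I_mul_ofReal_sub_one]
  rw [Real.norm_eq_abs, abs_mul]
  rw [show 2 * Real.pi * x / 2 = Real.pi * x by ring]
  norm_num

lemma norm_ee_sub_one_ge {x : ℝ} (h0 : 0 ≤ x) (h1 : x ≤ 1 / 2) : 4 * x ≤ ‖ee x - 1‖ := by
  rw [norm_ee_sub_one]
  have := Real.mul_le_sin (x := Real.pi * x) (by positivity) (by nlinarith [Real.pi_pos])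
  have h2 : 2 / Real.pi * (Real.pi * x) = 2 * x := by field_simp
  rw [h2] at this
  have := le_abs_self (Real.sin (Real.pi * x))
  linarith

lemma norm_ee_sub (x y : ℝ) : ‖ee x - ee y‖ ≤ 2 * Real.pi * |x - y| := by
  have : ee x - ee y = ee y * (ee (x - y) - 1) := by
    rw [mul_sub, ← ee_add]; simp
  rw [this, norm_mul, norm_ee, one_mul, norm_ee_sub_one]
  have := Real.abs_sin_le_abs (x := Real.pi * (x - y))
  rw [abs_mul, abs_of_pos Real.pi_pos] at this
  linarith

lemma norm_DK_le (L : ℕ) (θ : ℝ) : ‖DK L θ‖ ≤ L := by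
  unfold DK
  refine (norm_sum_le _ _).trans ?_
  simp [norm_ee]

lemma norm_DK_le' (L : ℕ) {θ : ℝ} (h0 : 0 < θ) (h1 : θ ≤ 1 / 2) : ‖DK L θ‖ ≤ 1 / (2 * θ) := by
  have h2 := congrArg norm (DK_mul L θ)
  rw [norm_mul] at h2
  have h3 : ‖ee (L * θ) - 1‖ ≤ 2 := by
    refine (norm_sub_le _ _).trans ?_
    rw [norm_ee]; norm_num
  have h4 := norm_ee_sub_one_ge h0.le h1
  rw [le_div_iff₀ (by positivity)]
  have : ‖DK L θ‖ * (4 * θ) ≤ 2 := by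
    calc _ ≤ ‖DK L θ‖ * ‖ee θ - 1‖ := by gcongr
      _ ≤ 2 := by rw [h2]; exact h3
  linarith

lemma norm_DK_sub (L : ℕ) {θ θ' θ₀ δ : ℝ} (h0 : 0 < θ₀) (h1 : θ₀ ≤ θ) (h2 : θ ≤ 1 / 2)
    (hd : |θ - θ'| ≤ δ) :
    ‖DK L θ - DK L θ'‖ ≤ Real.pi * L * δ / θ₀ := by
  have key : (DK L θ - DK L θ') * (ee θ - 1) =
      (ee (L * θ) - ee (L * θ')) - DK L θ' * (ee θ - ee θ') := by
    have e1 := DK_mul L θ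
    have e2 := DK_mul L θ'
    linear_combination e1 - e2
  have k2 := congrArg norm key
  rw [norm_mul] at k2
  have h4 := norm_ee_sub_one_ge (h0.le.trans h1) h2
  have hL : (0 : ℝ) ≤ L := Nat.cast_nonneg L
  have h5 : ‖(ee (L * θ) - ee (L * θ')) - DK L θ' * (ee θ - ee θ')‖ ≤ 4 * Real.pi * L * δ := by
    refine (norm_sub_le _ _).trans ?_
    rw [norm_mul]
    have a1 := norm_ee_sub (L * θ) (L * θ')
    rw [← mul_sub, abs_mul, abs_of_nonneg hL] at a1
    have a2 := norm_ee_sub θ θ'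
    have a3 := norm_DK_le L θ'
    have a4 : ‖DK L θ'‖ * ‖ee θ - ee θ'‖ ≤ L * (2 * Real.pi * |θ - θ'|) := by gcongr
    have a5 : L * |θ - θ'| ≤ L * δ := by gcongr
    have := Real.pi_pos
    nlinarith
  rw [le_div_iff₀ h0]
  have : ‖DK L θ - DK L θ'‖ * (4 * θ₀) ≤ 4 * Real.pi * L * δ := by
    calc _ ≤ ‖DK L θ - DK L θ'‖ * ‖ee θ - 1‖ := by gcongr; linarith
      _ ≤ _ := by rw [k2]; exact h5
  linarith

lemma sum_inv_le (m : ℕ) : ∑ h ∈ Icc 1 m, (1 : ℝ) / h ≤ 1 + Real.log m := by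
  have := harmonic_le_one_add_log m
  rw [harmonic_eq_sum_Icc] at this
  push_cast at this
  simpa [one_div] using this

/-- Polya–Vinogradov for odd squarefree moduli -/
lemma pv {n : ℕ} (hn : Odd n) (hsq : Squarefree n) (h1 : 1 < n) (L : ℕ) (A : ℤ) :
    |((∑ k ∈ range L, jacobiSym (A + k) n : ℤ) : ℝ)| ≤ √n * (1 + Real.log n) := by
  obtain ⟨m, hm⟩ := hn
  have hm1 : 1 ≤ m := by omega
  have : NeZero n := ⟨by omega⟩
  have hg := norm_gz_one ⟨m, hm⟩ hsq
  have hnpos : (0 : ℝ) < n := by exact_mod_cast (by omega : 0 < n)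
  have hg' : ‖gz n 1‖ = √n := by
    rw [← hg, Real.sqrt_sq (norm_nonneg _)]
  have key : gz n 1 * ((∑ k ∈ range L, jacobiSym (A + k) n : ℤ) : ℂ) =
      ∑ h ∈ Icc 1 m, ((jacobiSym h n : ℤ) : ℂ) *
        (ee ((h : ℝ) * A / n) * DK L (h / n) + ((jacobiSym (-1) n : ℤ) : ℂ) *
          (starRingEnd ℂ) (ee ((h : ℝ) * A / n) * DK L (h / n))) := by
    push_cast
    rw [Finset.mul_sum]
    simp_rw [completion hm hm1 hsq]
    rw [Finset.sum_comm]
    refine Finset.sum_congr rfl fun h _ => ?_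
    rw [← Finset.mul_sum, Finset.sum_add_distrib, ← Finset.mul_sum, ← map_sum]
    have : ∑ i ∈ range L, ee (↑h * ↑(A + (i : ℤ)) / ↑n) = ee ((h : ℝ) * A / n) * DK L (h / n) := by
      unfold DK
      rw [Finset.mul_sum]
      refine Finset.sum_congr rfl fun i _ => ?_
      rw [← ee_add]; congr 1; push_cast; ring
    rw [this]
  have hbound : ‖gz n 1 * ((∑ k ∈ range L, jacobiSym (A + k) n : ℤ) : ℂ)‖ ≤ n * (1 + Real.log n) := by
    rw [key]
    have jle : ∀ (x : ℤ), ‖((jacobiSym x n : ℤ) : ℂ)‖ ≤ 1 := by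
      intro x
      rcases jacobiSym.trichotomy x n with h | h | h <;> rw [h] <;> simp
    calc _ ≤ ∑ h ∈ Icc 1 m, (n : ℝ) * (1 / h) := by
          refine (norm_sum_le _ _).trans (Finset.sum_le_sum fun h hh => ?_)
          simp only [mem_Icc] at hh
          have hhpos : (0 : ℝ) < h := by exact_mod_cast hh.1
          have hd := norm_DK_le' L (θ := h / n) (by positivity) (by
            rw [div_le_div_iff₀ hnpos (by norm_num)]
            have : h * 2 ≤ 1 * n := by omega
            exact_mod_cast this)
          rw [norm_mul]
          have e : ‖ee ((h : ℝ) * A / n) * DK L (h / n)‖ ≤ 1 / (2 * (h / n)) := by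
            rw [norm_mul, norm_ee, one_mul]; exact hd
          calc _ ≤ 1 * (1 / (2 * ((h : ℝ) / n)) + 1 * (1 / (2 * ((h : ℝ) / n)))) := by
                refine mul_le_mul (jle _) ?_ (norm_nonneg _) zero_le_one
                refine (norm_add_le _ _).trans (add_le_add e ?_)
                rw [norm_mul, RCLike.norm_conj]
                exact mul_le_mul (jle _) e (norm_nonneg _) zero_le_one
            _ = _ := by field_simp; norm_num
      _ ≤ n * (1 + Real.log n) := by
          rw [← Finset.mul_sum]
          have := sum_inv_le m
          have h2 : Real.log m ≤ Real.log n := by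
            apply Real.log_le_log (by exact_mod_cast hm1)
            exact_mod_cast (by omega : m ≤ n)
          gcongr; linarith
  rw [norm_mul, hg', Complex.norm_intCast] at hbound
  have hs : (0 : ℝ) < √n := Real.sqrt_pos.mpr hnpos
  have : √n * |((∑ k ∈ range L, jacobiSym (A + k) n : ℤ) : ℝ)| ≤ √n * (√n * (1 + Real.log n)) := by
    rw [← mul_assoc, Real.mul_self_sqrt hnpos.le]; exact hbound
  exact le_of_mul_le_mul_left this hs

lemma jac_abs_le (a : ℤ) (b : ℕ) : |jacobiSym a b| ≤ 1 := by
  rcases jacobiSym.trichotomy a b with h | h | h <;> rw [h] <;> simp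

lemma jac_prime_sq (x : ℕ) {p : ℕ} (hp : p.Prime) :
    jacobiSym x (p * p) = if p ∣ x then 0 else 1 := by
  have : NeZero p := ⟨hp.ne_zero⟩
  rw [jacobiSym.mul_right]
  split_ifs with h
  · have : jacobiSym x p = 0 := by
      rw [jacobiSym.eq_zero_iff_not_coprime, Int.gcd_natCast_natCast]
      intro hc
      rw [Nat.gcd_eq_right h] at hc
      exact hp.one_lt.ne' hc
    rw [this]; simp
  · rw [← sq]
    apply jacobiSym.sq_one
    rw [Int.gcd_natCast_natCast]
    exact ((Nat.Prime.coprime_iff_not_dvd hp).mpr h).symm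

/-- PV for `m = m₀ b²`. -/
lemma pv_gen {m₀ : ℕ} (hn : Odd m₀) (hsq : Squarefree m₀) (h1 : 1 < m₀) (b : ℕ) (hb : b ≠ 0) :
    ∀ X : ℕ, |((∑ x ∈ range X, jacobiSym x (m₀ * (b * b)) : ℤ) : ℝ)| ≤
      b * (√m₀ * (1 + Real.log m₀)) := by
  revert hb
  induction b using induction_on_primes with
  | zero => intro h; exact absurd rfl h
  | one =>
    intro _ X
    have := pv hn hsq h1 X 0
    simpa using this
  | prime_mul p b hp ih =>
    intro hb X
    have hb0 : b ≠ 0 := by rintro rfl; simp at hb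
    have ih := ih hb0
    have : NeZero (m₀ * (b * b)) := ⟨by
      have : m₀ ≠ 0 := by omega
      positivity⟩
    have : NeZero (p * p) := ⟨by have := hp.ne_zero; positivity⟩
    set m := m₀ * (b * b) with hm
    have hmm : m₀ * (p * b * (p * b)) = m * (p * p) := by rw [hm]; ring
    rw [hmm]
    have hsum : ∑ x ∈ range X, jacobiSym x (m * (p * p)) =
        ∑ x ∈ range X, jacobiSym x m - jacobiSym p m * ∑ y ∈ range ((X + p - 1) / p), jacobiSym y m := by
      have e1 : ∀ x : ℕ, jacobiSym x (m * (p * p)) = jacobiSym x m - if p ∣ x then jacobiSym x m else 0 := by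
        intro x
        rw [jacobiSym.mul_right, jac_prime_sq x hp]
        split_ifs <;> simp
      simp_rw [e1]
      rw [Finset.sum_sub_distrib]
      congr 1
      rw [← Finset.sum_filter, Finset.mul_sum]
      symm
      apply Finset.sum_bij (fun y _ => p * y)
      · intro y hy
        simp only [mem_range, mem_filter, dvd_mul_right, and_true] at hy ⊢
        have := (Nat.le_div_iff_mul_le hp.pos).mp (Nat.succ_le_of_lt hy)
        have := hp.pos
        have h3 : (y.succ) * p = p * y + p := by rw [Nat.succ_mul]; ring
        omega
      · intro a _ b _ h
        exact Nat.eq_of_mul_eq_mul_left hp.pos h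
      · intro x hx
        simp only [mem_range, mem_filter] at hx
        obtain ⟨hx, y, rfl⟩ := hx
        refine ⟨y, ?_, rfl⟩
        simp only [mem_range]
        apply Nat.lt_of_succ_le
        rw [Nat.le_div_iff_mul_le hp.pos]
        have h3 : (y.succ) * p = p * y + p := by rw [Nat.succ_mul]; ring
        have := hp.pos
        omega
      · intro y _
        push_cast
        rw [jacobiSym.mul_left]
    rw [hsum]
    have b1 := ih X
    have b2 := ih ((X + p - 1) / p)
    have b3 : |((jacobiSym p m : ℤ) : ℝ)| ≤ 1 := by exact_mod_cast jac_abs_le p m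
    have hp2 : (2 : ℝ) ≤ p := by exact_mod_cast hp.two_le
    have hnn : (0 : ℝ) ≤ b * (√m₀ * (1 + Real.log m₀)) := (abs_nonneg _).trans b1
    rw [Int.cast_sub, Int.cast_mul]
    calc _ ≤ _ := abs_sub _ _
      _ ≤ b * (√m₀ * (1 + Real.log m₀)) + 1 * (b * (√m₀ * (1 + Real.log m₀))) := by
        rw [abs_mul]
        gcongr
      _ ≤ p * (b * (√m₀ * (1 + Real.log m₀))) := by nlinarith
      _ = _ := by push_cast; ring

/-- PV for odd nonsquare `g`, summing over odd `x`. -/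
lemma pv_odd {g : ℕ} (hn : Odd g) (hns : ¬ IsSquare g) (A B : ℕ) (hAB : A ≤ B) :
    |((∑ x ∈ Ico A B, jacobiSym x (4 * g) : ℤ) : ℝ)| ≤ 4 * √g * (1 + Real.log g) := by
  obtain ⟨a, b, hab, hsq⟩ := Nat.sq_mul_squarefree g
  have hg0 : g ≠ 0 := by rintro rfl; exact hns ⟨0, rfl⟩
  have hb0 : b ≠ 0 := by rintro rfl; simp at hab; exact hg0 hab.symm
  have ha : Odd a := by
    rw [← hab] at hn; exact (Nat.odd_mul.mp hn).2
  have ha1 : 1 < a := by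
    rcases Nat.lt_trichotomy a 1 with h | h | h
    · interval_cases a; simp at hab; exact absurd hab.symm hg0
    · subst h; exact absurd ⟨b, by rw [← hab]; ring⟩ hns
    · exact h
  have key := pv_gen ha hsq ha1 (2 * b) (by positivity)
  have e : a * (2 * b * (2 * b)) = 4 * g := by rw [← hab]; ring
  rw [e] at key
  rw [Finset.sum_Ico_eq_sub _ hAB, Int.cast_sub]
  have k1 := key A
  have k2 := key B
  have hsg : √(g : ℝ) = b * √a := by
    rw [← hab]; push_cast; rw [Real.sqrt_mul (by positivity), Real.sqrt_sq (by positivity)]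
  have hlog : Real.log a ≤ Real.log g := by
    apply Real.log_le_log (by exact_mod_cast (by omega : 0 < a))
    have : a ≤ g := Nat.le_of_dvd (Nat.pos_of_ne_zero hg0) ⟨b ^ 2, by rw [← hab]; ring⟩
    exact_mod_cast this
  have : (2 * b : ℕ) * (√(a : ℝ) * (1 + Real.log a)) ≤ 2 * √g * (1 + Real.log g) := by
    rw [hsg]; push_cast
    have : 0 ≤ 2 * (b : ℝ) * √a := by positivity
    nlinarith
  calc _ ≤ _ := abs_sub _ _
    _ ≤ 2 * √g * (1 + Real.log g) + 2 * √g * (1 + Real.log g) := by linarith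
    _ = _ := by ring

end CNM


namespace CNM

open Finset

lemma sqfree_eq {a b c : ℕ} (ha : Squarefree a) (hb : Squarefree b) (h : a * b = c * c) : a = b := by
  have h1 : a ∣ c := by
    rw [← ha.dvd_pow_iff_dvd (n := 2) (by norm_num)]
    exact ⟨b, by rw [sq, h]⟩
  obtain ⟨e, rfl⟩ := h1
  have ha0 : 0 < a := Nat.pos_of_ne_zero ha.ne_zero
  have h2 : b = a * (e * e) := by
    apply Nat.eq_of_mul_eq_mul_left ha0; rw [h]; ring
  have h3 := hb e ⟨a, by rw [h2]; ring⟩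
  rw [Nat.isUnit_iff] at h3
  subst h3; simpa using h2.symm

lemma sqpair (G : ℕ) : ∑ g₁ ∈ Icc 1 G, ∑ g₂ ∈ Icc 1 G,
    (if IsSquare (g₁ * g₂) then 1 / (√(g₁ : ℝ) * √(g₂ : ℝ)) else 0) ≤ (1 + Real.log G) ^ 3 := by
  have hex : ∀ g : ℕ, ∃ x : ℕ × ℕ, x.2 ^ 2 * x.1 = g ∧ Squarefree x.1 := fun g => by
    obtain ⟨a, b, h⟩ := Nat.sq_mul_squarefree g; exact ⟨(a, b), h⟩
  choose ab h1 h2 using hex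
  rw [← Finset.sum_product', ← Finset.sum_filter]
  set S := ((Icc 1 G) ×ˢ (Icc 1 G)).filter (fun x => IsSquare (x.1 * x.2)) with hS
  let F : ℕ × ℕ → ℕ × ℕ × ℕ := fun x => ((ab x.1).1, (ab x.1).2, (ab x.2).2)
  have heq : ∀ x ∈ S, (ab x.1).1 = (ab x.2).1 := by
    intro x hx
    simp only [hS, mem_filter, mem_product, mem_Icc] at hx
    obtain ⟨⟨⟨hx1, _⟩, hx2, _⟩, c, hc⟩ := hx
    have e1 := h1 x.1
    have e2 := h1 x.2
    set a1 := (ab x.1).1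
    set b1 := (ab x.1).2
    set a2 := (ab x.2).1
    set b2 := (ab x.2).2
    have hb1 : b1 ≠ 0 := by rintro h; rw [h] at e1; simp at e1; omega
    have hb2 : b2 ≠ 0 := by rintro h; rw [h] at e2; simp at e2; omega
    have hd : b1 * b2 ∣ c := by
      rw [← Nat.pow_dvd_pow_iff (n := 2) (by norm_num)]
      refine ⟨a1 * a2, ?_⟩
      rw [sq c, ← hc, ← e1, ← e2]; ring
    obtain ⟨e, rfl⟩ := hd
    apply sqfree_eq (h2 _) (h2 _) (c := e)
    have : 0 < (b1 * b2) ^ 2 := by positivity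
    apply Nat.eq_of_mul_eq_mul_left this
    rw [← e1, ← e2] at hc
    calc _ = b1 ^ 2 * a1 * (b2 ^ 2 * a2) := by ring
      _ = _ := by rw [hc]; ring
  have hinj : Set.InjOn F S := by
    intro x hx y hy hxy
    have ex := heq x hx
    have ey := heq y hy
    simp only [F, Prod.mk.injEq] at hxy
    obtain ⟨p1, p2, p3⟩ := hxy
    apply Prod.ext
    · rw [← h1 x.1, ← h1 y.1, p1, p2]
    · rw [← h1 x.2, ← h1 y.2, ← ex, ← ey, p1, p3]
  have hval : ∀ x ∈ S, 1 / (√(x.1 : ℝ) * √(x.2 : ℝ)) =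
      (fun z : ℕ × ℕ × ℕ => (1 / (z.1 : ℝ)) * ((1 / (z.2.1 : ℝ)) * (1 / (z.2.2 : ℝ)))) (F x) := by
    intro x hx
    have ex := heq x hx
    have e1 := h1 x.1
    have e2 := h1 x.2
    simp only [F]
    rw [← ex] at e2
    set a1 := (ab x.1).1
    set b1 := (ab x.1).2
    set b2 := (ab x.2).2
    rw [← e1, ← e2]
    push_cast
    rw [Real.sqrt_mul (by positivity), Real.sqrt_mul (by positivity), Real.sqrt_sq (by positivity),
      Real.sqrt_sq (by positivity)]
    have : √(a1 : ℝ) * √a1 = a1 := Real.mul_self_sqrt (by positivity)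
    rw [show (b1 : ℝ) * √a1 * (b2 * √a1) = (√a1 * √a1) * (b1 * b2) by ring, this]
    ring
  rw [Finset.sum_congr rfl hval, ← Finset.sum_image (f := fun z : ℕ × ℕ × ℕ => (1 / (z.1 : ℝ)) * ((1 / (z.2.1 : ℝ)) * (1 / (z.2.2 : ℝ)))) hinj]
  have hsub : S.image F ⊆ (Icc 1 G) ×ˢ (Icc 1 G) ×ˢ (Icc 1 G) := by
    intro z hz
    rw [Finset.mem_image] at hz
    obtain ⟨x, hx, rfl⟩ := hz
    simp only [hS, mem_filter, mem_product, mem_Icc] at hx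
    obtain ⟨⟨⟨hx1, hx1'⟩, hx2, hx2'⟩, _⟩ := hx
    have aux : ∀ g : ℕ, 1 ≤ g → g ≤ G → ((1 ≤ (ab g).1 ∧ (ab g).1 ≤ G) ∧ (1 ≤ (ab g).2 ∧ (ab g).2 ≤ G)) := by
      intro g hg hgG
      have e := h1 g
      have ha : 0 < (ab g).1 := Nat.pos_of_ne_zero (h2 g).ne_zero
      have hb : 0 < (ab g).2 := Nat.pos_of_ne_zero (by rintro h; rw [h] at e; simp at e; omega)
      have : (ab g).1 ≤ g := Nat.le_of_dvd hg ⟨_, by rw [mul_comm]; exact e.symm⟩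
      have : (ab g).2 ≤ g := Nat.le_of_dvd hg ⟨(ab g).2 * (ab g).1, by rw [← mul_assoc, ← sq]; exact e.symm⟩
      omega
    simp only [F, mem_product, mem_Icc]
    exact ⟨(aux _ hx1 hx1').1, (aux _ hx1 hx1').2, (aux _ hx2 hx2').2⟩
  refine (Finset.sum_le_sum_of_subset_of_nonneg hsub (fun _ _ _ => by positivity)).trans ?_
  rw [Finset.sum_product]
  simp_rw [← Finset.mul_sum]
  rw [← Finset.sum_mul]
  have : ∑ i ∈ Icc 1 G ×ˢ Icc 1 G, (1 / (i.1 : ℝ)) * (1 / (i.2 : ℝ)) =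
      (∑ i ∈ Icc 1 G, (1 / (i : ℝ))) * (∑ i ∈ Icc 1 G, (1 / (i : ℝ))) := by
    rw [Finset.sum_product, Finset.sum_mul_sum]
  rw [this]
  have hh := sum_inv_le G
  have hnn : 0 ≤ ∑ i ∈ Icc 1 G, (1 / (i : ℝ)) := Finset.sum_nonneg fun _ _ => by positivity
  calc _ = (∑ i ∈ Icc 1 G, (1 / (i : ℝ))) ^ 3 := by ring
    _ ≤ _ := by gcongr

lemma abel_id (c F : ℕ → ℂ) (k : ℕ) : ∑ i ∈ range (k + 1), c i * F i =
    (∑ i ∈ range (k + 1), c i) * F k - ∑ i ∈ range k, (∑ j ∈ range (i + 1), c j) * (F (i + 1) - F i) := by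
  induction k with
  | zero => simp
  | succ k ih =>
    rw [Finset.sum_range_succ (fun i => c i * F i), ih,
      Finset.sum_range_succ (fun i => (∑ j ∈ range (i + 1), c j) * (F (i + 1) - F i)) k,
      Finset.sum_range_succ c (k + 1)]
    ring

lemma abel_bound (c F : ℕ → ℂ) (k : ℕ) {P s v : ℝ} (hP0 : 0 ≤ P) (hs0 : 0 ≤ s) (hv0 : 0 ≤ v)
    (hP : ∀ j ≤ k, ‖∑ i ∈ range j, c i‖ ≤ P) (hs : ∀ i < k, ‖F i‖ ≤ s)
    (hv : ∀ i, i + 1 < k → ‖F (i + 1) - F i‖ ≤ v) :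
    ‖∑ i ∈ range k, c i * F i‖ ≤ P * (s + k * v) := by
  cases k with
  | zero => simp; positivity
  | succ k =>
    rw [abel_id]
    refine (norm_sub_le _ _).trans ?_
    have h1 : ‖(∑ i ∈ range (k + 1), c i) * F k‖ ≤ P * s := by
      rw [norm_mul]
      exact mul_le_mul (hP _ le_rfl) (hs _ (by omega)) (norm_nonneg _) hP0
    have h2 : ‖∑ i ∈ range k, (∑ j ∈ range (i + 1), c j) * (F (i + 1) - F i)‖ ≤ k * (P * v) := by
      refine (norm_sum_le_of_le (f := fun i => (∑ j ∈ range (i + 1), c j) * (F (i + 1) - F i)) (n := fun _ => P * v) _ fun i hi => ?_).trans (by simp)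
      rw [mem_range] at hi
      rw [norm_mul]
      exact mul_le_mul (hP _ (by omega)) (hv _ (by omega)) (norm_nonneg _) hP0
    push_cast
    nlinarith [mul_nonneg hP0 hv0]

lemma jac_recip {g₁ g₂ b n : ℕ} (hb : b % 2 = 1) (h1 : g₁ % 8 = b) (h2 : g₂ % 8 = b) :
    (if Odd n then jacobiSym g₁ n * jacobiSym g₂ n else 0) = jacobiSym n (4 * (g₁ * g₂)) := by
  have : NeZero (g₁ * g₂) := ⟨Nat.mul_ne_zero (by omega) (by omega)⟩
  rw [jacobiSym.mul_right, show 4 = 2 * 2 by norm_num, jac_prime_sq n Nat.prime_two]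
  split_ifs with h3 h4 h4
  · exact absurd (even_iff_two_dvd.mpr h4) (Nat.not_even_iff_odd.mpr h3)
  · rw [one_mul, ← jacobiSym.mul_left]
    have h5 : (g₁ * g₂) % 4 = 1 := by
      have : b < 8 := by omega
      have e1 : g₁ % 4 = b % 4 := by omega
      have e2 : g₂ % 4 = b % 4 := by omega
      rw [Nat.mul_mod, e1, e2]
      have : b % 4 = 1 ∨ b % 4 = 3 := by omega
      rcases this with h | h <;> rw [h]
    have := jacobiSym.quadratic_reciprocity_one_mod_four h5 h3
    push_cast at this
    exact this
  · simp
  · exact absurd (even_iff_two_dvd.mp (Nat.not_odd_iff_even.mp h3)) h4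

/-- nonsquare pairs -/
lemma pair_ns {g₁ g₂ b N : ℕ} (hb : b % 2 = 1) (h1 : g₁ % 8 = b) (h2 : g₂ % 8 = b) (hN : 1 ≤ N)
    (hns : ¬ IsSquare (g₁ * g₂)) (F : ℕ → ℂ) (M : ℕ) {s v : ℝ} (hs0 : 0 ≤ s) (hv0 : 0 ≤ v)
    (hs : ∀ n, N ≤ n → n < 2 * N → M < n → ‖F n‖ ≤ s)
    (hv : ∀ n, N ≤ n → n + 1 < 2 * N → M < n → ‖F (n + 1) - F n‖ ≤ v / N) :
    ‖∑ n ∈ (Ico N (2 * N)).filter (fun n => Odd n ∧ M < n),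
      ((jacobiSym g₁ n * jacobiSym g₂ n : ℤ) : ℂ) * F n‖ ≤
      4 * √(g₁ * g₂ : ℝ) * (1 + Real.log (g₁ * g₂)) * (s + v) := by
  have e : ∑ n ∈ (Ico N (2 * N)).filter (fun n => Odd n ∧ M < n),
      ((jacobiSym g₁ n * jacobiSym g₂ n : ℤ) : ℂ) * F n =
      ∑ n ∈ Ico (max N (M + 1)) (2 * N), ((jacobiSym n (4 * (g₁ * g₂)) : ℤ) : ℂ) * F n := by
    simp_rw [← jac_recip hb h1 h2]
    have : Ico (max N (M + 1)) (2 * N) = (Ico N (2 * N)).filter (fun n => M < n) := by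
      ext x; simp; omega
    rw [this, Finset.sum_filter, Finset.sum_filter]
    refine Finset.sum_congr rfl fun n _ => ?_
    by_cases ho : Odd n <;> by_cases hM : M < n <;> simp [ho, hM]
  have hg : Odd (g₁ * g₂) := Nat.odd_mul.mpr ⟨Nat.odd_iff.mpr (by omega), Nat.odd_iff.mpr (by omega)⟩
  rw [e, Finset.sum_Ico_eq_sum_range]
  set A := max N (M + 1) with hA
  have hNr : (0 : ℝ) < N := by exact_mod_cast hN
  have hlog : 0 ≤ Real.log ((g₁ : ℝ) * g₂) := by
    have := Real.log_natCast_nonneg (g₁ * g₂)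
    push_cast at this; exact this
  have := abel_bound (fun i => ((jacobiSym (A + i : ℕ) (4 * (g₁ * g₂)) : ℤ) : ℂ)) (fun i => F (A + i))
    (2 * N - A) (P := 4 * √(g₁ * g₂ : ℝ) * (1 + Real.log (g₁ * g₂))) (s := s) (v := v / N)
    (by positivity) hs0 (by positivity) ?_ ?_ ?_
  · refine this.trans ?_
    have hk : ((2 * N - A : ℕ) : ℝ) ≤ N := by
      exact_mod_cast (by omega : 2 * N - A ≤ N)
    have : ((2 * N - A : ℕ) : ℝ) * (v / N) ≤ v := by
      calc _ ≤ N * (v / N) := by gcongr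
        _ = v := by field_simp
    gcongr
  · intro j hj
    have := pv_odd hg hns A (A + j) (by omega)
    rw [Finset.sum_Ico_eq_sum_range] at this
    simp only [Nat.add_sub_cancel_left] at this
    rw [← Int.cast_sum, Complex.norm_intCast]
    push_cast at this ⊢
    exact this
  · intro i hi
    exact hs _ (by omega) (by omega) (by omega)
  · intro i hi
    exact hv (A + i) (by omega) (by omega) (by omega)

lemma bilinear {N G b : ℕ} (hN : 1 ≤ N) (hb : b % 2 = 1) (f : ℕ → ℕ → ℂ) (M : ℕ → ℕ)
    {R A B : ℝ} (hR : 0 ≤ R) (hA : 0 ≤ A) (hB : 0 ≤ B)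
    (hS : ∀ g ∈ Icc 1 G, g % 8 = b → ∀ n, N ≤ n → n < 2 * N → M g < n → ‖f g n‖ ≤ R / √g)
    (hs : ∀ g ∈ Icc 1 G, g % 8 = b → ∀ n, N ≤ n → n < 2 * N → M g < n → ‖f g n‖ ≤ A / (g * √g))
    (hv : ∀ g ∈ Icc 1 G, g % 8 = b → ∀ n, N ≤ n → n + 1 < 2 * N → M g < n →
      ‖f g (n + 1) - f g n‖ ≤ B / (g * √g) / N) :
    ∑ n ∈ (Ico N (2 * N)).filter Odd,
      ‖∑ g ∈ (Icc 1 G).filter (fun g => g % 8 = b ∧ M g < n), ((jacobiSym g n : ℤ) : ℂ) * f g n‖ ^ 2 ≤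
    N * R ^ 2 * (1 + Real.log G) ^ 3 +
      8 * (A ^ 2 + 2 * A * B) * (1 + Real.log G) ^ 3 := by
  have hNr : (0 : ℝ) < N := by exact_mod_cast hN
  set 𝒢 := (Icc 1 G).filter (fun g => g % 8 = b) with h𝒢
  let F : ℕ → ℕ → ℕ → ℂ := fun g₁ g₂ n => f g₁ n * (starRingEnd ℂ) (f g₂ n)
  let E : ℕ → ℕ → ℂ := fun g₁ g₂ => ∑ n ∈ (Ico N (2 * N)).filter (fun n => Odd n ∧ max (M g₁) (M g₂) < n),
      ((jacobiSym g₁ n * jacobiSym g₂ n : ℤ) : ℂ) * F g₁ g₂ n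
  have hexp : ((∑ n ∈ (Ico N (2 * N)).filter Odd,
      ‖∑ g ∈ (Icc 1 G).filter (fun g => g % 8 = b ∧ M g < n), ((jacobiSym g n : ℤ) : ℂ) * f g n‖ ^ 2 : ℝ) : ℂ)
      = ∑ g₁ ∈ 𝒢, ∑ g₂ ∈ 𝒢, E g₁ g₂ := by
    push_cast
    have e1 : ∀ n, (((‖∑ g ∈ (Icc 1 G).filter (fun g => g % 8 = b ∧ M g < n), ((jacobiSym g n : ℤ) : ℂ) * f g n‖ : ℝ) : ℂ) ^ 2)
       = ∑ g₁ ∈ 𝒢, ∑ g₂ ∈ 𝒢, if max (M g₁) (M g₂) < n then ((jacobiSym g₁ n * jacobiSym g₂ n : ℤ) : ℂ) * F g₁ g₂ n else 0 := by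
      intro n
      rw [← Complex.mul_conj', ← Finset.filter_filter, Finset.sum_filter, map_sum, Finset.sum_mul_sum]
      refine Finset.sum_congr rfl fun g₁ _ => Finset.sum_congr rfl fun g₂ _ => ?_
      by_cases m1 : M g₁ < n <;> by_cases m2 : M g₂ < n <;> simp [m1, m2, F]
      ring
    simp_rw [e1]
    rw [Finset.sum_comm]
    refine Finset.sum_congr rfl fun g₁ _ => ?_
    rw [Finset.sum_comm]
    refine Finset.sum_congr rfl fun g₂ _ => ?_
    simp only [E]
    rw [← Finset.sum_filter, Finset.filter_filter]
  have hG0 : 0 ≤ Real.log G := Real.log_natCast_nonneg G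
  have hE : ∀ g₁ ∈ 𝒢, ∀ g₂ ∈ 𝒢, ‖E g₁ g₂‖ ≤
      N * R ^ 2 * (if IsSquare (g₁ * g₂) then 1 / (√(g₁ : ℝ) * √(g₂ : ℝ)) else 0) +
      8 * (1 + Real.log G) * (A ^ 2 + 2 * A * B) * (1 / (g₁ : ℝ) * (1 / g₂)) := by
    intro g₁ hg₁ g₂ hg₂
    simp only [h𝒢, mem_filter] at hg₁ hg₂
    obtain ⟨m1, b1⟩ := hg₁
    obtain ⟨m2, b2⟩ := hg₂
    have q1 : (1 : ℝ) ≤ g₁ := by exact_mod_cast (mem_Icc.mp m1).1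
    have q2 : (1 : ℝ) ≤ g₂ := by exact_mod_cast (mem_Icc.mp m2).1
    have r1 : (g₁ : ℝ) ≤ G := by exact_mod_cast (mem_Icc.mp m1).2
    have r2 : (g₂ : ℝ) ≤ G := by exact_mod_cast (mem_Icc.mp m2).2
    have s1 : 0 < √(g₁ : ℝ) := Real.sqrt_pos.mpr (by linarith)
    have s2 : 0 < √(g₂ : ℝ) := Real.sqrt_pos.mpr (by linarith)
    by_cases hsq : IsSquare (g₁ * g₂)
    · rw [if_pos hsq]
      have : ‖E g₁ g₂‖ ≤ N * R ^ 2 * (1 / (√(g₁ : ℝ) * √(g₂ : ℝ))) := by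
        have hterm : ∀ n ∈ (Ico N (2 * N)).filter (fun n => Odd n ∧ max (M g₁) (M g₂) < n),
            ‖((jacobiSym g₁ n * jacobiSym g₂ n : ℤ) : ℂ) * F g₁ g₂ n‖ ≤ R ^ 2 * (1 / (√(g₁ : ℝ) * √(g₂ : ℝ))) := by
          intro n hn
          simp only [mem_filter, mem_Ico] at hn
          obtain ⟨⟨n1, n2⟩, _, n3⟩ := hn
          have u1 := hS g₁ m1 b1 n n1 n2 (by omega)
          have u2 := hS g₂ m2 b2 n n1 n2 (by omega)
          rw [norm_mul, Complex.norm_intCast]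
          have j : |((jacobiSym g₁ n * jacobiSym g₂ n : ℤ) : ℝ)| ≤ 1 := by
            rw [← jacobiSym.mul_left]; exact_mod_cast jac_abs_le _ _
          simp only [F, norm_mul, RCLike.norm_conj]
          calc _ ≤ 1 * ((R / √g₁) * (R / √g₂)) := by gcongr
            _ = _ := by field_simp
        refine (norm_sum_le_of_le _ hterm).trans ?_
        rw [Finset.sum_const, nsmul_eq_mul, mul_assoc]
        gcongr
        refine (Finset.card_filter_le _ _).trans ?_
        simp; omega
      refine this.trans (le_add_of_nonneg_right (by positivity))
    · rw [if_neg hsq, mul_zero, zero_add]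
      have := pair_ns hb b1 b2 hN hsq (F g₁ g₂) (max (M g₁) (M g₂))
        (s := A / (g₁ * √g₁) * (A / (g₂ * √g₂)))
        (v := A / (g₁ * √g₁) * (B / (g₂ * √g₂)) + (B / (g₁ * √g₁)) * (A / (g₂ * √g₂)))
        (by positivity) (by positivity) ?_ ?_
      · refine this.trans ?_
        have hl : Real.log ((g₁ : ℝ) * g₂) ≤ 2 * Real.log G := by
          rw [Real.log_mul (by positivity) (by positivity)]
          have := Real.log_le_log (by linarith) r1
          have := Real.log_le_log (by linarith) r2
          linarith
        rw [Real.sqrt_mul (by linarith)]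
        calc _ = 4 * (1 + Real.log ((g₁ : ℝ) * g₂)) * ((A ^ 2 + 2 * A * B) * (1 / (g₁ : ℝ) * (1 / g₂))) := by
              field_simp; ring
          _ ≤ 8 * (1 + Real.log G) * ((A ^ 2 + 2 * A * B) * (1 / (g₁ : ℝ) * (1 / g₂))) := by
              gcongr ?_ * _
              linarith
          _ = _ := by ring
      · intro n n1 n2 n3
        simp only [F, norm_mul, RCLike.norm_conj]
        exact mul_le_mul (hs g₁ m1 b1 n n1 n2 (by omega)) (hs g₂ m2 b2 n n1 n2 (by omega)) (norm_nonneg _) (by positivity)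
      · intro n n1 n2 n3
        have e : F g₁ g₂ (n + 1) - F g₁ g₂ n = f g₁ (n + 1) * (starRingEnd ℂ) (f g₂ (n + 1) - f g₂ n)
          + (f g₁ (n + 1) - f g₁ n) * (starRingEnd ℂ) (f g₂ n) := by
          simp only [F, map_sub]; ring
        rw [e]
        refine (norm_add_le _ _).trans ?_
        rw [norm_mul, norm_mul, RCLike.norm_conj, RCLike.norm_conj, add_div, mul_div_assoc]
        have t1 := hs g₁ m1 b1 (n + 1) (by omega) (by omega) (by omega)
        have t2 := hs g₂ m2 b2 n n1 (by omega) (by omega)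
        have t3 := hv g₁ m1 b1 n n1 n2 (by omega)
        have t4 := hv g₂ m2 b2 n n1 n2 (by omega)
        refine add_le_add (mul_le_mul t1 t4 (norm_nonneg _) (by positivity)) ?_
        calc _ ≤ B / (g₁ * √g₁) / N * (A / (g₂ * √g₂)) := mul_le_mul t3 t2 (norm_nonneg _) (by positivity)
          _ = _ := by ring
  have h1 : ∑ n ∈ (Ico N (2 * N)).filter Odd,
      ‖∑ g ∈ (Icc 1 G).filter (fun g => g % 8 = b ∧ M g < n), ((jacobiSym g n : ℤ) : ℂ) * f g n‖ ^ 2 ≤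
      ∑ g₁ ∈ 𝒢, ∑ g₂ ∈ 𝒢, ‖E g₁ g₂‖ := by
    have h0 : 0 ≤ ∑ n ∈ (Ico N (2 * N)).filter Odd,
      ‖∑ g ∈ (Icc 1 G).filter (fun g => g % 8 = b ∧ M g < n), ((jacobiSym g n : ℤ) : ℂ) * f g n‖ ^ 2 :=
      Finset.sum_nonneg fun _ _ => by positivity
    rw [← Complex.norm_of_nonneg h0, hexp]
    refine (norm_sum_le _ _).trans (Finset.sum_le_sum fun _ _ => norm_sum_le _ _)
  refine h1.trans ((Finset.sum_le_sum fun g₁ hg₁ => Finset.sum_le_sum fun g₂ hg₂ => hE g₁ hg₁ g₂ hg₂).trans ?_)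
  have hsub : 𝒢 ⊆ Icc 1 G := Finset.filter_subset _ _
  have nn : ∀ g₁ g₂ : ℕ, 0 ≤ N * R ^ 2 * (if IsSquare (g₁ * g₂) then 1 / (√(g₁ : ℝ) * √(g₂ : ℝ)) else 0) +
      8 * (1 + Real.log G) * (A ^ 2 + 2 * A * B) * (1 / (g₁ : ℝ) * (1 / g₂)) := by
    intro g₁ g₂
    have : 0 ≤ (if IsSquare (g₁ * g₂) then 1 / (√(g₁ : ℝ) * √(g₂ : ℝ)) else 0) := by
      split_ifs <;> positivity
    positivity
  calc _ ≤ ∑ g₁ ∈ Icc 1 G, ∑ g₂ ∈ Icc 1 G, (N * R ^ 2 * (if IsSquare (g₁ * g₂) then 1 / (√(g₁ : ℝ) * √(g₂ : ℝ)) else 0) +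
      8 * (1 + Real.log G) * (A ^ 2 + 2 * A * B) * (1 / (g₁ : ℝ) * (1 / g₂))) := by
        refine (Finset.sum_le_sum fun g₁ _ => Finset.sum_le_sum_of_subset_of_nonneg hsub fun g₂ _ _ => nn g₁ g₂).trans ?_
        exact Finset.sum_le_sum_of_subset_of_nonneg hsub fun g₁ _ _ => Finset.sum_nonneg fun g₂ _ => nn g₁ g₂
    _ ≤ N * R ^ 2 * (1 + Real.log G) ^ 3 + 8 * (1 + Real.log G) * (A ^ 2 + 2 * A * B) * ((1 + Real.log G) * (1 + Real.log G)) := by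
        simp_rw [Finset.sum_add_distrib, ← Finset.mul_sum]
        rw [← Finset.sum_mul]
        have hh := sum_inv_le G
        have hnn : 0 ≤ ∑ i ∈ Icc 1 G, (1 / (i : ℝ)) := Finset.sum_nonneg fun _ _ => by positivity
        have := sqpair G
        gcongr
    _ = _ := by ring

end CNM


namespace CNM

open Finset

noncomputable def phi (a L H : ℕ) (θ : ℝ) : ℂ := ee (a * θ / 8) * DK L θ * (DK H θ / H) ^ 2

lemma DKH_le_one {H : ℕ} (hH : 1 ≤ H) (θ : ℝ) : ‖DK H θ / H‖ ≤ 1 := by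
  rw [norm_div, Complex.norm_natCast, div_le_one (by exact_mod_cast hH)]
  exact norm_DK_le H θ

lemma DKH_le {H : ℕ} (hH : 1 ≤ H) {θ θ₀ : ℝ} (h0 : 0 < θ₀) (h1 : θ₀ ≤ θ) (h2 : θ ≤ 1 / 2) :
    ‖DK H θ / H‖ ≤ min 1 (1 / (2 * θ₀ * H)) := by
  have hH' : (0 : ℝ) < H := by exact_mod_cast hH
  refine le_min (DKH_le_one hH θ) ?_
  rw [norm_div, Complex.norm_natCast, div_le_iff₀ hH']
  refine (norm_DK_le' H (h0.trans_le h1) h2).trans ?_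
  calc 1 / (2 * θ) ≤ 1 / (2 * θ₀) := by gcongr
    _ = _ := by field_simp

lemma phi_le1 {a L H : ℕ} (hH : 1 ≤ H) {θ : ℝ} (h0 : 0 < θ) (h2 : θ ≤ 1 / 2) :
    ‖phi a L H θ‖ ≤ √(L / (2 * θ)) := by
  unfold phi
  rw [norm_mul, norm_mul, norm_ee, one_mul, norm_pow]
  have h3 : ‖DK H θ / H‖ ^ 2 ≤ 1 := pow_le_one₀ (norm_nonneg _) (DKH_le_one hH θ)
  have h4 : ‖DK L θ‖ ≤ √(L / (2 * θ)) := by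
    apply Real.le_sqrt_of_sq_le
    rw [sq]
    calc _ ≤ (L : ℝ) * (1 / (2 * θ)) := mul_le_mul (norm_DK_le L θ) (norm_DK_le' L h0 h2) (norm_nonneg _) (by positivity)
      _ = _ := by ring
  calc _ ≤ √(L / (2 * θ)) * 1 := mul_le_mul h4 h3 (by positivity) (by positivity)
    _ = _ := mul_one _

lemma phi_le2 {a L H : ℕ} (hH : 1 ≤ H) {θ θ₀ : ℝ} (h0 : 0 < θ₀) (h1 : θ₀ ≤ θ) (h2 : θ ≤ 1 / 2) :
    ‖phi a L H θ‖ ≤ 1 / (2 * θ₀) * (min 1 (1 / (2 * θ₀ * H))) ^ 2 := by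
  unfold phi
  rw [norm_mul, norm_mul, norm_ee, one_mul, norm_pow]
  have h3 := DKH_le hH h0 h1 h2
  have h4 : ‖DK L θ‖ ≤ 1 / (2 * θ₀) := (norm_DK_le' L (h0.trans_le h1) h2).trans (by gcongr)
  gcongr

lemma phi_diff {a L H : ℕ} (hH : 1 ≤ H) (hHL : H ≤ L) (ha : a ≤ 8) {θ θ' θ₀ δ : ℝ} (h0 : 0 < θ₀) (h1 : θ₀ ≤ θ) (h2 : θ ≤ 1 / 2)
    (h1' : θ₀ ≤ θ') (h2' : θ' ≤ 1 / 2) (hd : |θ - θ'| ≤ δ) :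
    ‖phi a L H θ - phi a L H θ'‖ ≤ 4 * Real.pi * (L * δ / θ₀) * (min 1 (1 / (2 * θ₀ * H))) ^ 2 := by
  have hH' : (0 : ℝ) < H := by exact_mod_cast hH
  have hHL' : (H : ℝ) ≤ L := by exact_mod_cast hHL
  have hL' : (0 : ℝ) < L := hH'.trans_le hHL'
  have hδ : 0 ≤ δ := (abs_nonneg _).trans hd
  set q := min 1 (1 / (2 * θ₀ * H)) with hq
  have hq0 : 0 < q := lt_min one_pos (by positivity)
  have hq1 : q ≤ 1 := min_le_left _ _
  set e1 := ee (a * θ / 8)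
  set e2 := ee (a * θ' / 8)
  set d1 := DK L θ
  set d2 := DK L θ'
  set c1 := DK H θ / H with hc1
  set c2 := DK H θ' / H with hc2
  have key : phi a L H θ - phi a L H θ' =
      (e1 - e2) * d1 * c1 ^ 2 + e2 * (d1 - d2) * c1 ^ 2 + e2 * d2 * ((c1 - c2) * (c1 + c2)) := by
    simp only [phi]; ring
  have n1 : ‖c1‖ ≤ q := DKH_le hH h0 h1 h2
  have n2 : ‖c2‖ ≤ q := DKH_le hH h0 h1' h2'
  have n3 : ‖d1 - d2‖ ≤ Real.pi * L * δ / θ₀ := norm_DK_sub L h0 h1 h2 hd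
  have n4 : ‖c1 - c2‖ ≤ Real.pi * δ / θ₀ := by
    have := norm_DK_sub H h0 h1 h2 hd
    rw [hc1, hc2, ← sub_div, norm_div, Complex.norm_natCast, div_le_iff₀ hH']
    calc _ ≤ _ := this
      _ = _ := by ring
  have n5 : ‖e1 - e2‖ ≤ 2 * Real.pi * δ := by
    refine (norm_ee_sub _ _).trans ?_
    have : |(a : ℝ) * θ / 8 - a * θ' / 8| ≤ δ := by
      rw [show (a : ℝ) * θ / 8 - a * θ' / 8 = (a / 8) * (θ - θ') by ring, abs_mul]
      have : |(a : ℝ) / 8| ≤ 1 := by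
        rw [abs_of_nonneg (by positivity)]
        have : (a : ℝ) ≤ 8 := by exact_mod_cast ha
        linarith
      calc _ ≤ 1 * δ := mul_le_mul this hd (abs_nonneg _) zero_le_one
        _ = δ := one_mul _
    have := Real.pi_pos
    gcongr
  have dq : ∀ x, θ₀ ≤ x → x ≤ 1 / 2 → ‖DK L x‖ ≤ L * q := by
    intro x hx hx'
    rw [hq, mul_min_of_nonneg _ _ hL'.le, mul_one]
    refine le_min (norm_DK_le L x) ((norm_DK_le' L (h0.trans_le hx) hx').trans ?_)
    calc 1 / (2 * x) ≤ 1 / (2 * θ₀) := by gcongr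
      _ = H * (1 / (2 * θ₀ * H)) := by field_simp
      _ ≤ _ := by gcongr
  have n6 : ‖d1‖ ≤ L := norm_DK_le L θ
  have n7 : ‖d2‖ ≤ L * q := dq θ' h1' h2'
  rw [key]
  have pp := Real.pi_pos
  have hθ : 1 ≤ 1 / (2 * θ₀) := by
    rw [le_div_iff₀ (by positivity)]; linarith
  have t1 : ‖(e1 - e2) * d1 * c1 ^ 2‖ ≤ Real.pi * (L * δ / θ₀) * q ^ 2 := by
    rw [norm_mul, norm_mul, norm_pow]
    calc _ ≤ 2 * Real.pi * δ * L * q ^ 2 := by gcongr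
      _ ≤ 2 * Real.pi * δ * L * q ^ 2 * (1 / (2 * θ₀)) := le_mul_of_one_le_right (by positivity) hθ
      _ = _ := by field_simp
  have t2 : ‖e2 * (d1 - d2) * c1 ^ 2‖ ≤ Real.pi * (L * δ / θ₀) * q ^ 2 := by
    rw [norm_mul, norm_mul, norm_pow, norm_ee, one_mul]
    calc _ ≤ Real.pi * L * δ / θ₀ * q ^ 2 := by gcongr
      _ = _ := by ring
  have t3 : ‖e2 * d2 * ((c1 - c2) * (c1 + c2))‖ ≤ 2 * (Real.pi * (L * δ / θ₀) * q ^ 2) := by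
    rw [norm_mul, norm_mul, norm_ee, one_mul, norm_mul]
    have : ‖c1 + c2‖ ≤ q + q := (norm_add_le _ _).trans (add_le_add n1 n2)
    calc _ ≤ (L * q) * (Real.pi * δ / θ₀ * (q + q)) := by gcongr
      _ = _ := by ring
  have := norm_add₃_le (a := (e1 - e2) * d1 * c1 ^ 2) (b := e2 * (d1 - d2) * c1 ^ 2) (c := e2 * d2 * ((c1 - c2) * (c1 + c2)))
  linarith

/-- class sum -/
noncomputable def SS (a L H N k b n : ℕ) : ℂ :=
  ∑ g ∈ (Icc 1 N).filter (fun g => g % 8 = b ∧ 2 ^ (k + 1) * g < n),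
    ((jacobiSym g n : ℤ) : ℂ) * phi a L H (2 ^ k * g / n)

lemma class_bound {a L H N k b : ℕ} (hN : 1 ≤ N) (hb : b % 2 = 1) (hH : 1 ≤ H) (hHL : H ≤ L) (ha : a ≤ 8)
    (hNLH : N ≤ L * H) :
    ∑ n ∈ (Ico N (2 * N)).filter Odd, ‖SS a L H N k b n‖ ^ 2 ≤
      (23 * N * L / √H * (1 + Real.log N) ^ 2) ^ 2 := by
  have hH' : (0 : ℝ) < H := by exact_mod_cast hH
  have hH1 : (1 : ℝ) ≤ H := by exact_mod_cast hH
  have hHL' : (H : ℝ) ≤ L := by exact_mod_cast hHL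
  have hL' : (0 : ℝ) < L := hH'.trans_le hHL'
  have hN' : (0 : ℝ) < N := by exact_mod_cast hN
  have hNL : (N : ℝ) ≤ L * H := by exact_mod_cast hNLH
  have h2k : (1 : ℝ) ≤ 2 ^ k := one_le_pow₀ (by norm_num)
  set G : ℝ := N / 2 ^ k with hG
  have hG0 : 0 < G := by positivity
  have hGN : G ≤ N := div_le_self hN'.le h2k
  -- basic facts
  have facts : ∀ g : ℕ, 1 ≤ g → ∀ n : ℕ, N ≤ n → n < 2 * N → 2 ^ (k + 1) * g < n →
      (0 : ℝ) < g / (2 * G) ∧ (g : ℝ) / (2 * G) ≤ 2 ^ k * g / n ∧ (2 : ℝ) ^ k * g / n ≤ 1 / 2 := by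
    intro g hg n n1 n2 n3
    have hg' : (0 : ℝ) < g := by exact_mod_cast hg
    have n1' : (N : ℝ) ≤ n := by exact_mod_cast n1
    have n2' : (n : ℝ) ≤ 2 * N := by exact_mod_cast n2.le
    have n3' : (2 : ℝ) ^ (k + 1) * g ≤ n := by exact_mod_cast n3.le
    have hn : (0 : ℝ) < n := hN'.trans_le n1'
    refine ⟨by positivity, ?_, ?_⟩
    · rw [hG, show (g : ℝ) / (2 * (N / 2 ^ k)) = 2 ^ k * g / (2 * N) by field_simp]
      gcongr
    · rw [div_le_iff₀ hn]
      rw [pow_succ] at n3'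
      linarith
  have q_eq : ∀ g : ℕ, 1 ≤ g → min 1 (1 / (2 * ((g : ℝ) / (2 * G)) * H)) = min 1 (G / (g * H)) := by
    intro g hg
    have hg' : (0 : ℝ) < g := by exact_mod_cast hg
    congr 1; field_simp
  have hq0 : ∀ g : ℕ, 1 ≤ g → 0 < min 1 (G / (g * H)) := by
    intro g hg
    have hg' : (0 : ℝ) < g := by exact_mod_cast hg
    exact lt_min one_pos (by positivity)
  have hq4 : ∀ g : ℕ, 1 ≤ g → (min 1 (G / (g * H))) ^ 2 ≤ √(G / H) / √g := by
    intro g hg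
    have hg' : (0 : ℝ) < g := by exact_mod_cast hg
    have h0 := hq0 g hg
    have h1 : min 1 (G / (g * H)) ≤ 1 := min_le_left _ _
    have h2 : min 1 (G / (g * H)) ≤ G / (g * H) := min_le_right _ _
    rw [← Real.sqrt_div (by positivity)]
    apply Real.le_sqrt_of_sq_le
    calc ((min 1 (G / (g * H))) ^ 2) ^ 2 = (min 1 (G / (g * H))) ^ 3 * min 1 (G / (g * H)) := by ring
      _ ≤ 1 * (G / (g * H)) := by
        gcongr
        exact pow_le_one₀ h0.le h1
      _ = _ := by field_simp
  have hq43 : ∀ g : ℕ, 1 ≤ g → (min 1 (G / (g * H))) ^ 2 ≤ (G / H * √(G / H)) / (g * √g) := by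
    intro g hg
    have hg' : (0 : ℝ) < g := by exact_mod_cast hg
    have h0 := hq0 g hg
    have h1 : min 1 (G / (g * H)) ≤ 1 := min_le_left _ _
    have h2 : min 1 (G / (g * H)) ≤ G / (g * H) := min_le_right _ _
    have h3 : min 1 (G / (g * H)) ≤ √(G / H) / √g := by
      rw [← Real.sqrt_div (by positivity)]
      apply Real.le_sqrt_of_sq_le
      calc (min 1 (G / (g * H))) ^ 2 = (min 1 (G / (g * H))) * min 1 (G / (g * H)) := by ring
        _ ≤ 1 * (G / (g * H)) := by gcongr
        _ = _ := by field_simp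
    calc (min 1 (G / (g * H))) ^ 2 = (min 1 (G / (g * H))) * min 1 (G / (g * H)) := by ring
      _ ≤ (G / (g * H)) * (√(G / H) / √g) := by gcongr
      _ = _ := by field_simp
  have := bilinear (N := N) (G := N) (b := b) hN hb (fun g n => phi a L H (2 ^ k * g / n)) (fun g => 2 ^ (k + 1) * g)
    (R := √(L * G)) (A := G * √(G / H)) (B := 26 * L * (G / H * √(G / H)))
    (by positivity) (by positivity) (by positivity) ?_ ?_ ?_
  · refine this.trans ?_
    have hl : 0 ≤ Real.log N := Real.log_natCast_nonneg N
    rw [Real.sq_sqrt (by positivity)]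
    have e1 : (G * √(G / H)) ^ 2 + 2 * (G * √(G / H)) * (26 * L * (G / H * √(G / H))) =
        G ^ 3 / H + 52 * (L * G ^ 3 / H ^ 2) := by
      have : √(G / H) ^ 2 = G / H := Real.sq_sqrt (by positivity)
      calc _ = G ^ 2 * √(G / H) ^ 2 + 52 * L * G ^ 2 / H * √(G / H) ^ 2 := by ring
        _ = _ := by rw [this]; field_simp
    rw [e1]
    have e2 : G ^ 3 / H ≤ N ^ 2 * L ^ 2 / H := by
      have : G ^ 3 ≤ N ^ 2 * L ^ 2 := by
        calc G ^ 3 ≤ (N : ℝ) ^ 3 := by gcongr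
          _ = (N : ℝ) ^ 2 * N := by ring
          _ ≤ (N : ℝ) ^ 2 * (L * L) := by gcongr; exact hNL.trans (by gcongr)
          _ = _ := by ring
      gcongr
    have e3 : L * G ^ 3 / H ^ 2 ≤ N ^ 2 * L ^ 2 / H := by
      rw [div_le_div_iff₀ (by positivity) hH']
      calc L * G ^ 3 * H ≤ (L : ℝ) * N ^ 3 * H := by gcongr
        _ = (N : ℝ) ^ 2 * (L * H) * N := by ring
        _ ≤ (N : ℝ) ^ 2 * (L * H) * (L * H) := by gcongr
        _ = _ := by ring
    have e4 : N * (L * G) ≤ N ^ 2 * L ^ 2 / H := by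
      rw [le_div_iff₀ hH']
      calc N * (L * G) * H ≤ (N : ℝ) * (L * N) * L := by gcongr
        _ = _ := by ring
    have e5 : (23 * N * L / √H * (1 + Real.log N) ^ 2) ^ 2 = 529 * (N ^ 2 * L ^ 2 / H) * (1 + Real.log N) ^ 4 := by
      have : √(H : ℝ) ^ 2 = H := Real.sq_sqrt hH'.le
      calc _ = 529 * (N ^ 2 * L ^ 2 / √(H : ℝ) ^ 2) * (1 + Real.log N) ^ 4 := by ring
        _ = _ := by rw [this]
    rw [e5]
    have e6 : (1 + Real.log N) ^ 3 ≤ (1 + Real.log N) ^ 4 := pow_le_pow_right₀ (by linarith) (by norm_num)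
    calc _ ≤ (N ^ 2 * L ^ 2 / H) * (1 + Real.log N) ^ 3 + 8 * (N ^ 2 * L ^ 2 / H + 52 * (N ^ 2 * L ^ 2 / H)) * (1 + Real.log N) ^ 3 := by
          gcongr
      _ = 425 * (N ^ 2 * L ^ 2 / H) * (1 + Real.log N) ^ 3 := by ring
      _ ≤ _ := by gcongr; norm_num
  · intro g hg _ n n1 n2 n3
    have hg1 := (mem_Icc.mp hg).1
    have hg' : (0 : ℝ) < g := by exact_mod_cast hg1
    obtain ⟨f1, f2, f3⟩ := facts g hg1 n n1 n2 n3
    refine (phi_le1 hH (f1.trans_le f2) f3).trans ?_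
    rw [← Real.sqrt_div (by positivity)]
    apply Real.sqrt_le_sqrt
    calc (L : ℝ) / (2 * (2 ^ k * g / n)) ≤ L / (2 * (g / (2 * G))) := by gcongr
      _ = _ := by field_simp
  · intro g hg _ n n1 n2 n3
    have hg1 := (mem_Icc.mp hg).1
    have hg' : (0 : ℝ) < g := by exact_mod_cast hg1
    obtain ⟨f1, f2, f3⟩ := facts g hg1 n n1 n2 n3
    refine (phi_le2 hH f1 f2 f3).trans ?_
    rw [q_eq g hg1]
    calc _ ≤ 1 / (2 * ((g : ℝ) / (2 * G))) * (√(G / H) / √g) := by gcongr; exact hq4 g hg1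
      _ = _ := by field_simp
  · intro g hg _ n n1 n2 n3
    have hg1 := (mem_Icc.mp hg).1
    have hg' : (0 : ℝ) < g := by exact_mod_cast hg1
    obtain ⟨f1, f2, f3⟩ := facts g hg1 n n1 (by omega) n3
    obtain ⟨_, f2', f3'⟩ := facts g hg1 (n + 1) (by omega) n2 (by omega)
    have n1' : (N : ℝ) ≤ n := by exact_mod_cast n1
    have hn : (0 : ℝ) < n := hN'.trans_le n1'
    have hd : |(2 : ℝ) ^ k * g / (n + 1 : ℕ) - 2 ^ k * g / n| ≤ 2 ^ k * g / N ^ 2 := by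
      rw [abs_sub_comm]
      have : (2 : ℝ) ^ k * g / n - 2 ^ k * g / (n + 1 : ℕ) = 2 ^ k * g / (n * (n + 1)) := by
        push_cast; field_simp; ring
      rw [this, abs_of_nonneg (by positivity)]
      gcongr
      nlinarith
    refine (phi_diff hH hHL ha f1 f2' f3' f2 f3 hd).trans ?_
    rw [q_eq g hg1]
    have hpi : 8 * Real.pi ≤ 26 := by linarith [Real.pi_lt_d2]
    calc 4 * Real.pi * (L * ((2 : ℝ) ^ k * g / N ^ 2) / (g / (2 * G))) * (min 1 (G / (g * H))) ^ 2
        = (8 * Real.pi) * (L / N) * (min 1 (G / (g * H))) ^ 2 := by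
          rw [hG]; field_simp; norm_num
      _ ≤ 26 * (L / N) * ((G / H * √(G / H)) / (g * √g)) := by
          gcongr; exact hq43 g hg1
      _ = _ := by ring

end CNM


namespace CNM

open Finset

/-- sum over the progression `a mod 8` -/
def UU (a L n : ℕ) : ℤ := ∑ k ∈ range L, jacobiSym ((8 * k + a : ℕ) : ℤ) n

def UW (a L H n : ℕ) : ℤ := ∑ i ∈ range H, ∑ j ∈ range H, ∑ k ∈ range L, jacobiSym ((8 * (k + i + j) + a : ℕ) : ℤ) n

lemma UW_completion {a L H n m : ℕ} (hnm : n = 2 * m + 1) (hm : 1 ≤ m) (hsq : Squarefree n)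
    (hH : 1 ≤ H) : ∃ t : ℤ,
    √n * (|(UW a L H n : ℝ)| / H ^ 2) ≤
      2 * ‖∑ h ∈ Icc 1 m, ((jacobiSym h n : ℤ) : ℂ) * (ee (a * t * h / 8) * phi a L H (h / n))‖ := by
  have : NeZero n := ⟨by omega⟩
  have hn : Odd n := ⟨m, hnm⟩
  have hnpos : (0 : ℝ) < n := by exact_mod_cast (by omega : 0 < n)
  have hH' : (H : ℂ) ≠ 0 := by exact_mod_cast (by omega : H ≠ 0)
  have hg := norm_gz_one hn hsq
  have hg' : ‖gz n 1‖ = √n := by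
    rw [← hg, Real.sqrt_sq (norm_nonneg _)]
  have hcop : IsCoprime (8 : ℤ) (n : ℤ) := by
    have : Nat.Coprime 8 n := by
      rw [show 8 = 2 ^ 3 by norm_num]
      exact Nat.Coprime.pow_left 3 (Nat.coprime_two_left.mpr hn)
    exact_mod_cast Nat.isCoprime_iff_coprime.mpr this
  obtain ⟨u, v, huv⟩ := hcop
  refine ⟨-v, ?_⟩
  have hu : (u : ℝ) = 1 / 8 - v * n / 8 := by
    have : (u : ℝ) * 8 + v * n = 1 := by exact_mod_cast huv
    linarith
  have hJ : ∀ y : ℕ, jacobiSym ((8 * y + a : ℕ) : ℤ) n = jacobiSym 8 n * jacobiSym (y + u * a) n := by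
    intro y
    rw [← jacobiSym.mul_left, jacobiSym.mod_left, jacobiSym.mod_left (8 * _)]
    congr 1
    apply Int.ModEq.eq
    rw [Int.modEq_iff_dvd]
    refine ⟨-v * a, ?_⟩
    push_cast
    linear_combination (a : ℤ) * huv
  set E : ℕ → ℂ := fun h => ee (a * (-v : ℤ) * h / 8) * phi a L H (h / n) with hE
  have key : gz n 1 * ((UW a L H n : ℤ) : ℂ) = ((jacobiSym 8 n : ℤ) : ℂ) * (H : ℂ) ^ 2 *
      ∑ h ∈ Icc 1 m, ((jacobiSym h n : ℤ) : ℂ) *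
        (E h + ((jacobiSym (-1) n : ℤ) : ℂ) * (starRingEnd ℂ) (E h)) := by
    unfold UW
    simp_rw [hJ]
    push_cast
    simp_rw [Finset.mul_sum]
    have c1 : ∀ i j k : ℕ, gz n 1 * (((jacobiSym 8 n : ℤ) : ℂ) * ((jacobiSym ((k : ℤ) + i + j + u * a) n : ℤ) : ℂ)) =
      ∑ h ∈ Icc 1 m, ((jacobiSym 8 n : ℤ) : ℂ) * (((jacobiSym h n : ℤ) : ℂ) *
        (ee ((h : ℝ) * ((k : ℤ) + i + j + u * a : ℤ) / n) + ((jacobiSym (-1) n : ℤ) : ℂ) *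
          (starRingEnd ℂ) (ee ((h : ℝ) * ((k : ℤ) + i + j + u * a : ℤ) / n)))) := by
      intro i j k
      rw [← Finset.mul_sum, ← completion hnm hm hsq]; ring
    simp_rw [c1]
    have c2 : ∀ f : ℕ → ℕ → ℕ → ℕ → ℂ, ∑ i ∈ range H, ∑ j ∈ range H, ∑ k ∈ range L, ∑ h ∈ Icc 1 m, f i j k h =
        ∑ h ∈ Icc 1 m, ∑ i ∈ range H, ∑ j ∈ range H, ∑ k ∈ range L, f i j k h := by
      intro f
      simp_rw [Finset.sum_comm (s := range L) (t := Icc 1 m), Finset.sum_comm (s := range H) (t := Icc 1 m)]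
    rw [c2]
    refine Finset.sum_congr rfl fun h _ => ?_
    have c3 : ∑ i ∈ range H, ∑ j ∈ range H, ∑ k ∈ range L, ee ((h : ℝ) * ((k : ℤ) + i + j + u * a : ℤ) / n) =
        (H : ℂ) ^ 2 * E h := by
      have : ∀ i j k : ℕ, ee ((h : ℝ) * ((k : ℤ) + i + j + u * a : ℤ) / n) =
          ee (a * (-v : ℤ) * h / 8) * ee (a * (h / n : ℝ) / 8) * (ee (i * (h / n : ℝ)) * (ee (j * (h / n : ℝ)) * ee (k * (h / n : ℝ)))) := by
        intro i j k
        simp_rw [← ee_add]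
        congr 1
        push_cast
        rw [hu]
        field_simp
        ring
      simp_rw [this, ← Finset.mul_sum, ← Finset.sum_mul]
      simp only [hE, phi]
      rw [← show DK L (h / n) = ∑ i ∈ range L, ee (i * (h / n : ℝ)) from rfl,
        ← show DK H (h / n) = ∑ i ∈ range H, ee (i * (h / n : ℝ)) from rfl]
      field_simp
    simp_rw [← Finset.mul_sum, Finset.sum_add_distrib, ← Finset.mul_sum, ← map_sum, c3]
    rw [map_mul, map_pow, Complex.conj_natCast]
    ring
  have jle : ∀ (x : ℤ), ‖((jacobiSym x n : ℤ) : ℂ)‖ ≤ 1 := by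
    intro x
    rcases jacobiSym.trichotomy x n with h | h | h <;> rw [h] <;> simp
  have hb : ‖gz n 1 * ((UW a L H n : ℤ) : ℂ)‖ ≤ H ^ 2 * (2 * ‖∑ h ∈ Icc 1 m, ((jacobiSym h n : ℤ) : ℂ) * E h‖) := by
    rw [key, norm_mul, norm_mul, norm_pow, Complex.norm_natCast]
    have s1 : ∑ h ∈ Icc 1 m, ((jacobiSym h n : ℤ) : ℂ) *
        (E h + ((jacobiSym (-1) n : ℤ) : ℂ) * (starRingEnd ℂ) (E h)) =
        ∑ h ∈ Icc 1 m, ((jacobiSym h n : ℤ) : ℂ) * E h + ((jacobiSym (-1) n : ℤ) : ℂ) *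
          (starRingEnd ℂ) (∑ h ∈ Icc 1 m, ((jacobiSym h n : ℤ) : ℂ) * E h) := by
      rw [map_sum, Finset.mul_sum, ← Finset.sum_add_distrib]
      refine Finset.sum_congr rfl fun h _ => ?_
      rw [map_mul _ (((jacobiSym h n : ℤ) : ℂ)) (E h), map_intCast]; ring
    rw [s1]
    set T := ∑ h ∈ Icc 1 m, ((jacobiSym h n : ℤ) : ℂ) * E h
    have : ‖T + ((jacobiSym (-1) n : ℤ) : ℂ) * (starRingEnd ℂ) T‖ ≤ 2 * ‖T‖ := by
      refine (norm_add_le _ _).trans ?_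
      rw [norm_mul, RCLike.norm_conj]
      nlinarith [jle (-1), norm_nonneg T]
    calc _ ≤ 1 * (H : ℝ) ^ 2 * (2 * ‖T‖) := by
          gcongr; exact jle 8
      _ = _ := by ring
  rw [norm_mul, hg', Complex.norm_intCast] at hb
  have hHr : (0 : ℝ) < H := by exact_mod_cast hH
  rw [← mul_div_assoc, div_le_iff₀ (by positivity)]
  calc _ ≤ _ := hb
    _ = _ := by ring

lemma class_split {a L H n m N : ℕ} (hnm : n = 2 * m + 1) (h2 : n < 2 * N) (t : ℤ) :
    ‖∑ h ∈ Icc 1 m, ((jacobiSym h n : ℤ) : ℂ) * (ee (a * t * h / 8) * phi a L H (h / n))‖ ≤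
      ∑ k ∈ range (Nat.log 2 N + 1), ∑ b ∈ ({1, 3, 5, 7} : Finset ℕ), ‖SS a L H N k b n‖ := by
  set κ : ℕ → ℕ × ℕ := fun h => (h.factorization 2, (h / 2 ^ (h.factorization 2)) % 8) with hκ
  have hmaps : ∀ h ∈ Icc 1 m, κ h ∈ (range (Nat.log 2 N + 1)) ×ˢ ({1, 3, 5, 7} : Finset ℕ) := by
    intro h hh
    simp only [mem_Icc] at hh
    simp only [hκ, mem_product, mem_range]
    constructor
    · rw [Nat.lt_succ_iff]
      apply Nat.le_log_of_pow_le (by norm_num)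
      exact (Nat.ordProj_le 2 (by omega)).trans (by omega)
    · have := Nat.not_dvd_ordCompl Nat.prime_two (n := h) (by omega)
      have h8 : h / 2 ^ h.factorization 2 % 8 < 8 := Nat.mod_lt _ (by norm_num)
      simp only [mem_insert, mem_singleton]
      omega
  rw [← Finset.sum_fiberwise_of_maps_to hmaps]
  rw [← Finset.sum_product']
  refine (norm_sum_le _ _).trans (Finset.sum_le_sum fun kb hkb => ?_)
  obtain ⟨k, b⟩ := kb
  simp only [mem_product, mem_range] at hkb
  have hb : b % 2 = 1 ∧ b < 8 := by
    have := hkb.2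
    simp only [mem_insert, mem_singleton] at this
    omega
  have e : ∑ h ∈ (Icc 1 m).filter (fun h => κ h = (k, b)), ((jacobiSym h n : ℤ) : ℂ) * (ee (a * t * h / 8) * phi a L H (h / n)) =
      ((jacobiSym (2 ^ k) n : ℤ) : ℂ) * ee (a * t * (2 ^ k * b) / 8) * SS a L H N k b n := by
    unfold SS
    rw [Finset.mul_sum]
    symm
    apply Finset.sum_bij (fun g _ => 2 ^ k * g)
    · intro g hg
      simp only [mem_filter, mem_Icc] at hg ⊢
      obtain ⟨⟨g1, g2⟩, g3, g4⟩ := hg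
      have hodd : ¬ 2 ∣ g := by omega
      have hf : (2 ^ k * g).factorization 2 = k := by
        rw [Nat.factorization_mul (by positivity) (by omega)]
        simp [Nat.prime_two.factorization, Nat.factorization_eq_zero_of_not_dvd hodd]
      have hp : 1 ≤ 2 ^ k * g := Nat.mul_pos (by positivity) (by omega)
      rw [pow_succ, mul_comm (2 ^ k) 2, mul_assoc] at g4
      refine ⟨⟨hp, by omega⟩, ?_⟩
      simp only [hκ, hf]
      rw [Nat.mul_div_cancel_left _ (by positivity), g3]
    · intro x _ y _ hxy
      exact Nat.eq_of_mul_eq_mul_left (by positivity) hxy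
    · intro h hh
      simp only [mem_filter, mem_Icc, hκ, Prod.mk.injEq] at hh
      obtain ⟨⟨h1, h2'⟩, h3, h4⟩ := hh
      have hmul : 2 ^ k * (h / 2 ^ k) = h := by
        rw [← h3]; exact Nat.ordProj_mul_ordCompl_eq_self h 2
      rw [h3] at h4
      refine ⟨h / 2 ^ k, ?_, hmul⟩
      simp only [mem_filter, mem_Icc]
      have : h / 2 ^ k ≤ h := Nat.div_le_self _ _
      refine ⟨⟨by generalize h / 2 ^ k = z at *; omega, by omega⟩, h4, ?_⟩
      rw [pow_succ, mul_comm (2 ^ k) 2, mul_assoc, hmul]; omega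
    · intro g hg
      simp only [mem_filter, mem_Icc] at hg
      obtain ⟨_, g3, _⟩ := hg
      have e1 : ee (a * t * ((2 ^ k * g : ℕ) : ℝ) / 8) = ee (a * t * (2 ^ k * b) / 8) := by
        have hgb : (g : ℝ) = 8 * ((g / 8 : ℕ) : ℝ) + b := by
          have := Nat.div_add_mod g 8
          rw [g3] at this
          exact_mod_cast this.symm
        rw [show a * t * ((2 ^ k * g : ℕ) : ℝ) / 8 = a * t * (2 ^ k * b) / 8 + ((a * t * 2 ^ k * ((g / 8 : ℕ) : ℤ) : ℤ) : ℝ) by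
          rw [Nat.cast_mul, hgb]; generalize g / 8 = z; push_cast; ring]
        rw [ee_add, ee_int, mul_one]
      rw [e1]
      push_cast
      rw [jacobiSym.mul_left]
      push_cast
      ring
  rw [e, norm_mul, norm_mul, norm_ee, mul_one]
  have : ‖((jacobiSym (2 ^ k) n : ℤ) : ℂ)‖ ≤ 1 := by
    rcases jacobiSym.trichotomy (2 ^ k) n with h | h | h <;> rw [h] <;> simp
  exact mul_le_of_le_one_left (norm_nonneg _) this

lemma shift_bound (a L n s : ℕ) :
    |(∑ k ∈ range L, jacobiSym ((8 * (k + s) + a : ℕ) : ℤ) n) - UU a L n| ≤ 2 * s := by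
  unfold UU
  set f : ℕ → ℤ := fun k => jacobiSym ((8 * k + a : ℕ) : ℤ) n with hf
  have h1 : ∑ k ∈ range L, jacobiSym ((8 * (k + s) + a : ℕ) : ℤ) n = ∑ k ∈ range L, f (k + s) := rfl
  have h2 : ∑ k ∈ range L, jacobiSym ((8 * k + a : ℕ) : ℤ) n = ∑ k ∈ range L, f k := rfl
  rw [h1, h2]
  have e1 := Finset.sum_range_add f s L
  have e2 := Finset.sum_range_add f L s
  rw [add_comm L s] at e2
  have e3 : ∑ k ∈ range L, f (k + s) - ∑ k ∈ range L, f k = ∑ k ∈ range s, f (L + k) - ∑ k ∈ range s, f k := by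
    simp_rw [add_comm _ s]
    linarith
  rw [e3]
  have hb : ∀ g : ℕ → ℕ, |∑ k ∈ range s, f (g k)| ≤ s := by
    intro g
    refine (Finset.abs_sum_le_sum_abs _ _).trans ?_
    calc _ ≤ ∑ k ∈ range s, (1 : ℤ) := Finset.sum_le_sum fun k _ => jac_abs_le _ _
      _ = s := by simp
  have := hb (fun k => L + k)
  have h4 := hb (fun k => k)
  refine (abs_sub _ _).trans ?_
  linarith

lemma UU_UW {a L H n : ℕ} (hH : 1 ≤ H) : |(UU a L n : ℝ)| ≤ |(UW a L H n : ℝ)| / H ^ 2 + 4 * H := by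
  have hH' : (0 : ℝ) < H := by exact_mod_cast hH
  have h1 : |UW a L H n - H ^ 2 * UU a L n| ≤ H ^ 2 * (4 * H) := by
    have : UW a L H n - H ^ 2 * UU a L n = ∑ i ∈ range H, ∑ j ∈ range H,
        ((∑ k ∈ range L, jacobiSym ((8 * (k + (i + j)) + a : ℕ) : ℤ) n) - UU a L n) := by
      unfold UW
      simp_rw [Finset.sum_sub_distrib]
      simp [← add_assoc, sq, mul_assoc]
    rw [this]
    calc _ ≤ ∑ i ∈ range H, ∑ j ∈ range H, (4 * H : ℤ) := by
          refine (Finset.abs_sum_le_sum_abs _ _).trans (Finset.sum_le_sum fun i hi => ?_)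
          refine (Finset.abs_sum_le_sum_abs _ _).trans (Finset.sum_le_sum fun j hj => ?_)
          rw [mem_range] at hi hj
          refine (shift_bound a L n (i + j)).trans ?_
          push_cast; linarith [(by exact_mod_cast hi : (i : ℤ) < H), (by exact_mod_cast hj : (j : ℤ) < H)]
      _ = _ := by simp [sq]; ring
  have h2 : |(UW a L H n : ℝ) - H ^ 2 * UU a L n| ≤ H ^ 2 * (4 * H) := by exact_mod_cast h1
  have h3 : |(H : ℝ) ^ 2 * UU a L n| ≤ |(UW a L H n : ℝ)| + H ^ 2 * (4 * H) := by
    have := abs_sub_abs_le_abs_sub ((H : ℝ) ^ 2 * UU a L n) (UW a L H n : ℝ)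
    rw [abs_sub_comm] at this
    linarith
  rw [abs_mul, abs_of_pos (by positivity : (0 : ℝ) < H ^ 2)] at h3
  rw [← sub_le_iff_le_add, le_div_iff₀ (by positivity)]
  linarith

/-- Cauchy–Schwarz in the form used below -/
lemma cs_card {ι : Type*} (s : Finset ι) (f : ι → ℝ) {c V : ℝ} (hc0 : 0 ≤ c) (hV : 0 ≤ V)
    (hc : (s.card : ℝ) ≤ c ^ 2) (h : ∑ i ∈ s, f i ^ 2 ≤ V ^ 2) : ∑ i ∈ s, f i ≤ c * V := by
  apply le_of_sq_le_sq _ (by positivity)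
  have := sq_sum_le_card_mul_sum_sq (s := s) (f := f)
  calc _ ≤ _ := this
    _ ≤ c ^ 2 * V ^ 2 := by
      apply mul_le_mul hc h (Finset.sum_nonneg fun _ _ => sq_nonneg _) (by positivity)
    _ = _ := by ring

/-- the moduli in the dyadic block -/
def WW (N : ℕ) : Finset ℕ := (Ico N (2 * N)).filter (fun n => Odd n ∧ Squarefree n ∧ 1 < n)

lemma WW_comp {a L H N : ℕ} (hN : 1 ≤ N) (hH : 1 ≤ H) (hHL : H ≤ L) (ha : a ≤ 8)
    (hNLH : N ≤ L * H) :
    ∑ n ∈ WW N, |(UW a L H n : ℝ)| / H ^ 2 ≤ 368 * (N * L / √H * (1 + Real.log N) ^ 3) := by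
  have hH' : (0 : ℝ) < H := by exact_mod_cast hH
  have hN' : (0 : ℝ) < N := by exact_mod_cast hN
  have hsN : (0 : ℝ) < √N := Real.sqrt_pos.mpr hN'
  have hl : 0 ≤ Real.log N := Real.log_natCast_nonneg N
  set V : ℝ := 23 * N * L / √H * (1 + Real.log N) ^ 2 with hV
  have hV0 : 0 ≤ V := by positivity
  have h1 : ∀ n ∈ WW N, |(UW a L H n : ℝ)| / H ^ 2 ≤ (2 / √N) * 
      ∑ k ∈ range (Nat.log 2 N + 1), ∑ b ∈ ({1, 3, 5, 7} : Finset ℕ), ‖SS a L H N k b n‖ := by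
    intro n hn
    simp only [WW, mem_filter, mem_Ico] at hn
    obtain ⟨⟨n1, n2⟩, ⟨m, hm⟩, n4, n5⟩ := hn
    obtain ⟨t, ht⟩ := UW_completion (a := a) (L := L) hm (by omega) n4 hH
    have h2 := class_split (a := a) (L := L) (H := H) hm n2 t
    have h3 : √(N : ℝ) ≤ √n := Real.sqrt_le_sqrt (by exact_mod_cast n1)
    rw [div_mul_eq_mul_div, le_div_iff₀ hsN]
    calc _ ≤ √n * (|(UW a L H n : ℝ)| / H ^ 2) := by rw [mul_comm]; gcongr
      _ ≤ _ := ht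
      _ ≤ _ := by gcongr
  have h2 : ∀ k, ∀ b ∈ ({1, 3, 5, 7} : Finset ℕ), ∑ n ∈ WW N, ‖SS a L H N k b n‖ ≤ √N * V := by
    intro k b hb
    have hb2 : b % 2 = 1 := by
      simp only [mem_insert, mem_singleton] at hb
      omega
    apply cs_card _ _ hsN.le hV0
    · rw [Real.sq_sqrt hN'.le]
      have : (WW N).card ≤ N := (Finset.card_filter_le _ _).trans (by simp; omega)
      exact_mod_cast this
    · refine le_trans ?_ (class_bound (k := k) hN hb2 hH hHL ha hNLH)
      apply Finset.sum_le_sum_of_subset_of_nonneg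
      · intro n hn
        simp only [WW, mem_filter] at hn ⊢
        exact ⟨hn.1, hn.2.1⟩
      · intros; positivity
  have hlog : ((Nat.log 2 N + 1 : ℕ) : ℝ) ≤ 2 * (1 + Real.log N) := by
    have h3 : (2 : ℝ) ^ (Nat.log 2 N) ≤ N := by exact_mod_cast Nat.pow_log_le_self 2 (by omega)
    have h4 := Real.log_le_log (by positivity) h3
    rw [Real.log_pow] at h4
    have := Real.log_two_gt_d9
    push_cast
    nlinarith [(Nat.cast_nonneg (Nat.log 2 N) : (0 : ℝ) ≤ _)]
  calc _ ≤ ∑ n ∈ WW N, (2 / √N) * 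
      ∑ k ∈ range (Nat.log 2 N + 1), ∑ b ∈ ({1, 3, 5, 7} : Finset ℕ), ‖SS a L H N k b n‖ := Finset.sum_le_sum h1
    _ = (2 / √N) * ∑ k ∈ range (Nat.log 2 N + 1), ∑ b ∈ ({1, 3, 5, 7} : Finset ℕ), ∑ n ∈ WW N, ‖SS a L H N k b n‖ := by
      rw [← Finset.mul_sum, Finset.sum_comm]
      congr 1
      refine Finset.sum_congr rfl fun k _ => Finset.sum_comm
    _ ≤ (2 / √N) * ∑ k ∈ range (Nat.log 2 N + 1), ∑ b ∈ ({1, 3, 5, 7} : Finset ℕ), √N * V := by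
      gcongr with k _ b hb
      exact h2 k b hb
    _ = 8 * V * ((Nat.log 2 N + 1 : ℕ) : ℝ) := by
      simp only [Finset.sum_const, card_range, nsmul_eq_mul]
      rw [show (({1, 3, 5, 7} : Finset ℕ).card) = 4 from rfl]
      field_simp
      norm_num
      ring
    _ ≤ 8 * V * (2 * (1 + Real.log N)) := by gcongr
    _ = _ := by rw [hV]; ring

lemma WW_direct {a L H N : ℕ} (hN : 1 ≤ N) (hH : 1 ≤ H) (hHL : H ≤ L) (ha : a % 2 = 1) (ha8 : a < 8)
    (hNLH : L * H ≤ N) :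
    ∑ n ∈ WW N, |(UU a L n : ℝ)| ≤ 65 * (N * L / √H * (1 + Real.log (8 * L)) ^ 2) := by
  have hH' : (0 : ℝ) < H := by exact_mod_cast hH
  have hHL' : (H : ℝ) ≤ L := by exact_mod_cast hHL
  have hL' : (0 : ℝ) < L := hH'.trans_le hHL'
  have hN' : (0 : ℝ) < N := by exact_mod_cast hN
  have hsN : (0 : ℝ) < √N := Real.sqrt_pos.mpr hN'
  have hNL : (L * H : ℝ) ≤ N := by exact_mod_cast hNLH
  have hl : 0 ≤ Real.log (8 * L) := by
    have := Real.log_natCast_nonneg (8 * L); push_cast at this; exact this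
  set lam : ℝ := 1 + Real.log (8 * L) with hlam
  have hlam1 : 1 ≤ lam := by linarith
  have key := bilinear (N := N) (G := 8 * L) (b := a) hN ha (fun _ _ => 1) (fun _ => 0)
    (R := √(8 * L)) (A := 8 * L * √(8 * L)) (B := 0) (by positivity) (by positivity) le_rfl ?_ ?_ ?_
  · have hU : ∀ n, 1 ≤ n → ∑ g ∈ (Icc 1 (8 * L)).filter (fun g => g % 8 = a ∧ 0 < n), ((jacobiSym g n : ℤ) : ℂ) * 1 =
        ((UU a L n : ℤ) : ℂ) := by
      intro n hn
      unfold UU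
      rw [Int.cast_sum]
      symm
      apply Finset.sum_bij (fun k _ => 8 * k + a)
      · intro k hk
        simp only [mem_range, mem_filter, mem_Icc] at hk ⊢
        omega
      · intro x _ y _ h
        omega
      · intro g hg
        simp only [mem_filter, mem_Icc] at hg
        exact ⟨g / 8, by rw [mem_range]; omega, by omega⟩
      · intro k _
        push_cast; ring
    have h1 : ∑ n ∈ WW N, |(UU a L n : ℝ)| ^ 2 ≤ (65 * (√N * L / √H) * lam ^ 2) ^ 2 := by
      have hle : ∑ n ∈ WW N, |(UU a L n : ℝ)| ^ 2 ≤ ∑ n ∈ (Ico N (2 * N)).filter Odd,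
        ‖∑ g ∈ (Icc 1 (8 * L)).filter (fun g => g % 8 = a ∧ 0 < n), ((jacobiSym g n : ℤ) : ℂ) * 1‖ ^ 2 := by
        have : ∀ n ∈ WW N, |(UU a L n : ℝ)| ^ 2 = ‖∑ g ∈ (Icc 1 (8 * L)).filter (fun g => g % 8 = a ∧ 0 < n), ((jacobiSym g n : ℤ) : ℂ) * 1‖ ^ 2 := by
          intro n hn
          simp only [WW, mem_filter, mem_Ico] at hn
          rw [hU n (by omega), Complex.norm_intCast]
        rw [Finset.sum_congr rfl this]
        apply Finset.sum_le_sum_of_subset_of_nonneg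
        · intro n hn
          simp only [WW, mem_filter] at hn ⊢
          exact ⟨hn.1, hn.2.1⟩
        · intros; positivity
      refine hle.trans (key.trans ?_)
      have hcast : ((8 * L : ℕ) : ℝ) = 8 * L := by push_cast; ring
      rw [hcast, ← hlam]
      have e5 : (65 * (√N * L / √H) * lam ^ 2) ^ 2 = 4225 * (N * L ^ 2 / H) * lam ^ 4 := by
        have t1 : √(H : ℝ) ^ 2 = H := Real.sq_sqrt hH'.le
        have t2 : √(N : ℝ) ^ 2 = N := Real.sq_sqrt hN'.le
        calc _ = 4225 * (√(N : ℝ) ^ 2 * L ^ 2 / √(H : ℝ) ^ 2) * lam ^ 4 := by ring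
          _ = _ := by rw [t1, t2]
      have t3 : √(8 * L : ℝ) ^ 2 = 8 * L := Real.sq_sqrt (by positivity)
      rw [e5, mul_pow (8 * (L : ℝ)), t3]
      have e6 : lam ^ 3 ≤ lam ^ 4 := pow_le_pow_right₀ hlam1 (by norm_num)
      have e7 : (L : ℝ) ^ 3 ≤ N * L ^ 2 / H := by
        rw [le_div_iff₀ hH']
        calc (L : ℝ) ^ 3 * H = (L * H) * L ^ 2 := by ring
          _ ≤ _ := by gcongr
      have e8 : (N : ℝ) * L ≤ N * L ^ 2 / H := by
        rw [le_div_iff₀ hH']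
        calc (N : ℝ) * L * H ≤ N * L * L := by gcongr
          _ = _ := by ring
      calc _ = (8 * (N * L) + 4096 * L ^ 3) * lam ^ 3 := by ring
        _ ≤ (8 * (N * L ^ 2 / H) + 4096 * (N * L ^ 2 / H)) * lam ^ 4 := by gcongr
        _ = 4104 * (N * L ^ 2 / H) * lam ^ 4 := by ring
        _ ≤ _ := by gcongr; norm_num
    have h2 := cs_card (WW N) (fun n => |(UU a L n : ℝ)|) hsN.le (by positivity) (by
      rw [Real.sq_sqrt hN'.le]
      have : (WW N).card ≤ N := (Finset.card_filter_le _ _).trans (by simp; omega)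
      exact_mod_cast this) h1
    refine h2.trans (le_of_eq ?_)
    have t2 : √(N : ℝ) * √N = N := Real.mul_self_sqrt hN'.le
    calc _ = 65 * ((√(N : ℝ) * √N) * L / √H * lam ^ 2) := by ring
      _ = _ := by rw [t2]
  · intro g hg _ n _ _ _
    have hg1 : (1 : ℝ) ≤ g := by exact_mod_cast (mem_Icc.mp hg).1
    have hg2 : (g : ℝ) ≤ 8 * L := by exact_mod_cast (mem_Icc.mp hg).2
    rw [norm_one, le_div_iff₀ (Real.sqrt_pos.mpr (by linarith)), one_mul]
    exact Real.sqrt_le_sqrt hg2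
  · intro g hg _ n _ _ _
    have hg1 : (1 : ℝ) ≤ g := by exact_mod_cast (mem_Icc.mp hg).1
    have hg2 : (g : ℝ) ≤ 8 * L := by exact_mod_cast (mem_Icc.mp hg).2
    have hs : 0 < √(g : ℝ) := Real.sqrt_pos.mpr (by linarith)
    rw [norm_one, le_div_iff₀ (by positivity), one_mul]
    have := Real.sqrt_le_sqrt hg2
    gcongr
  · intro g hg _ n _ _ _
    simp

/-- **Lemma J** -/
lemma lemmaJ {a L N : ℕ} (hN : 1 ≤ N) (hL : 1 ≤ L) (ha : a % 2 = 1) (ha8 : a < 8) :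
    ∑ n ∈ WW N, |(UU a L n : ℝ)| ≤ 400 * (N * (L : ℝ) ^ (2 / 3 : ℝ) * (1 + Real.log (8 * L * N)) ^ 3) := by
  have hN' : (1 : ℝ) ≤ N := by exact_mod_cast hN
  have hL' : (1 : ℝ) ≤ L := by exact_mod_cast hL
  set x : ℝ := (L : ℝ) ^ (1 / 3 : ℝ) with hx
  have hx1 : 1 ≤ x := Real.one_le_rpow hL' (by norm_num)
  have hx3 : x ^ 3 = L := by
    rw [hx, ← Real.rpow_natCast, ← Real.rpow_mul (by positivity)]; norm_num
  have hx2 : (L : ℝ) ^ (2 / 3 : ℝ) = x ^ 2 := by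
    rw [hx, ← Real.rpow_natCast, ← Real.rpow_mul (by positivity)]; norm_num
  rw [hx2]
  set H : ℕ := ⌈x ^ 2⌉₊ with hH
  have hH1 : x ^ 2 ≤ H := Nat.le_ceil _
  have hH2 : (H : ℝ) ≤ x ^ 2 + 1 := (Nat.ceil_lt_add_one (by positivity)).le
  have hHpos : 1 ≤ H := Nat.one_le_ceil_iff.mpr (by positivity)
  have hHL : H ≤ L := by
    rw [hH, Nat.ceil_le, ← hx3]
    exact pow_le_pow_right₀ hx1 (by norm_num)
  have hHr : (0 : ℝ) < H := by exact_mod_cast hHpos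
  have hsH : x ≤ √H := Real.le_sqrt_of_sq_le hH1
  have hLH : (L : ℝ) / √H ≤ x ^ 2 := by
    rw [div_le_iff₀ (by positivity), ← hx3]
    calc x ^ 3 = x ^ 2 * x := by ring
      _ ≤ _ := by gcongr
  set lam : ℝ := 1 + Real.log (8 * L * N) with hlam
  have hlam0 : 0 ≤ Real.log (8 * L * N) := Real.log_nonneg (by nlinarith)
  have hlam1 : 1 ≤ lam := by linarith
  have hp1 : lam ^ 2 ≤ lam ^ 3 := pow_le_pow_right₀ hlam1 (by norm_num)
  rcases le_total N (L * H) with hc | hc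
  · have h1 := WW_comp hN hHpos hHL ha8.le hc
    have hcard : (((WW N).card : ℕ) : ℝ) ≤ N := by
      have : (WW N).card ≤ N := (Finset.card_filter_le _ _).trans (by simp; omega)
      exact_mod_cast this
    have hlogN : 1 + Real.log N ≤ lam := by
      have := Real.log_le_log (x := (N : ℝ)) (y := 8 * L * N) (by positivity) (by nlinarith)
      linarith
    have hlN : 0 ≤ Real.log N := Real.log_natCast_nonneg N
    calc _ ≤ ∑ n ∈ WW N, (|(UW a L H n : ℝ)| / H ^ 2 + 4 * H) := Finset.sum_le_sum fun n _ => UU_UW hHpos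
      _ = ∑ n ∈ WW N, |(UW a L H n : ℝ)| / H ^ 2 + (WW N).card * (4 * H) := by
          rw [Finset.sum_add_distrib, Finset.sum_const, nsmul_eq_mul]
      _ ≤ 368 * (N * L / √H * (1 + Real.log N) ^ 3) + N * (4 * (x ^ 2 + 1)) := by gcongr
      _ = 368 * (N * (L / √H) * (1 + Real.log N) ^ 3) + N * (4 * (x ^ 2 + 1)) := by ring
      _ ≤ 368 * (N * x ^ 2 * lam ^ 3) + N * (4 * (x ^ 2 + x ^ 2)) := by
          gcongr; exact one_le_pow₀ hx1
      _ = 368 * (N * x ^ 2 * lam ^ 3) + 8 * (N * x ^ 2 * 1) := by ring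
      _ ≤ 368 * (N * x ^ 2 * lam ^ 3) + 8 * (N * x ^ 2 * lam ^ 3) := by
          gcongr; exact one_le_pow₀ hlam1
      _ ≤ _ := by
          have : 0 ≤ N * x ^ 2 * lam ^ 3 := by positivity
          linarith
  · have h1 := WW_direct hN hHpos hHL ha ha8 hc
    have hlogL : 1 + Real.log (8 * L) ≤ lam := by
      have := Real.log_le_log (x := (8 * L : ℝ)) (y := 8 * L * N) (by positivity) (by nlinarith)
      linarith
    have hlL : 0 ≤ Real.log (8 * L) := Real.log_nonneg (by linarith)
    calc _ ≤ _ := h1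
      _ = 65 * (N * (L / √H) * (1 + Real.log (8 * L)) ^ 2) := by ring
      _ ≤ 65 * (N * x ^ 2 * lam ^ 2) := by gcongr
      _ ≤ 65 * (N * x ^ 2 * lam ^ 3) := by gcongr
      _ ≤ _ := by
          have : 0 ≤ N * x ^ 2 * lam ^ 3 := by positivity
          linarith

end CNM


namespace CNM

open Finset

lemma divisor_bound {η : ℝ} (hη : 0 < η) :
    ∃ C : ℝ, 1 ≤ C ∧ ∀ n : ℕ, (n.divisors.card : ℝ) ≤ C * (n : ℝ) ^ η := by
  obtain ⟨P, hP⟩ := exists_nat_gt ((2:ℝ) ^ (1 / η))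
  set B : ℝ := 1 + 1 / (η * Real.log 2) with hB
  have hl2 : 0 < Real.log 2 := Real.log_pos (by norm_num)
  have hB1 : 1 ≤ B := by rw [hB]; have : 0 < 1 / (η * Real.log 2) := by positivity
                         linarith
  have hkey : ∀ p k : ℕ, p.Prime → ((k:ℝ) + 1) ≤ (if p < P then B else 1) * ((p:ℝ) ^ k) ^ η := by
    intro p k hp
    have hp2 : (2:ℝ) ≤ p := by exact_mod_cast hp.two_le
    have hp0 : (0:ℝ) < p := by linarith
    rw [← Real.rpow_natCast, ← Real.rpow_mul hp0.le]
    split_ifs with h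
    · have h1 : (2:ℝ) ^ ((k:ℝ) * η) ≤ (p:ℝ) ^ ((k:ℝ) * η) := by gcongr
      have h2 : (k:ℝ) * η * Real.log 2 + 1 ≤ (2:ℝ) ^ ((k:ℝ) * η) := by
        rw [Real.rpow_def_of_pos (by norm_num)]
        have := Real.add_one_le_exp (Real.log 2 * (k * η))
        linarith
      have h3 : (1:ℝ) ≤ (2:ℝ) ^ ((k:ℝ) * η) := Real.one_le_rpow (by norm_num) (by positivity)
      calc (k:ℝ) + 1 = 1 / (η * Real.log 2) * (k * η * Real.log 2) + 1 := by field_simp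
        _ ≤ 1 / (η * Real.log 2) * (2:ℝ) ^ ((k:ℝ) * η) + (2:ℝ) ^ ((k:ℝ) * η) := by
            gcongr
            linarith
        _ = B * (2:ℝ) ^ ((k:ℝ) * η) := by rw [hB]; ring
        _ ≤ _ := by gcongr
    · push Not at h
      have h1 : (2:ℝ) ^ (1 / η) ≤ p := hP.le.trans (by exact_mod_cast h)
      have h2 : (2:ℝ) ≤ (p:ℝ) ^ η := by
        calc (2:ℝ) = ((2:ℝ) ^ (1 / η)) ^ η := by
              rw [← Real.rpow_mul (by norm_num)]; field_simp; simp
          _ ≤ _ := by gcongr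
      have h3 : ((k:ℝ) + 1) ≤ 2 ^ k := by
        have := Nat.lt_two_pow_self (n := k)
        exact_mod_cast this
      rw [one_mul, mul_comm (k:ℝ), Real.rpow_mul hp0.le, Real.rpow_natCast]
      exact h3.trans (by gcongr)
  refine ⟨B ^ P, one_le_pow₀ hB1, fun n => ?_⟩
  rcases Nat.eq_zero_or_pos n with rfl | hn
  · simp; positivity
  rw [Nat.card_divisors hn.ne']
  have hn' : ((n:ℝ)) ^ η = ∏ p ∈ n.primeFactors, (((p:ℝ) ^ (n.factorization p)) ^ η) := by
    conv_lhs => rw [← Nat.prod_factorization_pow_eq_self hn.ne']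
    rw [Finsupp.prod, Nat.support_factorization]
    push_cast
    rw [← Real.finsetProd_rpow _ _ (fun i _ => by positivity)]
  rw [hn']
  push_cast
  calc ∏ p ∈ n.primeFactors, ((n.factorization p : ℝ) + 1)
      ≤ ∏ p ∈ n.primeFactors, ((if p < P then B else 1) * (((p:ℝ) ^ (n.factorization p)) ^ η)) := by
        apply Finset.prod_le_prod (fun i _ => by positivity)
        intro p hp
        exact hkey p _ (Nat.prime_of_mem_primeFactors hp)
    _ = (∏ p ∈ n.primeFactors, (if p < P then B else 1)) * _ := Finset.prod_mul_distrib
    _ ≤ _ := by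
        gcongr
        rw [Finset.prod_ite, Finset.prod_const_one, mul_one, Finset.prod_const]
        apply pow_le_pow_right₀ hB1
        calc _ ≤ (range P).card := Finset.card_le_card (by intro x; simp)
          _ = P := card_range P

open ArithmeticFunction.Moebius in
lemma sum_mu (n : ℕ) (hn : n ≠ 0) : ∑ d ∈ n.divisors, (μ d : ℤ) = if n = 1 then 1 else 0 := by
  rw [← ArithmeticFunction.coe_mul_zeta_apply, ArithmeticFunction.moebius_mul_coe_zeta]
  simp [ArithmeticFunction.one_apply]

lemma sq_dvd_iff {s b d : ℕ} (hs : Squarefree s) (hb : b ≠ 0) (hd : d ≠ 0) :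
    d * d ∣ b ^ 2 * s ↔ d ∣ b := by
  constructor
  · intro h
    rw [← Nat.factorization_le_iff_dvd hd hb]
    rw [← Nat.factorization_le_iff_dvd (by positivity) (by have := hs.ne_zero; positivity)] at h
    intro p
    have h1 := h p
    have h2 := hs.natFactorization_le_one p
    rw [Nat.factorization_mul hd hd, Nat.factorization_mul (by positivity) hs.ne_zero, Nat.factorization_pow] at h1
    simp at h1
    omega
  · rintro ⟨c, rfl⟩
    exact ⟨c * c * s, by ring⟩

open ArithmeticFunction.Moebius in
lemma sqfree_ind {D X : ℕ} (hD : 1 ≤ D) (hX : D ≤ X) :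
    (if Squarefree D then 1 else 0 : ℤ) = ∑ d ∈ (Icc 1 X).filter (fun d => d * d ∣ D), μ d := by
  obtain ⟨s, b, h, hs⟩ := Nat.sq_mul_squarefree D
  have hb : b ≠ 0 := by rintro rfl; simp at h; omega
  have e : (Icc 1 X).filter (fun d => d * d ∣ D) = b.divisors := by
    ext d
    simp only [mem_filter, mem_Icc, Nat.mem_divisors]
    constructor
    · rintro ⟨⟨h1, h2⟩, h3⟩
      rw [← h, sq_dvd_iff hs hb (by omega)] at h3
      exact ⟨h3, hb⟩
    · rintro ⟨h1, -⟩
      have hd : d ≠ 0 := fun h0 => hb (by simpa [h0] using h1)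
      have h3 : d * d ∣ D := by rw [← h, sq_dvd_iff hs hb hd]; exact h1
      refine ⟨⟨by omega, ?_⟩, h3⟩
      have := Nat.le_of_dvd (by omega) h3
      nlinarith
  rw [e, sum_mu b hb]
  congr 1
  apply propext
  constructor
  · intro hsq
    rw [← h] at hsq
    have := hsq b ⟨s, by ring⟩
    simpa using this
  · rintro rfl
    rw [← h]; simpa using hs

lemma sum_dvd_class {q a Y : ℕ} (hq : q % 2 = 1) (ha8 : a < 8) (f : ℕ → ℤ) :
    ∑ D ∈ (Icc 1 Y).filter (fun D => D % 8 = a ∧ q ∣ D), f D =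
      ∑ E ∈ (Icc 1 (Y / q)).filter (fun E => E % 8 = (a * q) % 8), f (q * E) := by
  have hq0 : 0 < q := by omega
  have hqq : q * q % 8 = 1 := by
    have : q % 8 = 1 ∨ q % 8 = 3 ∨ q % 8 = 5 ∨ q % 8 = 7 := by omega
    rcases this with h | h | h | h <;> simp [Nat.mul_mod, h]
  symm
  apply Finset.sum_bij (fun E _ => q * E)
  · intro E hE
    simp only [mem_filter, mem_Icc] at hE ⊢
    obtain ⟨⟨h1, h2⟩, h3⟩ := hE
    refine ⟨⟨by nlinarith, ?_⟩, ?_, dvd_mul_right _ _⟩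
    · rw [Nat.le_div_iff_mul_le hq0] at h2; linarith
    · rw [Nat.mul_mod, h3, Nat.mul_mod, Nat.mod_mod, Nat.mod_mod, ← Nat.mul_mod,
        show q * (a * q) = a * (q * q) by ring, Nat.mul_mod, hqq]
      omega
  · intro a _ b _ h
    exact Nat.eq_of_mul_eq_mul_left hq0 h
  · intro D hD
    simp only [mem_filter, mem_Icc] at hD
    obtain ⟨⟨h1, h2⟩, h3, E, rfl⟩ := hD
    refine ⟨E, ?_, rfl⟩
    simp only [mem_filter, mem_Icc]
    refine ⟨⟨by rcases Nat.eq_zero_or_pos E with h | h; simp [h] at h1; exact h, ?_⟩, ?_⟩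
    · rw [Nat.le_div_iff_mul_le hq0]; linarith
    · rw [← h3, Nat.mul_mod, Nat.mod_mod, ← Nat.mul_mod, show q * E * q = E * (q * q) by ring, Nat.mul_mod, hqq]
      omega
  · intros; rfl

/-- sum of Jacobi symbols over `1 ≤ E ≤ Y`, `E ≡ b mod 8` -/
def VV (Y b n : ℕ) : ℤ := ∑ E ∈ (Icc 1 Y).filter (fun E => E % 8 = b), jacobiSym (E : ℤ) n

lemma VV_eq {Y b n : ℕ} (hb : b % 2 = 1) (hb8 : b < 8) : VV Y b n = UU b ((Y + 8 - b) / 8) n := by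
  rw [VV, UU]
  symm
  apply Finset.sum_bij (fun k _ => 8 * k + b)
  · intro k hk
    simp only [mem_filter, mem_Icc, mem_range] at hk ⊢
    omega
  · intro a _ b _ h; omega
  · intro E hE
    simp only [mem_filter, mem_Icc, mem_range] at hE ⊢
    exact ⟨E / 8, by omega, by omega⟩
  · intros; rfl

/-- sum of Jacobi symbols over square-free `1 ≤ D ≤ X`, `D ≡ a mod 8` -/
def TT (X a n : ℕ) : ℤ :=
  ∑ D ∈ (Icc 1 X).filter (fun D => D % 8 = a ∧ Squarefree D), jacobiSym (D : ℤ) n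

open ArithmeticFunction.Moebius in
lemma TT_eq {X a n : ℕ} (ha : a % 2 = 1) (ha8 : a < 8) :
    TT X a n = ∑ d ∈ (Icc 1 X).filter (fun d => d % 2 = 1), μ d * jacobiSym ((d * d : ℕ):ℤ) n * VV (X / (d * d)) a n := by
  have h1 : TT X a n = ∑ D ∈ (Icc 1 X).filter (fun D => D % 8 = a),
      ∑ d ∈ (Icc 1 X), if d * d ∣ D then μ d * jacobiSym (D : ℤ) n else 0 := by
    rw [TT, ← Finset.filter_filter, Finset.sum_filter]
    apply Finset.sum_congr rfl
    intro D hD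
    simp only [mem_filter, mem_Icc] at hD
    rw [← Finset.sum_filter, ← Finset.sum_mul, ← sqfree_ind hD.1.1 hD.1.2]
    split_ifs <;> simp
  rw [h1, Finset.sum_comm, Finset.sum_filter]
  apply Finset.sum_congr rfl
  intro d hd
  split_ifs with h
  · rw [← Finset.sum_filter, Finset.filter_filter]
    have hdd : d * d % 2 = 1 := by simp [Nat.mul_mod, h]
    rw [sum_dvd_class hdd ha8 (fun D => μ d * jacobiSym (D:ℤ) n), VV, Finset.mul_sum]
    have hd8 : a * (d * d) % 8 = a := by
      have : d % 8 = 1 ∨ d % 8 = 3 ∨ d % 8 = 5 ∨ d % 8 = 7 := by omega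
      have : d * d % 8 = 1 := by
        rcases this with h | h | h | h <;> simp [Nat.mul_mod, h]
      rw [Nat.mul_mod, this]; omega
    rw [hd8]
    apply Finset.sum_congr rfl
    intro E _
    push_cast
    rw [jacobiSym.mul_left (d * d : ℤ) E]; ring
  · apply Finset.sum_eq_zero
    intro D hD
    simp only [mem_filter, mem_Icc] at hD
    rw [if_neg]
    intro hdv
    have : 2 ∣ D := (Dvd.dvd.mul_right (by omega : 2 ∣ d) d).trans hdv
    omega

open ArithmeticFunction.Moebius in
lemma VV_sq {Y a n m : ℕ} (ha : a % 2 = 1) (ha8 : a < 8) (hm : m % 2 = 1) (hn : n ≠ 0):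
    VV Y a (m ^ 2 * n) = ∑ e ∈ m.divisors, μ e * jacobiSym (e:ℤ) n * VV (Y / e) ((a * e) % 8) n := by
  have hm0 : m ≠ 0 := by omega
  have h1 : VV Y a (m ^ 2 * n) = ∑ E ∈ (Icc 1 Y).filter (fun E => E % 8 = a),
      ∑ e ∈ m.divisors, if e ∣ E then μ e * jacobiSym (E : ℤ) n else 0 := by
    rw [VV]
    apply Finset.sum_congr rfl
    intro E hE
    simp only [mem_filter, mem_Icc] at hE
    have : NeZero (m ^ 2) := ⟨by positivity⟩
    have : NeZero n := ⟨hn⟩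
    rw [jacobiSym.mul_right, ← Finset.sum_filter, ← Finset.sum_mul]
    congr 1
    have e : m.divisors.filter (fun e => e ∣ E) = (Nat.gcd m E).divisors := by
      ext e
      have : Nat.gcd m E ≠ 0 := by simp [hm0]
      simp [Nat.dvd_gcd_iff, hm0]
      try tauto
    rw [e, sum_mu _ (by simp [hm0]), jacobiSym.pow_right]
    split_ifs with hg
    · rw [jacobiSym.sq_one]
      rw [Int.gcd_natCast_natCast, Nat.gcd_comm]; exact hg
    · rw [jacobiSym.eq_zero_iff.2 ⟨hm0, by rw [Int.gcd_natCast_natCast, Nat.gcd_comm]; exact hg⟩]; simp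
  rw [h1, Finset.sum_comm]
  apply Finset.sum_congr rfl
  intro e he
  have he := Nat.mem_divisors.1 he
  have he2 : e % 2 = 1 := by
    by_contra h
    have : 2 ∣ m := (by omega : 2 ∣ e).trans he.1
    omega
  rw [← Finset.sum_filter, Finset.filter_filter, sum_dvd_class he2 ha8 (fun D => μ e * jacobiSym (D:ℤ) n), VV, Finset.mul_sum]
  apply Finset.sum_congr rfl
  intro E _
  push_cast
  rw [jacobiSym.mul_left (e : ℤ) E]; ring

lemma TT_bound {X a n m : ℕ} (ha : a % 2 = 1) (ha8 : a < 8) (hm : m % 2 = 1) (hn : n ≠ 0) :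
    |(TT X a (m ^ 2 * n) : ℝ)| ≤ ∑ d ∈ (Icc 1 X).filter (fun d => d % 2 = 1), ∑ e ∈ m.divisors,
      |(VV (X / (d * d) / e) ((a * e) % 8) n : ℝ)| := by
  rw [TT_eq ha ha8]
  push_cast
  refine (Finset.abs_sum_le_sum_abs _ _).trans ?_
  apply Finset.sum_le_sum
  intro d _
  rw [VV_sq ha ha8 hm hn]
  push_cast
  have hmu : ∀ e : ℕ, |((ArithmeticFunction.moebius e : ℤ) : ℝ)| ≤ 1 := by
    intro e
    have := ArithmeticFunction.abs_moebius_le_one (n := e)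
    exact_mod_cast this
  have hj : ∀ (x : ℤ) (k : ℕ), |((jacobiSym x k : ℤ) : ℝ)| ≤ 1 := by
    intro x k
    have := jac_abs_le x k
    exact_mod_cast this
  rw [abs_mul, abs_mul]
  calc _ ≤ 1 * 1 * |∑ e ∈ m.divisors, ((ArithmeticFunction.moebius e : ℤ) : ℝ) * ((jacobiSym (e:ℤ) n : ℤ) : ℝ) * (VV (X / (d * d) / e) ((a * e) % 8) n : ℝ)| := by
        gcongr
        · exact hmu d
        · exact hj _ _
    _ ≤ ∑ e ∈ m.divisors, |((ArithmeticFunction.moebius e : ℤ) : ℝ) * ((jacobiSym (e:ℤ) n : ℤ) : ℝ) * (VV (X / (d * d) / e) ((a * e) % 8) n : ℝ)| := by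
        rw [one_mul, one_mul]; exact Finset.abs_sum_le_sum_abs _ _
    _ ≤ _ := by
        apply Finset.sum_le_sum
        intro e _
        rw [abs_mul, abs_mul]
        calc _ ≤ 1 * 1 * |(VV (X / (d * d) / e) ((a * e) % 8) n : ℝ)| := by
              gcongr
              · exact hmu e
              · exact hj _ _
          _ = _ := by ring

/-- the odd square-free integers in `(1,M]` -/
def OS (M : ℕ) : Finset ℕ := (Icc 1 M).filter (fun n => Odd n ∧ Squarefree n ∧ 1 < n)

lemma OS_sum {X Y M b : ℕ} (hX : 1 ≤ X) (hM : 1 ≤ M) (hY : Y ≤ X) (hb : b % 2 = 1) (hb8 : b < 8) :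
    ∑ n ∈ OS M, |(VV Y b n : ℝ)| / n ≤ 1200 * (Y:ℝ) ^ (2/3:ℝ) * (1 + Real.log (8 * X * M)) ^ 4 := by
  set L := (Y + 8 - b) / 8 with hL
  have hX' : (1:ℝ) ≤ X := by exact_mod_cast hX
  have hM' : (1:ℝ) ≤ M := by exact_mod_cast hM
  have hlam : 1 ≤ 1 + Real.log (8 * X * M) := by
    have : 0 ≤ Real.log (8 * X * M) := Real.log_nonneg (by nlinarith)
    linarith
  rcases Nat.eq_zero_or_pos L with h0 | hLp
  · have : ∑ n ∈ OS M, |(VV Y b n : ℝ)| / n = 0 := by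
      apply Finset.sum_eq_zero
      intro n _
      rw [VV_eq hb hb8, ← hL, h0]; simp [UU]
    rw [this]; positivity
  have hLY : L ≤ Y := by omega
  have h1 : ∑ n ∈ OS M, |(VV Y b n : ℝ)| / n ≤ ∑ j ∈ range (Nat.log 2 M + 1), ∑ n ∈ WW (2 ^ j), |(UU b L n : ℝ)| / (2:ℝ) ^ j := by
    have hmaps : ∀ n ∈ OS M, Nat.log 2 n ∈ range (Nat.log 2 M + 1) := by
      intro n hn
      simp only [OS, mem_filter, mem_Icc] at hn
      have := Nat.log_mono_right (b := 2) hn.1.2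
      rw [mem_range]; omega
    rw [← Finset.sum_fiberwise_of_maps_to hmaps]
    apply Finset.sum_le_sum
    intro j _
    calc _ ≤ ∑ n ∈ WW (2 ^ j), |(VV Y b n : ℝ)| / n := by
          apply Finset.sum_le_sum_of_subset_of_nonneg _ (fun _ _ _ => by positivity)
          intro n hn
          simp only [OS, WW, mem_filter, mem_Icc, mem_Ico] at hn ⊢
          obtain ⟨⟨⟨h1, h2⟩, h3⟩, rfl⟩ := hn
          refine ⟨⟨Nat.pow_log_le_self 2 (by omega), ?_⟩, h3⟩
          have := Nat.lt_pow_succ_log_self (b := 2) (by norm_num) n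
          rw [pow_succ] at this; linarith
      _ ≤ _ := by
          apply Finset.sum_le_sum; intro n hn
          rw [VV_eq hb hb8]
          simp only [WW, mem_filter, mem_Ico] at hn
          have : ((2:ℝ) ^ j) ≤ n := by exact_mod_cast hn.1.1
          gcongr
  have hLX : (L:ℝ) ≤ X := by exact_mod_cast hLY.trans hY
  have hL1 : (1:ℝ) ≤ L := by exact_mod_cast hLp
  have h2 : ∀ j ∈ range (Nat.log 2 M + 1), ∑ n ∈ WW (2 ^ j), |(UU b L n : ℝ)| / (2:ℝ) ^ j ≤
      400 * (Y:ℝ) ^ (2/3:ℝ) * (1 + Real.log (8 * X * M)) ^ 3 := by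
    intro j hj
    rw [mem_range] at hj
    have hjM : 2 ^ j ≤ M := (Nat.pow_le_pow_right (by norm_num) (by omega)).trans (Nat.pow_log_le_self 2 (by omega))
    have hjM' : ((2:ℝ) ^ j) ≤ M := by exact_mod_cast hjM
    have h2j : (1:ℝ) ≤ 2 ^ j := one_le_pow₀ (by norm_num)
    have := lemmaJ (a := b) (L := L) (N := 2 ^ j) Nat.one_le_two_pow hLp hb hb8
    push_cast at this
    rw [← Finset.sum_div, div_le_iff₀ (by positivity)]
    refine this.trans ?_
    have hlog : 0 ≤ Real.log (8 * L * 2 ^ j) := Real.log_nonneg (by nlinarith)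
    have e1 : (L:ℝ) ^ (2/3:ℝ) ≤ (Y:ℝ) ^ (2/3:ℝ) := by
      have : (L:ℝ) ≤ Y := by exact_mod_cast hLY
      gcongr
    calc 400 * (2 ^ j * (L:ℝ) ^ (2/3:ℝ) * (1 + Real.log (8 * L * 2 ^ j)) ^ 3)
        ≤ 400 * (2 ^ j * (Y:ℝ) ^ (2/3:ℝ) * (1 + Real.log (8 * X * M)) ^ 3) := by gcongr
      _ = _ := by ring
  have h3 : ((Nat.log 2 M + 1 : ℕ) : ℝ) ≤ 3 * (1 + Real.log (8 * X * M)) := by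
    have e1 : (Nat.log 2 M : ℝ) * Real.log 2 ≤ Real.log M := by
      rw [← Real.log_pow]
      apply Real.log_le_log (by positivity)
      exact_mod_cast Nat.pow_log_le_self 2 (by omega)
    have e2 : Real.log M ≤ Real.log (8 * X * M) := by
      apply Real.log_le_log (by linarith); nlinarith
    have e3 := Real.log_two_gt_d9
    have e4 : (0:ℝ) ≤ Nat.log 2 M := by positivity
    push_cast
    nlinarith
  calc _ ≤ _ := h1
    _ ≤ ∑ j ∈ range (Nat.log 2 M + 1), 400 * (Y:ℝ) ^ (2/3:ℝ) * (1 + Real.log (8 * X * M)) ^ 3 := Finset.sum_le_sum h2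
    _ = ((Nat.log 2 M + 1 : ℕ) : ℝ) * (400 * (Y:ℝ) ^ (2/3:ℝ) * (1 + Real.log (8 * X * M)) ^ 3) := by
        rw [Finset.sum_const, card_range, nsmul_eq_mul]
    _ ≤ (3 * (1 + Real.log (8 * X * M))) * (400 * (Y:ℝ) ^ (2/3:ℝ) * (1 + Real.log (8 * X * M)) ^ 3) := by gcongr
    _ = _ := by ring

lemma ns_bound : ∃ C : ℝ, 0 < C ∧ ∀ X M a : ℕ, 1 ≤ X → 1 ≤ M → a % 2 = 1 → a < 8 →
    ∑ n ∈ (Icc 1 M).filter (fun n => Odd n ∧ ¬ IsSquare n), |(TT X a n : ℝ)| / n ≤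
      C * ((X:ℝ) ^ (2/3:ℝ) * (1 + Real.log (8 * X * M)) ^ 4) := by
  obtain ⟨C₁, hC₁, hdiv⟩ := divisor_bound (η := 1/2) (by norm_num)
  have hs1 : Summable (fun d : ℕ => (d:ℝ) ^ (-(4/3):ℝ)) := Real.summable_nat_rpow.2 (by norm_num)
  have hs2 : Summable (fun d : ℕ => (d:ℝ) ^ (-(3/2):ℝ)) := Real.summable_nat_rpow.2 (by norm_num)
  set S₁ := ∑' d : ℕ, (d:ℝ) ^ (-(4/3):ℝ) with hS₁
  set S₂ := ∑' d : ℕ, (d:ℝ) ^ (-(3/2):ℝ) with hS₂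
  have hS₁0 : 0 ≤ S₁ := tsum_nonneg (fun _ => by positivity)
  have hS₂0 : 0 ≤ S₂ := tsum_nonneg (fun _ => by positivity)
  refine ⟨1200 * C₁ * S₁ * S₂ + 1, by positivity, ?_⟩
  intro X M a hX hM ha ha8
  set Λ := 1 + Real.log (8 * X * M) with hΛ
  have hX' : (1:ℝ) ≤ X := by exact_mod_cast hX
  have hM' : (1:ℝ) ≤ M := by exact_mod_cast hM
  have hlam : 1 ≤ Λ := by
    have : 0 ≤ Real.log (8 * X * M) := Real.log_nonneg (by nlinarith)
    linarith
  -- step 1: parametrise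
  have h1 : ∑ n ∈ (Icc 1 M).filter (fun n => Odd n ∧ ¬ IsSquare n), |(TT X a n : ℝ)| / n ≤
      ∑ m ∈ (Icc 1 M).filter (fun m => m % 2 = 1), ∑ k ∈ OS M, |(TT X a (m ^ 2 * k) : ℝ)| / ((m ^ 2 * k : ℕ) : ℝ) := by
    rw [← Finset.sum_product']
    have hsub : (Icc 1 M).filter (fun n => Odd n ∧ ¬ IsSquare n) ⊆
        (((Icc 1 M).filter (fun m => m % 2 = 1)) ×ˢ OS M).image (fun p => p.1 ^ 2 * p.2) := by
      intro n hn
      simp only [mem_filter, mem_Icc] at hn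
      obtain ⟨⟨hn1, hn2⟩, hodd, hns⟩ := hn
      obtain ⟨s, b, h, hs⟩ := Nat.sq_mul_squarefree n
      have hb : b ≠ 0 := by rintro rfl; simp at h; omega
      have hs0 := hs.ne_zero
      rw [← h] at hodd
      have ho := Nat.odd_mul.1 hodd
      have hob : Odd b := by
        rcases Nat.even_or_odd b with hh | hh
        · exact absurd ho.1 (by rw [Nat.not_odd_iff_even]; exact hh.pow_of_ne_zero (by norm_num))
        · exact hh
      have hsn : s ≤ n := by rw [← h]; exact Nat.le_mul_of_pos_left _ (by positivity)
      have hbn : b ≤ n := by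
        rw [← h]
        calc b ≤ b ^ 2 := Nat.le_self_pow (by norm_num) b
          _ ≤ _ := Nat.le_mul_of_pos_right _ (by omega)
      rw [mem_image]
      refine ⟨(b, s), ?_, h⟩
      simp only [mem_product, OS, mem_filter, mem_Icc]
      refine ⟨⟨⟨by omega, by omega⟩, Nat.odd_iff.1 hob⟩, ⟨by omega, by omega⟩, ho.2, hs, ?_⟩
      by_contra hs1
      have : s = 1 := by omega
      apply hns
      exact ⟨b, by rw [← h, this]; ring⟩
    refine (Finset.sum_le_sum_of_subset_of_nonneg hsub (fun _ _ _ => by positivity)).trans ?_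
    apply Finset.sum_image_le_of_nonneg (f := fun n : ℕ => |(TT X a n : ℝ)| / (n:ℝ))
    intros; positivity
  refine h1.trans ?_
  have h2 : ∀ m ∈ (Icc 1 M).filter (fun m => m % 2 = 1),
      ∑ k ∈ OS M, |(TT X a (m ^ 2 * k) : ℝ)| / ((m ^ 2 * k : ℕ) : ℝ) ≤
        (1200 * C₁ * S₁ * ((X:ℝ) ^ (2/3:ℝ) * Λ ^ 4)) * (m:ℝ) ^ (-(3/2):ℝ) := by
    intro m hm
    simp only [mem_filter, mem_Icc] at hm
    have hm0 : (0:ℝ) < m := by exact_mod_cast hm.1.1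
    have e1 : ∑ k ∈ OS M, |(TT X a (m ^ 2 * k) : ℝ)| / ((m ^ 2 * k : ℕ) : ℝ) ≤
        (1 / (m:ℝ) ^ 2) * ∑ d ∈ (Icc 1 X).filter (fun d => d % 2 = 1), ∑ e ∈ m.divisors,
          ∑ k ∈ OS M, |(VV (X / (d * d) / e) ((a * e) % 8) k : ℝ)| / k := by
      calc _ ≤ ∑ k ∈ OS M, (∑ d ∈ (Icc 1 X).filter (fun d => d % 2 = 1), ∑ e ∈ m.divisors,
              |(VV (X / (d * d) / e) ((a * e) % 8) k : ℝ)|) / ((m ^ 2 * k : ℕ) : ℝ) := by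
            apply Finset.sum_le_sum
            intro k hk
            have hk0 : k ≠ 0 := by simp [OS] at hk; omega
            gcongr
            exact TT_bound ha ha8 hm.2 hk0
        _ = _ := by
            rw [Finset.mul_sum]
            simp_rw [Finset.mul_sum, Finset.sum_div]
            rw [Finset.sum_comm]
            apply Finset.sum_congr rfl; intro d _
            rw [Finset.sum_comm]
            apply Finset.sum_congr rfl; intro e _
            apply Finset.sum_congr rfl; intro k _
            push_cast
            field_simp
    have e2 : ∀ d ∈ (Icc 1 X).filter (fun d => d % 2 = 1), ∀ e ∈ m.divisors,
        ∑ k ∈ OS M, |(VV (X / (d * d) / e) ((a * e) % 8) k : ℝ)| / k ≤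
          1200 * ((X:ℝ) ^ (2/3:ℝ) * Λ ^ 4) * (d:ℝ) ^ (-(4/3):ℝ) := by
      intro d hd e he
      simp only [mem_filter, mem_Icc] at hd
      have he := Nat.mem_divisors.1 he
      have he2 : e % 2 = 1 := by
        by_contra h
        have : 2 ∣ m := (by omega : 2 ∣ e).trans he.1
        omega
      have hae : a * e % 8 % 2 = 1 := by
        rw [Nat.mod_mod_of_dvd _ (by norm_num), Nat.mul_mod, ha, he2]
      have hYX : X / (d * d) / e ≤ X := (Nat.div_le_self _ _).trans (Nat.div_le_self _ _)
      refine (OS_sum hX hM hYX hae (Nat.mod_lt _ (by norm_num))).trans ?_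
      have hd0 : (0:ℝ) < d := by exact_mod_cast hd.1.1
      have e3 : ((X / (d * d) / e : ℕ) : ℝ) ≤ X * (d:ℝ) ^ (-2:ℝ) := by
        calc ((X / (d * d) / e : ℕ) : ℝ) ≤ ((X / (d * d) : ℕ) : ℝ) := by exact_mod_cast Nat.div_le_self _ _
          _ ≤ (X:ℝ) / ((d * d : ℕ):ℝ) := Nat.cast_div_le
          _ = _ := by
            rw [Real.rpow_neg hd0.le, show (2:ℝ) = ((2:ℕ):ℝ) by norm_num, Real.rpow_natCast]
            push_cast; rw [sq]; rfl
      have e4 : ((X / (d * d) / e : ℕ) : ℝ) ^ (2/3:ℝ) ≤ (X:ℝ) ^ (2/3:ℝ) * (d:ℝ) ^ (-(4/3):ℝ) := by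
        calc _ ≤ (X * (d:ℝ) ^ (-2:ℝ)) ^ (2/3:ℝ) := by gcongr
          _ = _ := by
            rw [Real.mul_rpow (by positivity) (by positivity), ← Real.rpow_mul hd0.le]
            norm_num
      calc _ ≤ 1200 * ((X:ℝ) ^ (2/3:ℝ) * (d:ℝ) ^ (-(4/3):ℝ)) * Λ ^ 4 := by gcongr
        _ = _ := by ring
    have e5 : ∑ d ∈ (Icc 1 X).filter (fun d => d % 2 = 1), ∑ e ∈ m.divisors,
          ∑ k ∈ OS M, |(VV (X / (d * d) / e) ((a * e) % 8) k : ℝ)| / k ≤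
        m.divisors.card * (1200 * ((X:ℝ) ^ (2/3:ℝ) * Λ ^ 4) * S₁) := by
      calc _ ≤ ∑ d ∈ (Icc 1 X).filter (fun d => d % 2 = 1), ∑ e ∈ m.divisors,
            1200 * ((X:ℝ) ^ (2/3:ℝ) * Λ ^ 4) * (d:ℝ) ^ (-(4/3):ℝ) :=
              Finset.sum_le_sum (fun d hd => Finset.sum_le_sum (fun e he => e2 d hd e he))
        _ = m.divisors.card * (1200 * ((X:ℝ) ^ (2/3:ℝ) * Λ ^ 4) * ∑ d ∈ (Icc 1 X).filter (fun d => d % 2 = 1), (d:ℝ) ^ (-(4/3):ℝ)) := by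
              simp_rw [Finset.sum_const, nsmul_eq_mul, ← Finset.mul_sum]
        _ ≤ _ := by
              gcongr
              exact hs1.sum_le_tsum _ (fun _ _ => by positivity)
    calc _ ≤ _ := e1
      _ ≤ (1 / (m:ℝ) ^ 2) * ((C₁ * (m:ℝ) ^ (1/2:ℝ)) * (1200 * ((X:ℝ) ^ (2/3:ℝ) * Λ ^ 4) * S₁)) := by
          gcongr
          refine e5.trans ?_
          gcongr
          exact hdiv m
      _ = (1200 * C₁ * S₁ * ((X:ℝ) ^ (2/3:ℝ) * Λ ^ 4)) * ((m:ℝ) ^ (-2:ℝ) * (m:ℝ) ^ (1/2:ℝ)) := by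
          rw [Real.rpow_neg hm0.le, show (2:ℝ) = ((2:ℕ):ℝ) by norm_num, Real.rpow_natCast]
          ring
      _ = _ := by rw [← Real.rpow_add hm0]; norm_num
  calc _ ≤ _ := Finset.sum_le_sum h2
    _ = (1200 * C₁ * S₁ * ((X:ℝ) ^ (2/3:ℝ) * Λ ^ 4)) * ∑ m ∈ (Icc 1 M).filter (fun m => m % 2 = 1), (m:ℝ) ^ (-(3/2):ℝ) := by
        rw [Finset.mul_sum]
    _ ≤ (1200 * C₁ * S₁ * ((X:ℝ) ^ (2/3:ℝ) * Λ ^ 4)) * S₂ := by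
        gcongr
        exact hs2.sum_le_tsum _ (fun _ _ => by positivity)
    _ ≤ _ := by
        have : 0 ≤ (X:ℝ) ^ (2/3:ℝ) * Λ ^ 4 := by positivity
        nlinarith

end CNM


namespace CNM

open Finset

lemma UU_one (a L : ℕ) : UU a L 1 = L := by
  simp [UU, jacobiSym.one_right]

lemma VV_one_err {X q e b : ℕ} (hq : 1 ≤ q) (he : 1 ≤ e) (hb : b % 2 = 1) (hb8 : b < 8) :
    |(VV (X / q / e) b 1 : ℝ) - X / (8 * q * e)| ≤ ((X:ℝ) / q) ^ (2/3:ℝ) := by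
  rw [VV_eq hb hb8, UU_one, Nat.div_div_eq_div_mul]
  have hq' : (1:ℝ) ≤ q := by exact_mod_cast hq
  have he' : (1:ℝ) ≤ e := by exact_mod_cast he
  set Y := X / (q * e) with hY
  set x : ℝ := X / (q * e) with hx
  have hx0 : 0 ≤ x := by positivity
  have hqe : 0 < q * e := by positivity
  have h1 : (Y:ℝ) ≤ x := by
    rw [hY, hx]
    have := Nat.cast_div_le (m := X) (n := q * e) (α := ℝ)
    push_cast at this; exact this
  have h2 : x < Y + 1 := by
    rw [hx, div_lt_iff₀ (by positivity)]
    have := Nat.lt_mul_div_succ X hqe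
    have h3 : (X:ℝ) < ((q * e : ℕ):ℝ) * ((X / (q * e) + 1 : ℕ):ℝ) := by exact_mod_cast this
    push_cast at h3
    rw [hY]
    push_cast
    linarith
  clear_value Y
  clear hY
  have hxx : (X:ℝ) / (8 * q * e) = x / 8 := by rw [hx]; field_simp
  rw [hxx]
  have hmono : x ^ (2/3:ℝ) ≤ ((X:ℝ) / q) ^ (2/3:ℝ) := by
    have : x ≤ X / q := by
      rw [hx]; apply div_le_div_of_nonneg_left (by positivity) (by positivity); nlinarith
    gcongr
  refine le_trans ?_ hmono
  rcases lt_or_ge x 1 with hlt | hge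
  · have hY0 : Y = 0 := by
      have : (Y:ℝ) < 1 := by linarith
      have : Y < 1 := by exact_mod_cast this
      omega
    have : (Y + 8 - b) / 8 = 0 := by omega
    rw [this]
    have h5 : x ≤ x ^ (2/3:ℝ) := by
      rcases eq_or_lt_of_le hx0 with h | h
      · rw [← h]; positivity
      · calc x = x ^ (1:ℝ) := by simp
          _ ≤ _ := Real.rpow_le_rpow_of_exponent_ge h hlt.le (by norm_num)
    push_cast
    rw [zero_sub, abs_neg, abs_of_nonneg (by positivity)]
    linarith
  · have h5 : (1:ℝ) ≤ x ^ (2/3:ℝ) := Real.one_le_rpow hge (by norm_num)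
    refine le_trans ?_ h5
    set L := (Y + 8 - b) / 8 with hL
    have e1 : 8 * L ≤ Y + 7 := by omega
    have e2 : Y ≤ 8 * L + 7 := by omega
    have e1' : 8 * (L:ℝ) ≤ Y + 7 := by exact_mod_cast e1
    have e2' : (Y:ℝ) ≤ 8 * L + 7 := by exact_mod_cast e2
    push_cast
    rw [abs_le]; constructor <;> linarith

open ArithmeticFunction.Moebius

/-- coefficient at `d` in the density -/
noncomputable def dterm (k d : ℕ) : ℝ :=
  if d % 2 = 1 then ((μ d : ℤ):ℝ) * ((jacobiSym ((d * d : ℕ):ℤ) (k^2) : ℤ):ℝ) *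
    ∑ e ∈ k.divisors, ((μ e : ℤ):ℝ) * (1 / (8 * ((d * d : ℕ):ℝ) * e)) else 0

noncomputable def dens (k : ℕ) : ℝ := ∑' d, dterm k d

lemma mu_le (e : ℕ) : |((μ e : ℤ) : ℝ)| ≤ 1 := by
  have := ArithmeticFunction.abs_moebius_le_one (n := e)
  exact_mod_cast this

lemma jac_le (x : ℤ) (k : ℕ) : |((jacobiSym x k : ℤ) : ℝ)| ≤ 1 := by
  have := jac_abs_le x k
  exact_mod_cast this

lemma rp23 {d : ℕ} (hd : 1 ≤ d) (X : ℕ) : ((X:ℝ) / ((d * d : ℕ):ℝ)) ^ (2/3:ℝ) = (X:ℝ) ^ (2/3:ℝ) * (d:ℝ) ^ (-(4/3):ℝ) := by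
  have hd0 : (0:ℝ) < d := by exact_mod_cast hd
  have : (X:ℝ) / ((d * d : ℕ):ℝ) = X * (d:ℝ) ^ (-2:ℝ) := by
    rw [Real.rpow_neg hd0.le, show (2:ℝ) = ((2:ℕ):ℝ) by norm_num, Real.rpow_natCast]
    push_cast; rw [sq]; rfl
  rw [this, Real.mul_rpow (by positivity) (by positivity), ← Real.rpow_mul hd0.le]
  norm_num

lemma dterm_le (k d : ℕ) : |dterm k d| ≤ k.divisors.card * (d:ℝ) ^ (-(4/3):ℝ) := by
  rw [dterm]
  split_ifs with h
  · have hd : 1 ≤ d := by omega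
    have hd1 : (1:ℝ) ≤ d := by exact_mod_cast hd
    rw [abs_mul, abs_mul]
    calc _ ≤ 1 * 1 * ∑ e ∈ k.divisors, (d:ℝ) ^ (-(4/3):ℝ) := by
          gcongr
          · exact mu_le d
          · exact jac_le _ _
          · refine (Finset.abs_sum_le_sum_abs _ _).trans ?_
            apply Finset.sum_le_sum
            intro e he
            have he1 : 1 ≤ e := Nat.pos_of_mem_divisors he
            have he1' : (1:ℝ) ≤ e := by exact_mod_cast he1
            rw [abs_mul]
            have h1 : (d:ℝ) ^ (-2:ℝ) ≤ (d:ℝ) ^ (-(4/3):ℝ) :=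
              Real.rpow_le_rpow_of_exponent_le hd1 (by norm_num)
            have h2 : (d:ℝ) ^ (-2:ℝ) = 1 / ((d * d : ℕ):ℝ) := by
              rw [Real.rpow_neg (by positivity), show (2:ℝ) = ((2:ℕ):ℝ) by norm_num, Real.rpow_natCast]
              push_cast; rw [sq, one_div]
            calc _ ≤ 1 * |1 / (8 * ((d * d : ℕ):ℝ) * e)| := by gcongr; exact mu_le e
              _ = 1 / (8 * ((d * d : ℕ):ℝ) * e) := by rw [one_mul, abs_of_nonneg (by positivity)]
              _ ≤ 1 / ((d * d : ℕ):ℝ) := by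
                  push_cast
                  apply one_div_le_one_div_of_le (by positivity)
                  nlinarith [mul_pos (show (0:ℝ) < d by linarith) (show (0:ℝ) < d by linarith)]
              _ ≤ _ := by rw [← h2]; exact h1
      _ = _ := by rw [Finset.sum_const, nsmul_eq_mul]; ring
  · simp; positivity

noncomputable def S43 : ℝ := ∑' d : ℕ, (d:ℝ) ^ (-(4/3):ℝ)

lemma summ43 : Summable (fun d : ℕ => (d:ℝ) ^ (-(4/3):ℝ)) := Real.summable_nat_rpow.2 (by norm_num)

lemma S43_nonneg : 0 ≤ S43 := tsum_nonneg (fun _ => by positivity)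

lemma dterm_summable (k : ℕ) : Summable (dterm k) :=
  Summable.of_norm_bounded (summ43.mul_left (k.divisors.card : ℝ)) (fun d => dterm_le k d)

lemma dens_le (k : ℕ) : |dens k| ≤ k.divisors.card * S43 := by
  have := tsum_of_norm_bounded (f := dterm k) (summ43.mul_left (k.divisors.card : ℝ)).hasSum (fun d => dterm_le k d)
  rw [tsum_mul_left] at this
  exact this

lemma TT_sq {X a k : ℕ} (ha : a % 2 = 1) (ha8 : a < 8) (hk : k % 2 = 1) :
    |(TT X a (k ^ 2) : ℝ) - dens k * X| ≤ k.divisors.card * (S43 * (X:ℝ) ^ (2/3:ℝ)) := by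
  set g : ℕ → ℝ := fun d => if d % 2 = 1 then ((μ d : ℤ):ℝ) * ((jacobiSym ((d * d : ℕ):ℤ) (k^2) : ℤ):ℝ) *
    ∑ e ∈ k.divisors, ((μ e : ℤ):ℝ) * (VV (X / (d * d) / e) ((a * e) % 8) 1 : ℝ) else 0 with hg
  have hz : ∀ d ∉ Icc 1 X, g d = 0 := by
    intro d hd
    simp only [hg]
    split_ifs with h
    · have hdX : X < d := by
        simp only [mem_Icc] at hd; omega
      have : X / (d * d) = 0 := Nat.div_eq_of_lt (by nlinarith)
      rw [this]
      simp [VV]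
    · rfl
  have h1 : (TT X a (k ^ 2) : ℝ) = ∑' d, g d := by
    rw [tsum_eq_sum hz, TT_eq ha ha8, Finset.sum_filter]
    push_cast
    apply Finset.sum_congr rfl
    intro d _
    simp only [hg]
    split_ifs with h
    · have := VV_sq (Y := X / (d * d)) (n := 1) (m := k) ha ha8 hk (by norm_num)
      rw [mul_one] at this
      rw [this]
      push_cast
      simp [jacobiSym.one_right]
    · simp
  have hgs : Summable g := summable_of_ne_finset_zero hz
  have h2 : dens k * X = ∑' d, dterm k d * X := by rw [dens, tsum_mul_right]
  rw [h1, h2, ← hgs.tsum_sub ((dterm_summable k).mul_right _)]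
  have hb : ∀ d, ‖g d - dterm k d * X‖ ≤ k.divisors.card * ((X:ℝ) ^ (2/3:ℝ)) * (d:ℝ) ^ (-(4/3):ℝ) := by
    intro d
    simp only [hg, dterm]
    split_ifs with h
    · have hd : 1 ≤ d := by omega
      have e1 : ((μ d : ℤ):ℝ) * ((jacobiSym ((d * d : ℕ):ℤ) (k^2) : ℤ):ℝ) *
          ∑ e ∈ k.divisors, ((μ e : ℤ):ℝ) * (VV (X / (d * d) / e) ((a * e) % 8) 1 : ℝ) -
          ((μ d : ℤ):ℝ) * ((jacobiSym ((d * d : ℕ):ℤ) (k^2) : ℤ):ℝ) *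
          (∑ e ∈ k.divisors, ((μ e : ℤ):ℝ) * (1 / (8 * ((d * d : ℕ):ℝ) * e))) * X =
          ((μ d : ℤ):ℝ) * ((jacobiSym ((d * d : ℕ):ℤ) (k^2) : ℤ):ℝ) *
          ∑ e ∈ k.divisors, ((μ e : ℤ):ℝ) * ((VV (X / (d * d) / e) ((a * e) % 8) 1 : ℝ) - X / (8 * ((d * d : ℕ):ℝ) * e)) := by
        simp_rw [mul_sub, Finset.sum_sub_distrib]
        rw [mul_sub, mul_assoc _ _ (X:ℝ), Finset.sum_mul]
        congr 2
        apply Finset.sum_congr rfl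
        intro e _
        ring
      rw [e1, Real.norm_eq_abs, abs_mul, abs_mul]
      calc _ ≤ 1 * 1 * ∑ e ∈ k.divisors, (X:ℝ) ^ (2/3:ℝ) * (d:ℝ) ^ (-(4/3):ℝ) := by
            gcongr
            · exact mu_le d
            · exact jac_le _ _
            · refine (Finset.abs_sum_le_sum_abs _ _).trans ?_
              apply Finset.sum_le_sum
              intro e he
              have he1 : 1 ≤ e := Nat.pos_of_mem_divisors he
              have he2 : e % 2 = 1 := by
                by_contra h'
                have : 2 ∣ k := (by omega : 2 ∣ e).trans (Nat.dvd_of_mem_divisors he)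
                omega
              have hae : a * e % 8 % 2 = 1 := by
                rw [Nat.mod_mod_of_dvd _ (by norm_num), Nat.mul_mod, ha, he2]
              rw [abs_mul, ← rp23 hd]
              have := VV_one_err (X := X) (q := d * d) (e := e) (b := a * e % 8) (by nlinarith) he1 hae (Nat.mod_lt _ (by norm_num))
              calc _ ≤ 1 * |(VV (X / (d * d) / e) ((a * e) % 8) 1 : ℝ) - X / (8 * ((d * d : ℕ):ℝ) * e)| := by
                    gcongr; exact mu_le e
                _ ≤ _ := by rw [one_mul]; exact this
        _ = _ := by rw [Finset.sum_const, nsmul_eq_mul]; ring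
    · simp; positivity
  have := tsum_of_norm_bounded (summ43.mul_left (k.divisors.card * ((X:ℝ) ^ (2/3:ℝ)))).hasSum hb
  rw [tsum_mul_left, Real.norm_eq_abs] at this
  refine this.trans (le_of_eq ?_)
  rw [S43]; ring

lemma TT_sq_nonneg (X a k : ℕ) : 0 ≤ TT X a (k ^ 2) := by
  rw [TT]
  apply Finset.sum_nonneg
  intro D _
  rw [jacobiSym.pow_right]; positivity

lemma dens_nonneg {k : ℕ} (hk : k % 2 = 1) : 0 ≤ dens k := by
  by_contra hneg
  push Not at hneg
  set C := k.divisors.card * S43 with hC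
  have hC0 : 0 ≤ C := mul_nonneg (by positivity) S43_nonneg
  -- X * |dens| ≤ C X^{2/3}
  have h1 : ∀ X : ℕ, (-dens k) * X ≤ C * (X:ℝ) ^ (2/3:ℝ) := by
    intro X
    have h1 := TT_sq (X := X) (a := 1) (by norm_num) (by norm_num) hk
    have h2 : (0:ℝ) ≤ TT X 1 (k^2) := by exact_mod_cast TT_sq_nonneg X 1 k
    rw [abs_le] at h1
    rw [hC]; nlinarith [h1.2]
  obtain ⟨N, hN⟩ := exists_nat_gt (C / (-dens k))
  have hN0 : (0:ℝ) < N := lt_of_le_of_lt (div_nonneg hC0 (by linarith)) hN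
  have h2 := h1 (N ^ 3)
  push_cast at h2
  have h3 : (((N:ℝ)) ^ 3) ^ (2/3:ℝ) = N ^ 2 := by
    rw [← Real.rpow_natCast, ← Real.rpow_mul hN0.le, ← Real.rpow_natCast]; norm_num
  rw [h3] at h2
  rw [div_lt_iff₀ (by linarith)] at hN
  nlinarith [mul_lt_mul_of_pos_right hN (show 0 < (N:ℝ) ^ 2 by positivity)]

lemma dens_one_pos : 0 < dens 1 := by
  have hd : ∀ d, dterm 1 d = if d % 2 = 1 then ((μ d : ℤ):ℝ) * (1 / (8 * (d:ℝ)^2)) else 0 := by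
    intro d
    rw [dterm]
    split_ifs
    · simp [jacobiSym.one_right, sq]
    · rfl
  have hs := dterm_summable 1
  rw [dens, ← hs.sum_add_tsum_nat_add 3]
  have hz := hasSum_zeta_two
  have hz2 : HasSum (fun n : ℕ => (1:ℝ) / (8 * ((n + 3 : ℕ):ℝ) ^ 2)) ((Real.pi ^ 2 / 6 - (1 + 1/4)) / 8) := by
    have h1 := (hasSum_nat_add_iff' 3).2 hz
    have h2 := h1.div_const 8
    have e1 : (fun n : ℕ => (1:ℝ) / (8 * ((n + 3 : ℕ):ℝ) ^ 2)) = fun n : ℕ => (1:ℝ) / ((n + 3 : ℕ):ℝ) ^ 2 / 8 := by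
      funext n; rw [div_div, mul_comm (8:ℝ)]
    have e2 : ∑ i ∈ range 3, (1:ℝ) / (i:ℝ) ^ 2 = 1 + 1 / 4 := by
      simp [Finset.sum_range_succ]; norm_num
    rw [e2] at h2
    rw [e1]; exact h2
  have hb : ∀ n : ℕ, ‖dterm 1 (n + 3)‖ ≤ (1:ℝ) / (8 * ((n + 3 : ℕ):ℝ) ^ 2) := by
    intro n
    rw [hd]
    split_ifs
    · rw [Real.norm_eq_abs, abs_mul, abs_of_nonneg (show 0 ≤ (1:ℝ) / (8 * ((n + 3 : ℕ):ℝ) ^ 2) by positivity)]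
      calc _ ≤ 1 * ((1:ℝ) / (8 * ((n + 3 : ℕ):ℝ) ^ 2)) := by gcongr; exact mu_le _
        _ = _ := one_mul _
    · simp; positivity
  have := tsum_of_norm_bounded hz2 hb
  rw [Real.norm_eq_abs, abs_le] at this
  have h3 : ∑ i ∈ range 3, dterm 1 i = 1 / 8 := by
    simp [Finset.sum_range_succ, hd]
  rw [h3]
  have hpi : Real.pi ^ 2 < 12 := by nlinarith [Real.pi_lt_d2, Real.pi_gt_three]
  nlinarith [this.1]

end CNM


namespace CNM

open Finset

def oddsZ (Z : ℕ) : Finset ℕ := (Icc 1 Z).filter (fun n => Odd n)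

noncomputable def ellZ (ψ : ℕ → ℤ) (Z D : ℕ) : ℝ :=
  ∑ n ∈ oddsZ Z, (ψ n : ℝ) * ((jacobiSym (D:ℤ) n : ℤ) : ℝ) / n

def alph (r Z n : ℕ) : ℕ := ((Fintype.piFinset (fun _ : Fin r => oddsZ Z)).filter (fun p => ∏ i, p i = n)).card

def dr (r n : ℕ) : ℕ := ((Fintype.piFinset (fun _ : Fin r => n.divisors)).filter (fun p => ∏ i, p i = n)).card

lemma dr_le (r n : ℕ) : dr r n ≤ n.divisors.card ^ r := by
  rw [dr]
  refine (Finset.card_filter_le _ _).trans ?_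
  rw [Fintype.card_piFinset]; simp

lemma dr_one (r : ℕ) : 1 ≤ dr r 1 := by
  rw [dr, Nat.one_le_iff_ne_zero, Finset.card_ne_zero]
  refine ⟨fun _ => 1, ?_⟩
  simp

lemma alph_le {r Z n : ℕ} (hn : n ≠ 0) : alph r Z n ≤ dr r n := by
  apply Finset.card_le_card
  intro p hp
  simp only [mem_filter, Fintype.mem_piFinset] at hp ⊢
  refine ⟨fun i => ?_, hp.2⟩
  rw [Nat.mem_divisors]
  exact ⟨hp.2 ▸ Finset.dvd_prod_of_mem _ (Finset.mem_univ i), hn⟩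

lemma alph_eq {r Z n : ℕ} (hn : Odd n) (hZ : n ≤ Z) : alph r Z n = dr r n := by
  have hn0 : n ≠ 0 := by rintro rfl; simp at hn
  apply le_antisymm (alph_le hn0)
  apply Finset.card_le_card
  intro p hp
  simp only [mem_filter, Fintype.mem_piFinset, oddsZ, mem_Icc] at hp ⊢
  refine ⟨fun i => ?_, hp.2⟩
  have h1 := Nat.dvd_of_mem_divisors (hp.1 i)
  have h2 := Nat.pos_of_mem_divisors (hp.1 i)
  exact ⟨⟨h2, (Nat.le_of_dvd (by omega) h1).trans hZ⟩, Odd.of_dvd_nat hn h1⟩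

lemma prod_odd {r Z : ℕ} {p : Fin r → ℕ} (hp : p ∈ Fintype.piFinset (fun _ : Fin r => oddsZ Z)) :
    Odd (∏ i, p i) ∧ ∏ i, p i ∈ Icc 1 (Z ^ r) := by
  simp only [Fintype.mem_piFinset, oddsZ, mem_filter, mem_Icc] at hp
  refine ⟨?_, ?_⟩
  · apply Finset.prod_induction _ (fun n => Odd n) (fun _ _ h1 h2 => h1.mul h2) odd_one (fun i _ => (hp i).2)
  · rw [mem_Icc]
    refine ⟨Nat.one_le_iff_ne_zero.2 (Finset.prod_ne_zero_iff.2 (fun i _ => by have := (hp i).1.1; omega)), ?_⟩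
    calc _ ≤ ∏ _i : Fin r, Z := Finset.prod_le_prod' (fun i _ => (hp i).1.2)
      _ = _ := by simp

lemma alph_zero {r Z n : ℕ} (hn : ¬ (Odd n ∧ n ∈ Icc 1 (Z ^ r))) : alph r Z n = 0 := by
  rw [alph, Finset.card_eq_zero, Finset.filter_eq_empty_iff]
  intro p hp h
  exact hn (h ▸ prod_odd hp)

lemma jac_prod {ι : Type*} (s : Finset ι) (p : ι → ℕ) (hp : ∀ i ∈ s, p i ≠ 0) (D : ℤ) :
    ∏ i ∈ s, jacobiSym D (p i) = jacobiSym D (∏ i ∈ s, p i) := by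
  classical
  induction s using Finset.induction_on with
  | empty => simp [jacobiSym.one_right]
  | insert i s hi ih =>
    rw [Finset.prod_insert hi, Finset.prod_insert hi, ih (fun j hj => hp j (by simp [hj]))]
    rw [jacobiSym.mul_right' _ (hp i (by simp)) (Finset.prod_ne_zero_iff.2 (fun j hj => hp j (by simp [hj])))]

structure Psi (ψ : ℕ → ℤ) : Prop where
  one : ψ 1 = 1
  mul : ∀ m n, m ≠ 0 → n ≠ 0 → ψ (m * n) = ψ m * ψ n
  bd : ∀ n, |ψ n| ≤ 1
  sq : ∀ k, Odd k → ψ (k ^ 2) = 1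

lemma psi_prod {ψ : ℕ → ℤ} (hψ : Psi ψ) {ι : Type*} (s : Finset ι) (p : ι → ℕ) (hp : ∀ i ∈ s, p i ≠ 0) :
    ∏ i ∈ s, ψ (p i) = ψ (∏ i ∈ s, p i) := by
  classical
  induction s using Finset.induction_on with
  | empty => simp [hψ.one]
  | insert i s hi ih =>
    rw [Finset.prod_insert hi, Finset.prod_insert hi, ih (fun j hj => hp j (by simp [hj]))]
    rw [hψ.mul _ _ (hp i (by simp)) (Finset.prod_ne_zero_iff.2 (fun j hj => hp j (by simp [hj])))]

lemma ellZ_pow {ψ : ℕ → ℤ} (hψ : Psi ψ) (r Z D : ℕ) :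
    ellZ ψ Z D ^ r = ∑ n ∈ Icc 1 (Z ^ r), (alph r Z n : ℝ) * ((ψ n : ℝ) * ((jacobiSym (D:ℤ) n : ℤ) : ℝ) / n) := by
  have h1 : ellZ ψ Z D ^ r = ∑ p ∈ Fintype.piFinset (fun _ : Fin r => oddsZ Z),
      ∏ i, ((ψ (p i) : ℝ) * ((jacobiSym (D:ℤ) (p i) : ℤ) : ℝ) / (p i : ℝ)) := by
    have := Finset.prod_univ_sum (fun _ : Fin r => oddsZ Z) (fun _ n => (ψ n : ℝ) * ((jacobiSym (D:ℤ) n : ℤ) : ℝ) / (n:ℝ))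
    rw [← this, Finset.prod_const, Finset.card_univ, Fintype.card_fin, ellZ]
  rw [h1, ← Finset.sum_fiberwise_of_maps_to (fun p hp => (prod_odd hp).2)]
  apply Finset.sum_congr rfl
  intro n _
  rw [alph, ← nsmul_eq_mul, ← Finset.sum_const]
  apply Finset.sum_congr rfl
  intro p hp
  simp only [mem_filter, Fintype.mem_piFinset, oddsZ, mem_Icc] at hp
  have hp0 : ∀ i ∈ (Finset.univ : Finset (Fin r)), p i ≠ 0 := fun i _ => by have := (hp.1 i).1.1; omega
  rw [← hp.2, ← psi_prod hψ _ _ hp0, ← jac_prod _ _ hp0]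
  push_cast
  rw [← Finset.prod_mul_distrib, ← Finset.prod_div_distrib]

lemma sum_ellZ_pow {ψ : ℕ → ℤ} (hψ : Psi ψ) (r Z X a : ℕ) :
    ∑ D ∈ (Icc 1 X).filter (fun D => D % 8 = a ∧ Squarefree D), ellZ ψ Z D ^ r =
    ∑ n ∈ Icc 1 (Z ^ r), (alph r Z n : ℝ) * (ψ n : ℝ) * ((TT X a n : ℤ) : ℝ) / n := by
  simp_rw [ellZ_pow hψ]
  rw [Finset.sum_comm]
  apply Finset.sum_congr rfl
  intro n _
  rw [TT]
  push_cast
  rw [Finset.mul_sum, Finset.sum_div]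
  apply Finset.sum_congr rfl
  intro D _
  ring

lemma sq_part (M : ℕ) (G : ℕ → ℝ) :
    ∑ n ∈ (Icc 1 M).filter (fun n => IsSquare n), G n =
      ∑ k ∈ (Icc 1 M).filter (fun k => k ^ 2 ≤ M), G (k ^ 2) := by
  symm
  apply Finset.sum_bij (fun k _ => k ^ 2)
  · intro k hk
    simp only [mem_filter, mem_Icc] at hk ⊢
    exact ⟨⟨Nat.one_le_pow _ _ (by omega), hk.2⟩, ⟨k, by ring⟩⟩
  · intro a _ b _ h
    exact Nat.pow_left_injective (n := 2) (by norm_num) h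
  · intro n hn
    simp only [mem_filter, mem_Icc] at hn
    obtain ⟨⟨h1, h2⟩, k, rfl⟩ := hn
    have hk : 1 ≤ k := by
      rcases Nat.eq_zero_or_pos k with h | h
      · simp [h] at h1
      · exact h
    refine ⟨k, ?_, by ring⟩
    simp only [mem_filter, mem_Icc]
    exact ⟨⟨hk, by nlinarith⟩, by nlinarith⟩
  · intros; rfl

/-- coefficient of the leading constant -/
noncomputable def cterm (r k : ℕ) : ℝ := if Odd k then (dr r (k ^ 2) : ℝ) * dens k / (k:ℝ) ^ 2 else 0

lemma dr_tau_bound (r : ℕ) : ∃ C : ℝ, 1 ≤ C ∧ ∀ k : ℕ, 1 ≤ k →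
    (dr r (k ^ 2) : ℝ) * k.divisors.card ≤ C * (k:ℝ) ^ (1/6:ℝ) := by
  set η : ℝ := 1 / (6 * (2 * r + 1)) with hη
  have hη0 : 0 < η := by positivity
  obtain ⟨C, hC, hd⟩ := divisor_bound hη0
  refine ⟨C ^ r * C, by nlinarith [one_le_pow₀ hC (n := r)], fun k hk => ?_⟩
  have hk0 : (0:ℝ) < k := by exact_mod_cast hk
  calc (dr r (k ^ 2) : ℝ) * k.divisors.card ≤ (((k^2).divisors.card : ℝ) ^ r) * k.divisors.card := by
        gcongr; exact_mod_cast dr_le r (k^2)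
    _ ≤ (C * (((k^2 : ℕ):ℝ)) ^ η) ^ r * (C * (k:ℝ) ^ η) := by
        gcongr
        · exact hd _
        · exact hd _
    _ = C ^ r * C * ((k:ℝ) ^ (2 * η * r) * (k:ℝ) ^ η) := by
        push_cast
        rw [mul_pow, ← Real.rpow_natCast (k:ℝ) 2, ← Real.rpow_mul hk0.le, ← Real.rpow_natCast _ r, ← Real.rpow_natCast _ r,
          ← Real.rpow_mul hk0.le]
        push_cast; ring
    _ = _ := by
        rw [← Real.rpow_add hk0]
        congr 2
        rw [hη]; field_simp

lemma rpow_combine {k : ℕ} (hk : 1 ≤ k) : (k:ℝ) ^ (1/6:ℝ) / (k:ℝ) ^ 2 = (k:ℝ) ^ (-(3/2):ℝ) * (k:ℝ) ^ (-(1/3):ℝ) := by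
  have hk0 : (0:ℝ) < k := by exact_mod_cast hk
  rw [← Real.rpow_natCast, ← Real.rpow_sub hk0, ← Real.rpow_add hk0]
  norm_num

lemma summ32 : Summable (fun d : ℕ => (d:ℝ) ^ (-(3/2):ℝ)) := Real.summable_nat_rpow.2 (by norm_num)

lemma key_square (r : ℕ) (hr : 1 ≤ r) :
    Summable (cterm r) ∧ 0 < ∑' k, cterm r k ∧
    ∃ C : ℝ, 0 < C ∧ ∀ (ψ : ℕ → ℤ), Psi ψ → ∀ X a : ℕ, 1 ≤ X → a % 2 = 1 → a < 8 →
      |∑ n ∈ (Icc 1 ((X^2) ^ r)).filter (fun n => IsSquare n),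
        (alph r (X^2) n : ℝ) * (ψ n : ℝ) * ((TT X a n : ℤ) : ℝ) / n - (∑' k, cterm r k) * X| ≤ C * (X:ℝ) ^ (2/3:ℝ) := by
  obtain ⟨C₀, hC₀, hdt⟩ := dr_tau_bound r
  have hb : ∀ k, ‖cterm r k‖ ≤ (C₀ * S43) * (k:ℝ) ^ (-(3/2):ℝ) := by
    intro k
    rw [cterm]
    split_ifs with h
    · have hk : 1 ≤ k := h.pos
      have hk1 : (1:ℝ) ≤ k := by exact_mod_cast hk
      rw [Real.norm_eq_abs, abs_div, abs_mul, abs_of_nonneg (show (0:ℝ) ≤ dr r (k^2) by positivity), abs_of_nonneg (show (0:ℝ) ≤ (k:ℝ)^2 by positivity)]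
      calc _ ≤ (dr r (k^2) : ℝ) * (k.divisors.card * S43) / (k:ℝ)^2 := by gcongr; exact dens_le k
        _ = ((dr r (k^2) : ℝ) * k.divisors.card) * S43 / (k:ℝ)^2 := by ring
        _ ≤ (C₀ * (k:ℝ) ^ (1/6:ℝ)) * S43 / (k:ℝ)^2 := by
            have := S43_nonneg
            exact div_le_div_of_nonneg_right (mul_le_mul_of_nonneg_right (hdt k hk) this) (by positivity)
        _ = (C₀ * S43) * ((k:ℝ) ^ (1/6:ℝ) / (k:ℝ) ^ 2) := by ring
        _ ≤ _ := by
            rw [rpow_combine hk]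
            have : (k:ℝ) ^ (-(1/3):ℝ) ≤ 1 := Real.rpow_le_one_of_one_le_of_nonpos hk1 (by norm_num)
            have h0 : 0 ≤ (k:ℝ) ^ (-(3/2):ℝ) := by positivity
            have := S43_nonneg
            gcongr
            nlinarith
    · simp; have := S43_nonneg; positivity
  have hsum : Summable (cterm r) := Summable.of_norm_bounded (summ32.mul_left _) hb
  refine ⟨hsum, ?_, ?_⟩
  · have hnn : ∀ k, 0 ≤ cterm r k := by
      intro k
      rw [cterm]
      split_ifs with h
      · have := dens_nonneg (Nat.odd_iff.1 h)
        positivity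
      · rfl
    apply hsum.tsum_pos hnn 1
    rw [cterm, if_pos odd_one]
    have h1 : (1:ℝ) ≤ dr r 1 := by exact_mod_cast dr_one r
    have h2 := dens_one_pos
    simp only [one_pow]
    positivity
  set S := ∑' k : ℕ, (k:ℝ) ^ (-(3/2):ℝ) with hS
  have hS0 : 0 ≤ S := tsum_nonneg (fun _ => by positivity)
  have hS43 := S43_nonneg
  refine ⟨2 * C₀ * S43 * S + 1, by positivity, ?_⟩
  intro ψ hψ X a hX ha ha8
  set M := (X^2)^r with hM
  have hX1 : (1:ℝ) ≤ X := by exact_mod_cast hX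
  set A : ℕ → ℝ := fun k => (alph r (X^2) (k^2) : ℝ) with hA
  have hA0 : ∀ k, ¬ (k ∈ (Icc 1 M).filter (fun k => k ^ 2 ≤ M) ∧ Odd k) → A k = 0 := by
    intro k hk
    simp only [hA]
    rw [alph_zero]; · simp
    intro ⟨h1, h2⟩
    apply hk
    rw [mem_Icc] at h2
    have hk2 : 1 ≤ k := by
      rcases Nat.eq_zero_or_pos k with h | h
      · simp [h] at h1
      · exact h
    have : Odd k := by
      rcases Nat.even_or_odd k with hh | hh
      · exact absurd h1 (by rw [Nat.not_odd_iff_even]; exact hh.pow_of_ne_zero (by norm_num))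
      · exact hh
    refine ⟨?_, this⟩
    simp only [mem_filter, mem_Icc]
    exact ⟨⟨hk2, by nlinarith [h2.2]⟩, h2.2⟩
  have h1 : ∑ n ∈ (Icc 1 M).filter (fun n => IsSquare n),
        (alph r (X^2) n : ℝ) * (ψ n : ℝ) * ((TT X a n : ℤ) : ℝ) / n = ∑' k, A k * ((TT X a (k^2) : ℤ) : ℝ) / (k:ℝ)^2 := by
    rw [sq_part, tsum_eq_sum (s := (Icc 1 M).filter (fun k => k ^ 2 ≤ M))]
    · apply Finset.sum_congr rfl
      intro k hk
      by_cases ho : Odd k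
      · rw [hψ.sq k ho]; simp [hA]
      · have := hA0 k (fun h => ho h.2)
        simp only [hA] at this ⊢
        rw [this]; simp
    · intro k hk
      rw [hA0 k (fun h => hk h.1)]; simp
  have hfs : Summable (fun k => A k * ((TT X a (k^2) : ℤ) : ℝ) / (k:ℝ)^2) := by
    apply summable_of_ne_finset_zero (s := (Icc 1 M).filter (fun k => k ^ 2 ≤ M))
    intro k hk
    rw [hA0 k (fun h => hk h.1)]; simp
  rw [h1, ← tsum_mul_right, ← hfs.tsum_sub (hsum.mul_right _)]
  have hterm : ∀ k, ‖A k * ((TT X a (k^2) : ℤ) : ℝ) / (k:ℝ)^2 - cterm r k * X‖ ≤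
      (2 * C₀ * S43 * (X:ℝ) ^ (2/3:ℝ)) * (k:ℝ) ^ (-(3/2):ℝ) := by
    intro k
    by_cases ho : Odd k
    · have hk : 1 ≤ k := ho.pos
      have hk1 : (1:ℝ) ≤ k := by exact_mod_cast hk
      rw [cterm, if_pos ho]
      have hAle : A k ≤ dr r (k^2) := by
        simp only [hA]; exact_mod_cast alph_le (by positivity)
      have hAnn : 0 ≤ A k := by simp only [hA]; positivity
      set t : ℝ := (k.divisors.card : ℝ) with ht
      have ht0 : 0 ≤ t := by positivity
      have e1 : |A k * (((TT X a (k^2) : ℤ) : ℝ) - dens k * X)| ≤ dr r (k^2) * (t * (S43 * (X:ℝ) ^ (2/3:ℝ))) := by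
        rw [abs_mul, abs_of_nonneg hAnn]
        gcongr
        exact TT_sq ha ha8 (Nat.odd_iff.1 ho)
      have e2 : |(A k - dr r (k^2)) * dens k| * X ≤ (dr r (k^2) * (t * S43)) * ((X:ℝ) ^ (2/3:ℝ) * (k:ℝ)^(1/3:ℝ)) := by
        by_cases hkX : k ≤ X
        · have : A k = dr r (k^2) := by
            simp only [hA]
            rw [alph_eq (ho.pow) (by gcongr)]
          rw [this]; simp; positivity
        · push Not at hkX
          have hX3 : (X:ℝ) ≤ (X:ℝ) ^ (2/3:ℝ) * (k:ℝ)^(1/3:ℝ) := by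
            calc (X:ℝ) = (X:ℝ) ^ (2/3:ℝ) * (X:ℝ)^(1/3:ℝ) := by
                  rw [← Real.rpow_add (by linarith)]; norm_num
              _ ≤ _ := by
                  have : (X:ℝ) ≤ k := by exact_mod_cast hkX.le
                  gcongr
          have : |A k - dr r (k^2)| ≤ dr r (k^2) := by
            rw [abs_le]; constructor <;> linarith
          rw [abs_mul]
          gcongr
          exact dens_le k
      have e3 : A k * ((TT X a (k^2) : ℤ) : ℝ) / (k:ℝ)^2 - (dr r (k ^ 2) : ℝ) * dens k / (k:ℝ) ^ 2 * X =
         (A k * (((TT X a (k^2) : ℤ) : ℝ) - dens k * X) + (A k - dr r (k^2)) * dens k * X) / (k:ℝ)^2 := by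
        field_simp; ring
      have hk3 : 1 ≤ (k:ℝ)^(1/3:ℝ) := Real.one_le_rpow hk1 (by norm_num)
      rw [e3, Real.norm_eq_abs, abs_div, abs_of_nonneg (show (0:ℝ) ≤ (k:ℝ)^2 by positivity)]
      calc _ ≤ (dr r (k^2) * (t * (S43 * (X:ℝ) ^ (2/3:ℝ))) * (k:ℝ)^(1/3:ℝ) + (dr r (k^2) * (t * S43)) * ((X:ℝ) ^ (2/3:ℝ) * (k:ℝ)^(1/3:ℝ))) / (k:ℝ)^2 := by
            gcongr
            refine (abs_add_le _ _).trans (add_le_add (e1.trans (le_mul_of_one_le_right (by positivity) hk3)) ?_)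
            rw [abs_mul, abs_of_nonneg (show (0:ℝ) ≤ X by positivity)]
            exact e2
        _ = (2 * S43 * (X:ℝ) ^ (2/3:ℝ) * (k:ℝ)^(1/3:ℝ)) * (dr r (k^2) * t) / (k:ℝ)^2 := by ring
        _ ≤ (2 * S43 * (X:ℝ) ^ (2/3:ℝ) * (k:ℝ)^(1/3:ℝ)) * (C₀ * (k:ℝ) ^ (1/6:ℝ)) / (k:ℝ)^2 := by
            exact div_le_div_of_nonneg_right (mul_le_mul_of_nonneg_left (hdt k hk) (by positivity)) (by positivity)
        _ = (2 * C₀ * S43 * (X:ℝ) ^ (2/3:ℝ) * (k:ℝ)^(1/3:ℝ)) * ((k:ℝ) ^ (1/6:ℝ) / (k:ℝ)^2) := by ring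
        _ = (2 * C₀ * S43 * (X:ℝ) ^ (2/3:ℝ)) * (k:ℝ) ^ (-(3/2):ℝ) * ((k:ℝ)^(1/3:ℝ) * (k:ℝ) ^ (-(1/3):ℝ)) := by
            rw [rpow_combine hk]; ring
        _ = _ := by rw [← Real.rpow_add (by linarith)]; simp
    · rw [cterm, if_neg ho, hA0 k (fun h => ho h.2)]
      simp; positivity
  have := tsum_of_norm_bounded (summ32.mul_left (2 * C₀ * S43 * (X:ℝ) ^ (2/3:ℝ))).hasSum hterm
  rw [tsum_mul_left, Real.norm_eq_abs] at this
  refine this.trans ?_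
  have : 0 ≤ (X:ℝ) ^ (2/3:ℝ) := by positivity
  rw [← hS]
  nlinarith

lemma key (r : ℕ) (hr : 1 ≤ r) :
    ∃ c : ℝ, 0 < c ∧ ∀ ε : ℝ, 0 < ε → ∃ C : ℝ, 0 < C ∧ ∀ (ψ : ℕ → ℤ), Psi ψ → ∀ X a : ℕ, 1 ≤ X → a % 2 = 1 → a < 8 →
      |∑ D ∈ (Icc 1 X).filter (fun D => D % 8 = a ∧ Squarefree D), ellZ ψ (X^2) D ^ r - c * X| ≤ C * (X:ℝ) ^ (2/3 + ε) := by
  obtain ⟨-, hc, C₁, hC₁, hsq⟩ := key_square r hr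
  refine ⟨∑' k, cterm r k, hc, fun ε hε => ?_⟩
  obtain ⟨C₂, hC₂, hns⟩ := ns_bound
  set η : ℝ := ε / (4 * r * r) with hη
  have hr0 : (1:ℝ) ≤ r := by exact_mod_cast hr
  have hη0 : 0 < η := by positivity
  obtain ⟨C₃, hC₃, hd⟩ := divisor_bound hη0
  -- log bound
  obtain ⟨C₄, hC₄, hlog⟩ : ∃ C₄ : ℝ, 0 < C₄ ∧ ∀ X : ℕ, 1 ≤ X → (1 + Real.log (8 * X * ((X^2)^r : ℕ))) ^ 4 ≤ C₄ * (X:ℝ) ^ (ε/2) := by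
    set B : ℝ := 1 + Real.log 8 + (2 * r + 1) * (8 / ε) with hB
    have hl8 : 0 < Real.log 8 := Real.log_pos (by norm_num)
    refine ⟨B ^ 4, by positivity, fun X hX => ?_⟩
    have hX1 : (1:ℝ) ≤ X := by exact_mod_cast hX
    have e1 : Real.log (8 * X * ((X^2)^r : ℕ)) = Real.log 8 + (2 * r + 1) * Real.log X := by
      push_cast
      rw [Real.log_mul (by positivity) (by positivity), Real.log_mul (by positivity) (by positivity), Real.log_pow, Real.log_pow]
      push_cast; ring
    have e2 : Real.log X ≤ (X:ℝ) ^ (ε/8) * (8 / ε) := by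
      have := Real.log_le_rpow_div (show (0:ℝ) ≤ X by positivity) (show 0 < ε / 8 by positivity)
      refine this.trans (le_of_eq ?_)
      field_simp
    have e3 : 1 ≤ (X:ℝ) ^ (ε/8) := Real.one_le_rpow hX1 (by positivity)
    have e0 : 0 ≤ Real.log X := Real.log_nonneg hX1
    have e4 : 1 + Real.log (8 * X * ((X^2)^r : ℕ)) ≤ B * (X:ℝ) ^ (ε/8) := by
      rw [e1, hB]
      have : (2 * (r:ℝ) + 1) * Real.log X ≤ (2 * r + 1) * ((X:ℝ) ^ (ε/8) * (8 / ε)) := by gcongr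
      nlinarith
    calc _ ≤ (B * (X:ℝ) ^ (ε/8)) ^ 4 := by
          have : 0 ≤ 1 + Real.log (8 * X * ((X^2)^r : ℕ)) := by rw [e1]; positivity
          gcongr
      _ = _ := by
          rw [mul_pow, ← Real.rpow_natCast (_ ^ (ε/8)), ← Real.rpow_mul (by positivity)]
          congr 2; push_cast; ring
  refine ⟨C₁ + C₃ ^ r * (C₂ * C₄), by positivity, ?_⟩
  intro ψ hψ X a hX ha ha8
  set M := (X^2)^r with hM
  have hX1 : (1:ℝ) ≤ X := by exact_mod_cast hX
  have hM1 : 1 ≤ M := Nat.one_le_pow _ _ (by positivity)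
  rw [sum_ellZ_pow hψ, ← Finset.sum_filter_add_sum_filter_not _ (fun n => IsSquare n)]
  have h1 := hsq ψ hψ X a hX ha ha8
  have hα : ∀ n ∈ Icc 1 M, (alph r (X^2) n : ℝ) ≤ C₃ ^ r * (X:ℝ) ^ (ε/2) := by
    intro n hn
    rw [mem_Icc] at hn
    have hnM : (n:ℝ) ≤ M := by exact_mod_cast hn.2
    calc (alph r (X^2) n : ℝ) ≤ (n.divisors.card : ℝ) ^ r := by
          exact_mod_cast (alph_le (by omega)).trans (dr_le r n)
      _ ≤ (C₃ * (M:ℝ) ^ η) ^ r := by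
          gcongr
          exact (hd n).trans (by gcongr)
      _ = _ := by
          rw [mul_pow, hM]
          push_cast
          rw [← pow_mul, ← Real.rpow_natCast (X:ℝ) (2 * r), ← Real.rpow_mul (by positivity), ← Real.rpow_natCast _ r, ← Real.rpow_natCast _ r,
            ← Real.rpow_mul (by positivity)]
          congr 2
          rw [hη]; push_cast; field_simp; norm_num
  have h2 : |∑ n ∈ (Icc 1 M).filter (fun n => ¬ IsSquare n),
        (alph r (X^2) n : ℝ) * (ψ n : ℝ) * ((TT X a n : ℤ) : ℝ) / n| ≤ C₃ ^ r * (C₂ * C₄) * (X:ℝ) ^ (2/3 + ε) := by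
    calc _ ≤ ∑ n ∈ (Icc 1 M).filter (fun n => ¬ IsSquare n), |(alph r (X^2) n : ℝ) * (ψ n : ℝ) * ((TT X a n : ℤ) : ℝ) / n| :=
          Finset.abs_sum_le_sum_abs _ _
      _ ≤ ∑ n ∈ (Icc 1 M).filter (fun n => Odd n ∧ ¬ IsSquare n), C₃ ^ r * (X:ℝ) ^ (ε/2) * (|((TT X a n : ℤ) : ℝ)| / n) := by
          rw [Finset.sum_filter, Finset.sum_filter]
          apply Finset.sum_le_sum
          intro n hn
          by_cases h : IsSquare n
          · simp [h]
          by_cases ho : Odd n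
          · rw [if_pos h, if_pos ⟨ho, h⟩, abs_div, abs_mul, abs_mul, Nat.abs_cast, Nat.abs_cast, mul_div_assoc]
            have : |(ψ n : ℝ)| ≤ 1 := by exact_mod_cast hψ.bd n
            calc _ ≤ (C₃ ^ r * (X:ℝ) ^ (ε/2)) * 1 * (|((TT X a n : ℤ) : ℝ)| / n) := by
                  gcongr
                  exact hα n hn
              _ = _ := by ring
          · rw [if_pos h, if_neg (fun hh => ho hh.1), alph_zero (fun hh => ho hh.1)]; simp
      _ = C₃ ^ r * (X:ℝ) ^ (ε/2) * ∑ n ∈ (Icc 1 M).filter (fun n => Odd n ∧ ¬ IsSquare n), |((TT X a n : ℤ) : ℝ)| / n := by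
          rw [Finset.mul_sum]
      _ ≤ C₃ ^ r * (X:ℝ) ^ (ε/2) * (C₂ * ((X:ℝ) ^ (2/3:ℝ) * (C₄ * (X:ℝ) ^ (ε/2)))) := by
          have hh := hns X M a hX hM1 ha ha8
          have hl := hlog X hX
          gcongr
          refine hh.trans ?_
          gcongr
      _ = C₃ ^ r * (C₂ * C₄) * ((X:ℝ) ^ (2/3:ℝ) * ((X:ℝ) ^ (ε/2) * (X:ℝ) ^ (ε/2))) := by ring
      _ = _ := by
          rw [← Real.rpow_add (by positivity), ← Real.rpow_add (by positivity)]
          congr 3; ring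
  have h3 : (X:ℝ) ^ (2/3:ℝ) ≤ (X:ℝ) ^ (2/3 + ε) := Real.rpow_le_rpow_of_exponent_le hX1 (by linarith)
  calc _ ≤ C₁ * (X:ℝ) ^ (2/3:ℝ) + C₃ ^ r * (C₂ * C₄) * (X:ℝ) ^ (2/3 + ε) := by
        rw [add_sub_right_comm]
        exact (abs_add_le _ _).trans (add_le_add h1 h2)
    _ ≤ _ := by rw [add_mul]; gcongr

end CNM


namespace CNM

open Finset

lemma ellZ_le {ψ : ℕ → ℤ} (hψ : Psi ψ) (Z D : ℕ) : |ellZ ψ Z D| ≤ 1 + Real.log Z := by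
  rw [ellZ]
  calc _ ≤ ∑ n ∈ oddsZ Z, |(ψ n : ℝ) * ((jacobiSym (D:ℤ) n : ℤ) : ℝ) / n| := Finset.abs_sum_le_sum_abs _ _
    _ ≤ ∑ n ∈ oddsZ Z, (1:ℝ) / n := by
        apply Finset.sum_le_sum
        intro n _
        rw [abs_div, abs_mul, Nat.abs_cast]
        gcongr
        have h1 : |(ψ n : ℝ)| ≤ 1 := by exact_mod_cast hψ.bd n
        have h2 := jac_le (D:ℤ) n
        have := abs_nonneg (ψ n : ℝ)
        nlinarith [abs_nonneg ((jacobiSym (D:ℤ) n : ℤ) : ℝ)]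
    _ ≤ ∑ n ∈ Icc 1 Z, (1:ℝ) / n :=
        Finset.sum_le_sum_of_subset_of_nonneg (Finset.filter_subset _ _) (fun _ _ _ => by positivity)
    _ ≤ _ := sum_inv_le Z

lemma log_pow_bound (r : ℕ) {ε : ℝ} (hε : 0 < ε) : ∃ C : ℝ, 0 < C ∧ ∀ X : ℕ, 1 ≤ X →
    (17 + 2 * Real.log X) ^ r ≤ C * (X:ℝ) ^ ε := by
  set η : ℝ := ε / (r + 1) with hη
  have hη0 : 0 < η := by positivity
  refine ⟨(17 + 2 / η) ^ r, by positivity, fun X hX => ?_⟩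
  have hX1 : (1:ℝ) ≤ X := by exact_mod_cast hX
  have e2 := Real.log_le_rpow_div (show (0:ℝ) ≤ X by positivity) hη0
  have e3 : 1 ≤ (X:ℝ) ^ η := Real.one_le_rpow hX1 (by positivity)
  have e0 : 0 ≤ Real.log X := Real.log_nonneg hX1
  calc (17 + 2 * Real.log X) ^ r ≤ ((17 + 2 / η) * (X:ℝ) ^ η) ^ r := by
        gcongr
        have : 2 * Real.log X ≤ 2 / η * (X:ℝ) ^ η := by
          calc _ ≤ 2 * ((X:ℝ) ^ η / η) := by gcongr
            _ = _ := by ring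
        nlinarith
    _ = (17 + 2 / η) ^ r * (X:ℝ) ^ (η * r) := by
        rw [mul_pow, ← Real.rpow_natCast (_ ^ η), ← Real.rpow_mul (by positivity)]
    _ ≤ _ := by
        have : η * r ≤ ε := by
          rw [hη, div_mul_eq_mul_div, div_le_iff₀ (by positivity)]; nlinarith
        gcongr

lemma moment (r : ℕ) (hr : 1 ≤ r) :
    ∃ c : ℝ, 0 < c ∧ ∀ ε : ℝ, 0 < ε → ∃ C : ℝ, 0 < C ∧ ∀ (ψ : ℕ → ℤ), Psi ψ → ∀ a : ℕ, a % 2 = 1 → a < 8 →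
      ∀ g : ℕ → ℝ, (∀ D, D % 8 = a → Squarefree D → (D ≤ 8 ∧ g D = 0) ∨ ∀ Z : ℕ, 1 ≤ Z → |g D - ellZ ψ Z D| ≤ 16 * D / Z) →
      ∀ X : ℕ, 1 ≤ X →
      |∑ D ∈ (Icc 1 X).filter (fun D => D % 8 = a ∧ Squarefree D), g D ^ r - c * X| ≤ C * (X:ℝ) ^ (2/3 + ε) := by
  obtain ⟨c, hc, hkey⟩ := key r hr
  refine ⟨c, hc, fun ε hε => ?_⟩
  obtain ⟨C₁, hC₁, hk⟩ := hkey ε hε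
  obtain ⟨C₂, hC₂, hl⟩ := log_pow_bound r hε
  refine ⟨C₁ + (16 * r + 9) * C₂, by positivity, ?_⟩
  intro ψ hψ a ha ha8 g hg X hX
  have hX1 : (1:ℝ) ≤ X := by exact_mod_cast hX
  set W : ℝ := 17 + 2 * Real.log X with hW
  have e0 : 0 ≤ Real.log X := Real.log_nonneg hX1
  have hW1 : 1 ≤ W := by linarith
  have hell : ∀ D, |ellZ ψ (X^2) D| ≤ W - 16 := by
    intro D
    have := ellZ_le hψ (X^2) D
    push_cast at this
    rw [Real.log_pow] at this
    push_cast at this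
    linarith
  have hD : ∀ D ∈ (Icc 1 X).filter (fun D => D % 8 = a ∧ Squarefree D),
      |g D ^ r - ellZ ψ (X^2) D ^ r| ≤ 16 * r * W ^ r / X + if D ≤ 8 then W ^ r else 0 := by
    intro D hD
    simp only [mem_filter, mem_Icc] at hD
    rcases hg D hD.2.1 hD.2.2 with ⟨h1, h2⟩ | h
    · rw [if_pos h1, h2, zero_pow (by omega), zero_sub, abs_neg, abs_pow]
      have : |ellZ ψ (X^2) D| ^ r ≤ W ^ r := by gcongr; linarith [hell D]
      have : 0 ≤ 16 * r * W ^ r / X := by positivity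
      linarith
    · have h1 := h (X^2) (Nat.one_le_pow _ _ hX)
      have hDX : (D:ℝ) ≤ X := by exact_mod_cast hD.1.2
      have h2 : 16 * (D:ℝ) / ((X^2 : ℕ):ℝ) ≤ 16 / X := by
        push_cast
        rw [div_le_div_iff₀ (by positivity) (by positivity)]
        nlinarith
      have h3 : (16:ℝ) / X ≤ 16 := by
        rw [div_le_iff₀ (by positivity)]; linarith
      have hgD : |g D| ≤ W := by
        have := abs_sub_abs_le_abs_sub (g D) (ellZ ψ (X^2) D)
        linarith [hell D]
      have h4 := abs_pow_sub_pow_le (g D) (ellZ ψ (X^2) D) r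
      have h5 : max |g D| |ellZ ψ (X^2) D| ≤ W := max_le hgD (by linarith [hell D])
      have h6 : 0 ≤ (if D ≤ 8 then W ^ r else 0 : ℝ) := by split_ifs <;> positivity
      have h7 : (max |g D| |ellZ ψ (X^2) D|) ^ (r - 1) ≤ W ^ r := by
        calc _ ≤ W ^ (r - 1) := by gcongr
          _ ≤ _ := pow_le_pow_right₀ hW1 (by omega)
      calc _ ≤ |g D - ellZ ψ (X^2) D| * r * (max |g D| |ellZ ψ (X^2) D|) ^ (r - 1) := h4
        _ ≤ (16 / X) * r * W ^ r := by
            gcongr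
            linarith
        _ = 16 * r * W ^ r / X := by ring
        _ ≤ _ := by linarith
  have h2 : |∑ D ∈ (Icc 1 X).filter (fun D => D % 8 = a ∧ Squarefree D), g D ^ r -
      ∑ D ∈ (Icc 1 X).filter (fun D => D % 8 = a ∧ Squarefree D), ellZ ψ (X^2) D ^ r| ≤ (16 * r + 9) * W ^ r := by
    rw [← Finset.sum_sub_distrib]
    calc _ ≤ ∑ D ∈ (Icc 1 X).filter (fun D => D % 8 = a ∧ Squarefree D), (16 * r * W ^ r / X + if D ≤ 8 then W ^ r else 0) :=
          (Finset.abs_sum_le_sum_abs _ _).trans (Finset.sum_le_sum hD)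
      _ ≤ ∑ D ∈ Icc 1 X, (16 * r * W ^ r / X + if D ≤ 8 then W ^ r else 0) := by
          apply Finset.sum_le_sum_of_subset_of_nonneg (Finset.filter_subset _ _)
          intro D _ _
          have : 0 ≤ (if D ≤ 8 then W ^ r else 0 : ℝ) := by split_ifs <;> positivity
          positivity
      _ = 16 * r * W ^ r + ((Icc 1 X).filter (fun D => D ≤ 8)).card * W ^ r := by
          rw [Finset.sum_add_distrib, Finset.sum_const, ← Finset.sum_filter, Finset.sum_const]
          simp only [nsmul_eq_mul, Nat.card_Icc, Nat.add_sub_cancel]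
          field_simp
      _ ≤ 16 * r * W ^ r + 9 * W ^ r := by
          gcongr
          have : ((Icc 1 X).filter (fun D => D ≤ 8)).card ≤ (range 9).card := by
            apply Finset.card_le_card
            intro x hx; simp at hx ⊢; omega
          rw [card_range] at this
          exact_mod_cast this
      _ = _ := by ring
  have h3 := hk ψ hψ X a hX ha ha8
  have h4 := hl X hX
  have h5 : (X:ℝ) ^ ε ≤ (X:ℝ) ^ (2/3 + ε) := Real.rpow_le_rpow_of_exponent_le hX1 (by linarith)
  calc _ ≤ _ := abs_sub_le _ (∑ D ∈ (Icc 1 X).filter (fun D => D % 8 = a ∧ Squarefree D), ellZ ψ (X^2) D ^ r) _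
    _ ≤ (16 * r + 9) * (C₂ * (X:ℝ) ^ ε) + C₁ * (X:ℝ) ^ (2/3 + ε) := by
        gcongr
        refine h2.trans ?_
        gcongr
    _ ≤ (16 * r + 9) * (C₂ * (X:ℝ) ^ (2/3 + ε)) + C₁ * (X:ℝ) ^ (2/3 + ε) := by gcongr
    _ = _ := by ring

/-- two-sided convexity bounds -/
lemma rpow_conv {s u v : ℝ} (hs : 0 ≤ s) (hu : 0 ≤ u) (huv : u ≤ v) :
    (s + 1) * (v - u) * u ^ s ≤ v ^ (s + 1) - u ^ (s + 1) ∧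
    v ^ (s + 1) - u ^ (s + 1) ≤ (s + 1) * (v - u) * v ^ s := by
  have gen : ∀ x y : ℝ, 0 < x → 0 ≤ y → x ^ (s+1) + (s+1) * (y - x) * x ^ s ≤ y ^ (s+1) := by
    intro x y hx hy
    have h1 := one_add_mul_self_le_rpow_one_add (s := y / x - 1) (by have : 0 ≤ y / x := by positivity
                                                                     linarith) (p := s + 1) (by linarith)
    have h2 : 1 + (y / x - 1) = y / x := by ring
    rw [h2, Real.div_rpow hy hx.le, le_div_iff₀ (by positivity)] at h1
    have h3 : x ^ (s+1) = x ^ s * x := by rw [Real.rpow_add hx, Real.rpow_one]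
    refine le_trans (le_of_eq ?_) h1
    rw [h3]; field_simp
  constructor
  · rcases eq_or_lt_of_le hu with h | h
    · rw [← h, Real.zero_rpow (by linarith : s + 1 ≠ 0)]
      rcases eq_or_lt_of_le hs with hs0 | hs0
      · rw [← hs0]; simp
      · rw [Real.zero_rpow (by linarith)]
        have : 0 ≤ v ^ (s+1) := Real.rpow_nonneg (hu.trans huv) _
        linarith
    · linarith [gen u v h (hu.trans huv)]
  · rcases eq_or_lt_of_le (hu.trans huv) with h | h
    · have : u = 0 := by linarith
      rw [← h, this]; simp
    · linarith [gen v u h hu]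

lemma sum_rpow {s : ℝ} (hs : 0 ≤ s) : ∃ C : ℝ, 0 < C ∧ ∀ x : ℝ, 1 ≤ x →
    |∑ n ∈ Icc 1 ⌊x⌋₊, (n:ℝ) ^ s - x ^ (s + 1) / (s + 1)| ≤ C * x ^ s := by
  refine ⟨2 * 3 ^ s, by positivity, fun x hx => ?_⟩
  set X := ⌊x⌋₊ with hX
  have hX1 : (X:ℝ) ≤ x := Nat.floor_le (by linarith)
  have hX2 : x < X + 1 := Nat.lt_floor_add_one x
  have tel : ∀ N : ℕ, (N:ℝ) ^ (s+1) ≤ (s+1) * ∑ n ∈ Icc 1 N, (n:ℝ) ^ s ∧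
      (s+1) * ∑ n ∈ Icc 1 N, (n:ℝ) ^ s ≤ ((N:ℝ)+1) ^ (s+1) := by
    intro N
    induction N with
    | zero => simp [Real.zero_rpow (by linarith : s + 1 ≠ 0)]
    | succ N ih =>
      rw [Finset.sum_Icc_succ_top (by omega)]
      have h1 := rpow_conv (u := N) (v := (N:ℝ)+1) hs (by positivity) (by linarith)
      have h2 := rpow_conv (u := (N:ℝ)+1) (v := (N:ℝ)+1+1) hs (by positivity) (by linarith)
      push_cast
      constructor
      · nlinarith [h1.2, ih.1]
      · nlinarith [h2.1, ih.2]
  obtain ⟨t1, t2⟩ := tel X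
  have hxs : 0 ≤ x ^ s := by positivity
  have h3x : (x + 1) ^ s ≤ 3 ^ s * x ^ s := by
    rw [← Real.mul_rpow (by norm_num) (by linarith)]
    gcongr; linarith
  have h31 : (1:ℝ) ≤ 3 ^ s := Real.one_le_rpow (by norm_num) hs
  have u1 : ((X:ℝ)+1) ^ (s+1) ≤ (x+1) ^ (s+1) := by gcongr
  have u2 := (rpow_conv (u := x) (v := x+1) hs (by linarith) (by linarith)).2
  have u3 : (x-1) ^ (s+1) ≤ (X:ℝ) ^ (s+1) := by
    have : 0 ≤ x - 1 := by linarith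
    gcongr; linarith
  have u4 := (rpow_conv (u := x-1) (v := x) hs (by linarith) (by linarith)).2
  have hs1 : 0 < s + 1 := by linarith
  have key : |(s+1) * ∑ n ∈ Icc 1 X, (n:ℝ) ^ s - x ^ (s + 1)| ≤ (s+1) * (2 * 3 ^ s * x ^ s) := by
    rw [abs_le]
    constructor
    · have : (s+1) * x ^ s ≤ (s+1) * (2 * 3 ^ s * x ^ s) := by gcongr; nlinarith
      nlinarith
    · have : (s+1) * (x+1) ^ s ≤ (s+1) * (2 * 3 ^ s * x ^ s) := by gcongr; nlinarith
      nlinarith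
  have : ∑ n ∈ Icc 1 X, (n:ℝ) ^ s - x ^ (s + 1) / (s + 1) = ((s+1) * ∑ n ∈ Icc 1 X, (n:ℝ) ^ s - x ^ (s + 1)) / (s+1) := by
    field_simp
  rw [this, abs_div, abs_of_pos hs1, div_le_iff₀ hs1]
  linarith

/-- partial summation -/
lemma partial_sum {s c C θ : ℝ} (hs : 0 ≤ s) (hC : 0 ≤ C) (hθ : 0 ≤ θ) (u : ℕ → ℝ)
    (h : ∀ X : ℕ, |∑ n ∈ Icc 1 X, u n - c * X| ≤ C * (X:ℝ) ^ θ) (X : ℕ) :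
    |∑ n ∈ Icc 1 X, (n:ℝ) ^ s * u n - c * ∑ n ∈ Icc 1 X, (n:ℝ) ^ s| ≤ 2 * C * (X:ℝ) ^ (θ) * (X:ℝ) ^ s := by
  set E : ℕ → ℝ := fun N => ∑ n ∈ Icc 1 N, u n - c * N with hE
  have hid : ∀ N : ℕ, ∑ n ∈ Icc 1 N, (n:ℝ) ^ s * u n - c * ∑ n ∈ Icc 1 N, (n:ℝ) ^ s =
      (N:ℝ) ^ s * E N - ∑ n ∈ range N, E n * (((n + 1 : ℕ):ℝ) ^ s - (n:ℝ) ^ s) := by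
    intro N
    induction N with
    | zero => simp [hE]
    | succ N ih =>
      rw [Finset.sum_Icc_succ_top (by omega), Finset.sum_Icc_succ_top (by omega), Finset.sum_range_succ]
      have : E (N+1) = E N + u (N+1) - c := by
        simp only [hE]
        rw [Finset.sum_Icc_succ_top (by omega)]; push_cast; ring
      rw [this]
      linear_combination ih
  rw [hid]
  have hb : |∑ n ∈ range X, E n * (((n + 1 : ℕ):ℝ) ^ s - (n:ℝ) ^ s)| ≤ C * (X:ℝ) ^ θ * (X:ℝ) ^ s := by
    calc _ ≤ ∑ n ∈ range X, |E n * (((n + 1 : ℕ):ℝ) ^ s - (n:ℝ) ^ s)| := Finset.abs_sum_le_sum_abs _ _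
      _ ≤ ∑ n ∈ range X, C * (X:ℝ) ^ θ * (((n + 1 : ℕ):ℝ) ^ s - (n:ℝ) ^ s) := by
          apply Finset.sum_le_sum
          intro n hn
          rw [mem_range] at hn
          have hm : (n:ℝ) ^ s ≤ ((n + 1 : ℕ):ℝ) ^ s := by gcongr; simp
          rw [abs_mul, abs_of_nonneg (sub_nonneg.2 hm)]
          have : |E n| ≤ C * (X:ℝ) ^ θ := by
            refine (h n).trans ?_
            have : (n:ℝ) ≤ X := by exact_mod_cast hn.le
            gcongr
          exact mul_le_mul_of_nonneg_right this (sub_nonneg.2 hm)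
      _ = C * (X:ℝ) ^ θ * ((X:ℝ) ^ s - (0:ℝ) ^ s) := by
          rw [← Finset.mul_sum, Finset.sum_range_sub (fun n : ℕ => (n:ℝ) ^ s)]; simp
      _ ≤ _ := by
          have : 0 ≤ (0:ℝ) ^ s := by positivity
          gcongr; linarith
  have h1 : |(X:ℝ) ^ s * E X| ≤ C * (X:ℝ) ^ θ * (X:ℝ) ^ s := by
    rw [abs_mul, abs_of_nonneg (by positivity), mul_comm]
    gcongr
    exact h X
  rw [sub_eq_add_neg]
  refine (abs_add_le _ _).trans ?_
  rw [abs_neg]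
  linarith

end CNM


namespace CNM

open Finset

lemma class_sum (r : ℕ) (hr : 1 ≤ r) (κ : ℕ) (hκ : 1 ≤ κ) (hκ8 : κ ≤ 8) (a : ℕ) (ha : a % 2 = 1) (ha8 : a < 8)
    (lam : ℝ) (hlam : 0 < lam) :
    ∃ c : ℝ, 0 < c ∧ ∀ ε : ℝ, 0 < ε → ∃ C : ℝ, 0 < C ∧ ∀ (ψ : ℕ → ℤ), Psi ψ → ∀ H : ℕ → ℝ,
      (∀ D, D % 8 = a → Squarefree D → (κ * D ≤ 8 ∧ H D = 1) ∨
        ∃ g : ℝ, H D = lam * √(D:ℝ) * g ∧ ∀ Z : ℕ, 1 ≤ Z → |g - ellZ ψ Z D| ≤ 16 * D / Z) →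
      ∀ Y : ℝ, 1 ≤ Y →
      |∑ D ∈ (Icc 1 ⌊Y / κ⌋₊).filter (fun D => D % 8 = a ∧ Squarefree D), H D ^ r - c * Y ^ ((r:ℝ)/2 + 1)| ≤
        C * Y ^ ((r:ℝ)/2 + 2/3 + ε) := by
  obtain ⟨c₀, hc₀, hm⟩ := moment r hr
  set s : ℝ := (r:ℝ)/2 with hs
  have hs0 : 0 ≤ s := by positivity
  obtain ⟨C₂, hC₂, hsum⟩ := sum_rpow hs0
  have hκ0 : (0:ℝ) < κ := by exact_mod_cast hκ
  have hκ1 : (1:ℝ) ≤ κ := by exact_mod_cast hκ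
  have hκ8' : (κ:ℝ) ≤ 8 := by exact_mod_cast hκ8
  set c : ℝ := lam ^ r * (c₀ / ((s + 1) * (κ:ℝ) ^ (s+1))) with hc
  have hcpos : 0 < c := by positivity
  refine ⟨c, hcpos, fun ε hε => ?_⟩
  obtain ⟨C₁, hC₁, hm⟩ := hm ε hε
  refine ⟨8 + lam ^ r * (2 * C₁ + c₀ * C₂) + 8 * c, by positivity, fun ψ hψ H hH Y hY => ?_⟩
  have hY0 : 0 < Y := by linarith
  have hYs : Y ^ s ≤ Y ^ (s + 2/3 + ε) := Real.rpow_le_rpow_of_exponent_le hY (by linarith)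
  have hY1 : 1 ≤ Y ^ (s + 2/3 + ε) := Real.one_le_rpow hY (by positivity)
  by_cases hx : Y / κ < 1
  · have h0 : ⌊Y / κ⌋₊ = 0 := Nat.floor_eq_zero.mpr hx
    rw [h0]
    simp only [Icc_eq_empty_of_lt zero_lt_one, filter_empty, sum_empty, zero_sub, abs_neg]
    rw [abs_of_pos (by positivity), Real.rpow_add hY0, Real.rpow_one]
    rw [div_lt_one hκ0] at hx
    calc c * (Y ^ s * Y) ≤ c * (Y ^ (s + 2/3 + ε) * 8) := by gcongr; linarith
      _ = 8 * c * Y ^ (s + 2/3 + ε) := by ring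
      _ ≤ _ := by
        gcongr
        have : 0 ≤ lam ^ r * (2 * C₁ + c₀ * C₂) := by positivity
        linarith
  · push Not at hx
    set X := ⌊Y / κ⌋₊ with hX
    have hXY : (X:ℝ) ≤ Y := by
      refine (Nat.floor_le (by positivity)).trans ?_
      exact div_le_self hY0.le hκ1
    classical
    have hg : ∀ D, ∃ g : ℝ, D % 8 = a → Squarefree D → (κ * D ≤ 8 ∧ H D = 1 ∧ g = 0) ∨
        (H D = lam * √(D:ℝ) * g ∧ ∀ Z : ℕ, 1 ≤ Z → |g - ellZ ψ Z D| ≤ 16 * D / Z) := by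
      intro D
      by_cases h1 : D % 8 = a
      · by_cases h2 : Squarefree D
        · rcases hH D h1 h2 with ⟨h, h'⟩ | ⟨g, h⟩
          · exact ⟨0, fun _ _ => Or.inl ⟨h, h', rfl⟩⟩
          · exact ⟨g, fun _ _ => Or.inr h⟩
        · exact ⟨0, fun _ h => absurd h h2⟩
      · exact ⟨0, fun h => absurd h h1⟩
    choose g hg using hg
    have hmom := hm ψ hψ a ha ha8 g (by
      intro D h1 h2
      rcases hg D h1 h2 with ⟨h, h', h''⟩ | ⟨h, h'⟩
      · left; refine ⟨?_, h''⟩; nlinarith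
      · right; exact h')
    set u : ℕ → ℝ := fun n => if n % 8 = a ∧ Squarefree n then g n ^ r else 0 with hu
    have hps := partial_sum hs0 hC₁.le (by positivity : 0 ≤ 2/3 + ε) u (c := c₀) (by
      intro N
      rcases Nat.eq_zero_or_pos N with rfl | hN
      · simp [Real.zero_rpow (by positivity : 2/3 + ε ≠ 0)]
      · rw [hu, ← Finset.sum_filter]; exact hmom N hN) X
    have hsm := hsum (Y / κ) hx
    rw [← hX] at hsm
    have e1 : |∑ D ∈ (Icc 1 X).filter (fun D => D % 8 = a ∧ Squarefree D), H D ^ r - lam ^ r * ∑ n ∈ Icc 1 X, (n:ℝ) ^ s * u n| ≤ 8 := by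
      have : ∑ n ∈ Icc 1 X, (n:ℝ) ^ s * u n = ∑ D ∈ (Icc 1 X).filter (fun D => D % 8 = a ∧ Squarefree D), (D:ℝ)^s * g D ^ r := by
        rw [Finset.sum_filter]
        apply Finset.sum_congr rfl
        intro n _
        simp only [hu]; split_ifs <;> simp
      rw [this, Finset.mul_sum, ← Finset.sum_sub_distrib]
      refine (Finset.abs_sum_le_sum_abs _ _).trans ?_
      have : ∀ D ∈ (Icc 1 X).filter (fun D => D % 8 = a ∧ Squarefree D),
          |H D ^ r - lam ^ r * ((D:ℝ)^s * g D ^ r)| ≤ if D ≤ 8 then 1 else 0 := by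
        intro D hD
        simp only [mem_filter, mem_Icc] at hD
        rcases hg D hD.2.1 hD.2.2 with ⟨h, h', h''⟩ | ⟨h, h'⟩
        · rw [h', h'', zero_pow (by omega), if_pos (by nlinarith)]; simp
        · have : √(D:ℝ) ^ r = (D:ℝ) ^ s := by
            rw [Real.sqrt_eq_rpow, ← Real.rpow_natCast, ← Real.rpow_mul (by positivity), hs]
            congr 1; ring
          rw [h, mul_pow, mul_pow, this, mul_assoc, sub_self, abs_zero]
          split_ifs <;> norm_num
      refine (Finset.sum_le_sum this).trans ?_
      rw [← Finset.sum_filter, Finset.sum_const, nsmul_eq_mul, mul_one]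
      have : (((Icc 1 X).filter (fun D => D % 8 = a ∧ Squarefree D)).filter (fun D => D ≤ 8)).card ≤ (Icc 1 8).card := by
        apply Finset.card_le_card
        intro D hD
        simp only [mem_filter, mem_Icc] at hD ⊢
        omega
      simp only [Nat.card_Icc] at this
      exact_mod_cast this
    have e2 : |∑ n ∈ Icc 1 X, (n:ℝ) ^ s * u n - c₀ * ∑ n ∈ Icc 1 X, (n:ℝ) ^ s| ≤ 2 * C₁ * Y ^ (s + 2/3 + ε) := by
      refine hps.trans ?_
      rw [mul_assoc, add_assoc, add_comm s, Real.rpow_add hY0]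
      gcongr
    have e3 : |∑ n ∈ Icc 1 X, (n:ℝ) ^ s - (Y / κ) ^ (s + 1) / (s + 1)| ≤ C₂ * Y ^ (s + 2/3 + ε) := by
      refine hsm.trans ?_
      gcongr
      refine le_trans ?_ hYs
      gcongr
      exact div_le_self hY0.le hκ1
    have e4 : c * Y ^ (s + 1) = lam ^ r * (c₀ * ((Y / κ) ^ (s + 1) / (s + 1))) := by
      rw [hc, Real.div_rpow hY0.le hκ0.le]; field_simp
    rw [e4]
    set A := ∑ D ∈ (Icc 1 X).filter (fun D => D % 8 = a ∧ Squarefree D), H D ^ r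
    set B := ∑ n ∈ Icc 1 X, (n:ℝ) ^ s * u n
    set E := ∑ n ∈ Icc 1 X, (n:ℝ) ^ s
    set F := (Y / κ) ^ (s + 1) / (s + 1)
    set W := Y ^ (s + 2/3 + ε)
    calc |A - lam ^ r * (c₀ * F)| = |(A - lam^r * B) + lam ^ r * (B - c₀ * E) + lam^r * c₀ * (E - F)| := by congr 1; ring
      _ ≤ |A - lam^r * B| + |lam ^ r * (B - c₀ * E)| + |lam^r * c₀ * (E - F)| := abs_add_three _ _ _
      _ = |A - lam^r * B| + lam ^ r * |B - c₀ * E| + lam^r * c₀ * |E - F| := by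
        rw [abs_mul, abs_mul, abs_of_pos (by positivity : 0 < lam ^ r), abs_of_pos (by positivity : 0 < lam ^ r * c₀)]
      _ ≤ 8 + lam ^ r * (2 * C₁ * W) + lam^r * c₀ * (C₂ * W) := by gcongr
      _ ≤ 8 * W + lam ^ r * (2 * C₁ * W) + lam^r * c₀ * (C₂ * W) + 8 * c * W := by
        have : 0 ≤ 8 * c * W := by positivity
        linarith
      _ = _ := by ring

end CNM


namespace CNM

open Finset

def cls : Finset (ℕ × ℕ) := {(1,3),(1,7),(4,1),(4,5),(8,1),(8,3),(8,5),(8,7)}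

lemma cls_iff (p : ℕ × ℕ) : p ∈ cls ↔ (p.1 = 1 ∧ (p.2 = 3 ∨ p.2 = 7)) ∨ (p.1 = 4 ∧ (p.2 = 1 ∨ p.2 = 5)) ∨
    (p.1 = 8 ∧ (p.2 = 1 ∨ p.2 = 3 ∨ p.2 = 5 ∨ p.2 = 7)) := by
  obtain ⟨a, b⟩ := p
  simp only [cls, mem_insert, mem_singleton, Prod.mk.injEq]
  omega

lemma fund_of {p : ℕ × ℕ} (hp : p ∈ cls) {D : ℕ} (hD : D % 8 = p.2) (hsq : Squarefree D) :
    IsFundamentalDiscriminant (-((p.1 * D : ℕ) : ℤ)) := by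
  refine ⟨by have : 0 ≤ ((p.1 * D : ℕ) : ℤ) := by positivity
             omega, ?_⟩
  rw [cls_iff] at hp
  have hsZ : Squarefree (-(D:ℤ)) := by
    rw [← Int.squarefree_natAbs]; simpa using hsq
  rcases hp with ⟨h, h'⟩ | ⟨h, h'⟩ | ⟨h, h'⟩
  · left
    rw [h, one_mul]
    exact ⟨by omega, hsZ⟩
  · right
    refine ⟨-(D:ℤ), by rw [h]; push_cast; ring, hsZ, by omega⟩
  · right
    refine ⟨-(2 * D : ℕ), by rw [h]; push_cast; ring, ?_, by omega⟩
    rw [← Int.squarefree_natAbs, Int.natAbs_neg, Int.natAbs_natCast, Nat.squarefree_mul]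
    · exact ⟨Nat.prime_two.squarefree, hsq⟩
    · rw [Nat.coprime_two_left, Nat.odd_iff]; omega

lemma of_fund {Δ : ℤ} (h0 : Δ < 0) (h : IsFundamentalDiscriminant Δ) :
    ∃ p ∈ cls, ∃ D : ℕ, D % 8 = p.2 ∧ Squarefree D ∧ Δ = -((p.1 * D : ℕ) : ℤ) := by
  rcases h.2 with ⟨h1, h2⟩ | ⟨m, h1, h2, h3⟩
  · refine ⟨(1, Δ.natAbs % 8), ?_, Δ.natAbs, rfl, Int.squarefree_natAbs.mpr h2, ?_⟩
    · rw [cls_iff]; left; refine ⟨rfl, ?_⟩; simp only; omega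
    · simp only [one_mul]; omega
  · rcases h3 with h3 | h3
    · obtain ⟨k, hk⟩ : ∃ k : ℤ, m = 2 * k := ⟨m / 2, by omega⟩
      refine ⟨(8, k.natAbs % 8), ?_, k.natAbs, rfl, Int.squarefree_natAbs.mpr (h2.squarefree_of_dvd ⟨2, by rw [hk]; ring⟩), ?_⟩
      · rw [cls_iff]; right; right; refine ⟨rfl, ?_⟩; simp only; omega
      · simp only; omega
    · refine ⟨(4, m.natAbs % 8), ?_, m.natAbs, rfl, Int.squarefree_natAbs.mpr h2, ?_⟩
      · rw [cls_iff]; right; left; refine ⟨rfl, ?_⟩; simp only; omega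
      · simp only; omega

open scoped Classical in
lemma reindex (F : ℤ → ℝ) {Y : ℝ} (hY : 1 ≤ Y) :
    (∑ Δ ∈ Icc ⌈-Y⌉ (-1 : ℤ), if IsFundamentalDiscriminant Δ then F Δ else 0) =
    ∑ p ∈ cls, ∑ D ∈ (Icc 1 ⌊Y / p.1⌋₊).filter (fun D => D % 8 = p.2 ∧ Squarefree D), F (-((p.1 * D : ℕ) : ℤ)) := by
  rw [← Finset.sum_filter, Finset.sum_sigma']
  symm
  have hle : ∀ p ∈ cls, ∀ D : ℕ, D ≤ ⌊Y / p.1⌋₊ ↔ ⌈-Y⌉ ≤ -((p.1 * D : ℕ) : ℤ) := by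
    intro p hp D
    rw [Nat.le_floor_iff (by positivity), Int.ceil_le]
    have : (0:ℝ) < p.1 := by
      rw [cls_iff] at hp
      have : 0 < p.1 := by omega
      exact_mod_cast this
    rw [le_div_iff₀ this]
    push_cast
    constructor <;> intro h <;> linarith
  apply Finset.sum_bij (fun (x : Σ _ : ℕ × ℕ, ℕ) _ => -((x.1.1 * x.2 : ℕ) : ℤ))
  · rintro ⟨p, D⟩ h
    simp only [mem_sigma, mem_filter, mem_Icc] at h ⊢
    refine ⟨⟨(hle p h.1 D).mp h.2.1.2, ?_⟩, fund_of h.1 h.2.2.1 h.2.2.2⟩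
    have hp := (cls_iff p).mp h.1
    have : 0 < p.1 * D := Nat.mul_pos (by omega) (by omega)
    omega
  · rintro ⟨⟨k, a⟩, D⟩ h ⟨⟨k', a'⟩, D'⟩ h' heq
    simp only [mem_sigma, mem_filter, mem_Icc, cls_iff] at h h' heq
    have heq : k * D = k' * D' := by omega
    have : k = k' ∧ a = a' ∧ D = D' := by
      obtain ⟨h1, -, h3, -⟩ := h
      obtain ⟨h1', -, h3', -⟩ := h'
      rcases h1 with ⟨rfl, h2⟩ | ⟨rfl, h2⟩ | ⟨rfl, h2⟩ <;> rcases h1' with ⟨rfl, h2'⟩ | ⟨rfl, h2'⟩ | ⟨rfl, h2'⟩ <;> omega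
    obtain ⟨rfl, rfl, rfl⟩ := this
    rfl
  · intro Δ h
    simp only [mem_filter, mem_Icc] at h
    obtain ⟨p, hp, D, h1, h2, h3⟩ := of_fund (by omega) h.2
    refine ⟨⟨p, D⟩, ?_, h3.symm⟩
    simp only [mem_sigma, mem_filter, mem_Icc]
    refine ⟨hp, ⟨?_, (hle p hp D).mpr (h3 ▸ h.1.1)⟩, h1, h2⟩
    rw [cls_iff] at hp
    omega
  · intro x _; rfl

open scoped Classical in
lemma assemble (r : ℕ) (hr : 1 ≤ r) (ψ : ℕ → ℕ → ℤ) (hψ : ∀ p ∈ cls, Psi (ψ p.1)) (lam : ℕ × ℕ → ℝ) (hlam : ∀ p, 0 < lam p) :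
    ∃ c : ℝ, 0 < c ∧ ∀ ε : ℝ, 0 < ε → ∃ C : ℝ, 0 < C ∧ ∀ h : ℤ → ℝ,
      (∀ p ∈ cls, ∀ D, D % 8 = p.2 → Squarefree D → (p.1 * D ≤ 8 ∧ h (-((p.1 * D : ℕ) : ℤ)) = 1) ∨
        ∃ g : ℝ, h (-((p.1 * D : ℕ) : ℤ)) = lam p * √(D:ℝ) * g ∧ ∀ Z : ℕ, 1 ≤ Z → |g - ellZ (ψ p.1) Z D| ≤ 16 * D / Z) →
      ∀ Y : ℝ, 1 ≤ Y →
      |(∑ Δ ∈ Icc ⌈-Y⌉ (-1 : ℤ), if IsFundamentalDiscriminant Δ then h Δ ^ r else 0) - c * Y ^ ((r:ℝ)/2 + 1)| ≤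
        C * Y ^ ((r:ℝ)/2 + 2/3 + ε) := by
  have h0 : ∀ p : ℕ × ℕ, ∃ c : ℝ, p ∈ cls → (0 < c ∧ ∀ ε : ℝ, 0 < ε → ∃ C : ℝ, 0 < C ∧ ∀ (ψ : ℕ → ℤ), Psi ψ → ∀ H : ℕ → ℝ,
      (∀ D, D % 8 = p.2 → Squarefree D → (p.1 * D ≤ 8 ∧ H D = 1) ∨
        ∃ g : ℝ, H D = lam p * √(D:ℝ) * g ∧ ∀ Z : ℕ, 1 ≤ Z → |g - ellZ ψ Z D| ≤ 16 * D / Z) →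
      ∀ Y : ℝ, 1 ≤ Y →
      |∑ D ∈ (Icc 1 ⌊Y / p.1⌋₊).filter (fun D => D % 8 = p.2 ∧ Squarefree D), H D ^ r - c * Y ^ ((r:ℝ)/2 + 1)| ≤
        C * Y ^ ((r:ℝ)/2 + 2/3 + ε)) := by
    intro p
    by_cases hp : p ∈ cls
    · have hp' := (cls_iff p).mp hp
      obtain ⟨c, hc⟩ := class_sum r hr p.1 (by omega) (by omega) p.2 (by omega) (by omega) (lam p) (hlam p)
      exact ⟨c, fun _ => hc⟩
    · exact ⟨0, fun h => absurd h hp⟩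
  choose c hc using h0
  have hne : cls.Nonempty := ⟨(1,3), by simp [cls]⟩
  refine ⟨∑ p ∈ cls, c p, Finset.sum_pos (fun p hp => (hc p hp).1) hne, fun ε hε => ?_⟩
  have h1 : ∀ p : ℕ × ℕ, ∃ C : ℝ, p ∈ cls → _ := fun p => by
    by_cases hp : p ∈ cls
    · obtain ⟨C, hC⟩ := (hc p hp).2 ε hε
      exact ⟨C, fun _ => hC⟩
    · exact ⟨0, fun h => absurd h hp⟩
  choose C hC using h1
  refine ⟨∑ p ∈ cls, C p, Finset.sum_pos (fun p hp => (hC p hp).1) hne, fun h hh Y hY => ?_⟩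
  rw [reindex (fun Δ => h Δ ^ r) hY, Finset.sum_mul, Finset.sum_mul, ← Finset.sum_sub_distrib]
  refine (Finset.abs_sum_le_sum_abs _ _).trans (Finset.sum_le_sum fun p hp => ?_)
  exact (hC p hp).2 (ψ p.1) (hψ p hp) (fun D => h (-((p.1 * D : ℕ) : ℤ))) (hh p hp) Y hY

end CNM


namespace CNM

open Finset

def ek (κ : ℕ) : ℤ := if κ = 8 then -2 else -1

def psi (κ n : ℕ) : ℤ := jacobiSym (ek κ) n

lemma Psi_psi (κ : ℕ) : Psi (psi κ) where
  one := by simp [psi]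
  mul := by
    intro m n hm hn
    have : NeZero m := ⟨hm⟩
    have : NeZero n := ⟨hn⟩
    exact jacobiSym.mul_right _ _ _
  bd := fun n => jac_abs_le _ _
  sq := by
    intro k hk
    have : NeZero k := ⟨by rintro rfl; simp at hk⟩
    rw [psi, pow_two, jacobiSym.mul_right, ← pow_two]
    apply jacobiSym.sq_one
    rw [ek]
    split_ifs
    · rw [Int.neg_gcd]
      have := (Nat.coprime_two_left (n := k)).mpr hk
      exact_mod_cast this
    · simp

noncomputable def ff (κ D n : ℕ) : ℤ := if Odd n then psi κ n * jacobiSym (D:ℤ) n else 0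

lemma psi_per (κ k b : ℕ) (hb : Odd b) : psi κ (8 * k + b) = psi κ b := by
  have hb' : Odd (8 * k + b) := by rw [Nat.odd_iff] at hb ⊢; omega
  rw [psi, psi, ek]
  split_ifs
  · rw [jacobiSym.mod_right _ hb, jacobiSym.mod_right _ hb']
    congr 1
    simp only [Int.natAbs_neg]
    norm_num [Nat.add_mod]
  · rw [jacobiSym.mod_right _ hb, jacobiSym.mod_right _ hb']
    congr 1
    simp only [Int.natAbs_neg, Int.natAbs_one]
    omega

lemma ff_class (κ D b : ℕ) (hb : Odd b) (hD : Odd D) :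
    ∃ s : ℤ, |s| ≤ 1 ∧ ∀ k : ℕ, ff κ D (8 * k + b) = s * jacobiSym ((8 * k + b : ℕ) : ℤ) D := by
  refine ⟨psi κ b * qrSign b D, ?_, fun k => ?_⟩
  · rw [abs_mul]
    have h1 := jac_abs_le (ek κ) b
    have h2 := jac_abs_le (ZMod.χ₄ b) D
    exact mul_le_one₀ h1 (abs_nonneg _) h2
  · have hb' : Odd (8 * k + b) := by rw [Nat.odd_iff] at hb ⊢; omega
    rw [ff, if_pos hb', psi_per _ _ _ hb, jacobiSym.quadratic_reciprocity' hD hb', ← mul_assoc]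
    congr 2
    rw [qrSign, qrSign]
    congr 2
    push_cast
    have : (8 : ZMod 4) = 0 := by decide
    rw [this]; simp

lemma UU_bound {D : ℕ} (hD : Odd D) (hsq : Squarefree D) (h1 : 1 < D) (b L : ℕ) :
    |(UU b L D : ℝ)| ≤ 2 * D := by
  obtain ⟨u, hu⟩ : ∃ u : ℤ, (D:ℤ) ∣ 8 * u - b := by
    have hc : IsCoprime (8:ℤ) (D:ℤ) := by
      have : Nat.Coprime 8 D := by
        rw [show 8 = 2 ^ 3 by norm_num]
        exact Nat.Coprime.pow_left 3 (Nat.coprime_two_left.mpr hD)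
      exact_mod_cast Nat.isCoprime_iff_coprime.mpr this
    obtain ⟨x, y, hxy⟩ := hc
    exact ⟨x * b, ⟨-y * b, by linear_combination b * hxy⟩⟩
  have h2 : UU b L D = jacobiSym 8 D * ∑ k ∈ range L, jacobiSym (u + k) D := by
    rw [UU, Finset.mul_sum]
    apply Finset.sum_congr rfl
    intro k _
    rw [← jacobiSym.mul_left]
    apply jacobiSym.mod_left'
    refine Int.modEq_iff_dvd.mpr ?_
    push_cast
    convert hu using 1; ring
  rw [h2]
  push_cast
  rw [abs_mul]
  have h3 := pv hD hsq h1 L u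
  push_cast at h3
  have h4 := jac_le 8 D
  have hD0 : (0:ℝ) < D := by positivity
  have h5 : √(D:ℝ) * (1 + Real.log D) ≤ 2 * D := by
    have hs : 0 < √(D:ℝ) := Real.sqrt_pos.mpr hD0
    have h6 : Real.log D = 2 * Real.log (√(D:ℝ)) := by
      rw [Real.log_sqrt hD0.le]; ring
    have h7 := Real.log_le_sub_one_of_pos hs
    have h8 := Real.mul_self_sqrt hD0.le
    rw [h6]
    nlinarith
  calc _ ≤ 1 * (√(D:ℝ) * (1 + Real.log D)) := by gcongr
    _ ≤ _ := by linarith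

lemma sum_mod8 (f : ℕ → ℝ) (hf : ∀ n, ¬ Odd n → f n = 0) (N : ℕ) :
    ∑ n ∈ range N, f n = ∑ b ∈ ({1,3,5,7} : Finset ℕ), ∑ k ∈ range ((N + 7 - b) / 8), f (8 * k + b) := by
  have h1 : ∀ b ∈ ({1,3,5,7} : Finset ℕ), ∑ k ∈ range ((N + 7 - b) / 8), f (8 * k + b) = ∑ n ∈ (range N).filter (fun n => n % 8 = b), f n := by
    intro b hb
    simp only [mem_insert, mem_singleton] at hb
    symm
    apply Finset.sum_nbij' (fun n => n / 8) (fun k => 8 * k + b)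
    · intro n hn; simp only [mem_filter, mem_range] at hn ⊢; omega
    · intro n hn; simp only [mem_filter, mem_range] at hn ⊢; omega
    · intro n hn; simp only [mem_filter, mem_range] at hn ⊢; omega
    · intro n hn; simp only [mem_range] at hn ⊢; omega
    · intro n hn; simp only [mem_filter, mem_range] at hn ⊢; congr 1; omega
  rw [Finset.sum_congr rfl h1]
  simp_rw [Finset.sum_filter]
  rw [Finset.sum_comm]
  apply Finset.sum_congr rfl
  intro n _
  by_cases h : Odd n
  · rw [Finset.sum_ite_eq, if_pos]
    rw [Nat.odd_iff] at h
    simp only [mem_insert, mem_singleton]; omega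
  · rw [hf n h]; simp

lemma ff_sum_bound {κ D : ℕ} (hD : Odd D) (hsq : Squarefree D) (h1 : 1 < D) (N : ℕ) :
    |∑ n ∈ range N, (ff κ D n : ℝ)| ≤ 8 * D := by
  rw [sum_mod8 (fun n => (ff κ D n : ℝ)) (by intro n hn; simp [ff, hn])]
  have : ∀ b ∈ ({1,3,5,7} : Finset ℕ), |∑ k ∈ range ((N + 7 - b) / 8), (ff κ D (8 * k + b) : ℝ)| ≤ 2 * D := by
    intro b hb
    have hbo : Odd b := by
      simp only [mem_insert, mem_singleton] at hb
      rw [Nat.odd_iff]; omega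
    obtain ⟨s, hs, h⟩ := ff_class κ D b hbo hD
    have e : ∑ k ∈ range ((N + 7 - b) / 8), (ff κ D (8 * k + b) : ℝ) = s * (UU b ((N + 7 - b) / 8) D : ℝ) := by
      rw [UU]; push_cast; rw [Finset.mul_sum]
      apply Finset.sum_congr rfl
      intro k _
      rw [h k]; push_cast; ring
    rw [e, abs_mul]
    have h2 := UU_bound hD hsq h1 b ((N + 7 - b) / 8)
    have hs' : |(s:ℝ)| ≤ 1 := by exact_mod_cast hs
    calc _ ≤ 1 * (2 * (D:ℝ)) := by gcongr
      _ = _ := one_mul _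
  refine (Finset.abs_sum_le_sum_abs _ _).trans ((Finset.sum_le_sum this).trans ?_)
  rw [Finset.sum_const, show ({1,3,5,7} : Finset ℕ).card = 4 by rfl]
  simp; linarith

lemma abel_real (c w : ℕ → ℝ) {P : ℝ} (hP : ∀ j, |∑ i ∈ range j, c i| ≤ P) (hw : Antitone w) (hw0 : ∀ i, 0 ≤ w i) (k : ℕ) :
    |∑ i ∈ range k, c i * w i| ≤ P * w 0 := by
  have hid : ∑ i ∈ range k, c i * w i = (∑ i ∈ range k, c i) * w k + ∑ i ∈ range k, (∑ j ∈ range (i+1), c j) * (w i - w (i+1)) := by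
    induction k with
    | zero => simp
    | succ k ih => rw [Finset.sum_range_succ, ih, Finset.sum_range_succ (fun i => (∑ j ∈ range (i+1), c j) * (w i - w (i+1))), Finset.sum_range_succ c]; ring
  rw [hid]
  calc _ ≤ |(∑ i ∈ range k, c i) * w k| + |∑ i ∈ range k, (∑ j ∈ range (i+1), c j) * (w i - w (i+1))| := abs_add_le _ _
    _ ≤ P * w k + ∑ i ∈ range k, P * (w i - w (i+1)) := by
        gcongr
        · rw [abs_mul, abs_of_nonneg (hw0 k)]; exact mul_le_mul_of_nonneg_right (hP k) (hw0 k)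
        · refine (Finset.abs_sum_le_sum_abs _ _).trans (Finset.sum_le_sum fun i _ => ?_)
          have : 0 ≤ w i - w (i+1) := sub_nonneg.mpr (hw (Nat.le_succ i))
          rw [abs_mul, abs_of_nonneg this]
          exact mul_le_mul_of_nonneg_right (hP _) this
    _ = _ := by rw [← Finset.mul_sum, Finset.sum_range_sub' w]; ring

lemma ff_le (κ D n : ℕ) : |(ff κ D n : ℝ)| ≤ 1 := by
  rw [ff]
  split_ifs
  · push_cast; rw [abs_mul]; exact mul_le_one₀ (jac_le _ _) (abs_nonneg _) (jac_le _ _)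
  · simp

lemma ff_summable (κ D : ℕ) {s : ℝ} (hs : 1 < s) : Summable (fun n : ℕ => (ff κ D n : ℝ) * (n:ℝ) ^ (-s)) := by
  refine Summable.of_norm_bounded (Real.summable_nat_rpow.mpr (by linarith : -s < -1)) fun n => ?_
  rw [norm_mul, Real.norm_eq_abs, Real.norm_of_nonneg (by positivity)]
  calc _ ≤ 1 * (n:ℝ) ^ (-s) := by gcongr; exact ff_le _ _ _
    _ = _ := one_mul _

lemma ff_tail {κ D : ℕ} (hD : Odd D) (hsq : Squarefree D) (h1 : 1 < D) {Z : ℕ} (hZ : 1 ≤ Z) {s : ℝ} (hs : 1 < s) :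
    |∑' n : ℕ, (ff κ D n : ℝ) * (n:ℝ) ^ (-s) - ∑ n ∈ range (Z+1), (ff κ D n : ℝ) * (n:ℝ) ^ (-s)| ≤ 16 * D / Z := by
  have hsum := ff_summable κ D hs
  rw [← hsum.sum_add_tsum_nat_add (Z+1), add_sub_cancel_left]
  have ht : Filter.Tendsto (fun k => |∑ i ∈ range k, (ff κ D (i + (Z+1)) : ℝ) * ((i + (Z+1) : ℕ):ℝ) ^ (-s)|) Filter.atTop (nhds |∑' i : ℕ, (ff κ D (i + (Z+1)) : ℝ) * ((i + (Z+1) : ℕ):ℝ) ^ (-s)|) :=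
    (((summable_nat_add_iff (Z+1)).mpr hsum).hasSum.tendsto_sum_nat).abs
  refine le_of_tendsto' ht fun k => ?_
  have := abel_real (fun i => (ff κ D (i + (Z+1)) : ℝ)) (fun i => ((i + (Z+1) : ℕ):ℝ) ^ (-s)) (P := 16 * D) (by
    intro j
    have e : ∑ i ∈ range j, (ff κ D (i + (Z+1)) : ℝ) = ∑ i ∈ range (Z + 1 + j), (ff κ D i : ℝ) - ∑ i ∈ range (Z+1), (ff κ D i : ℝ) := by
      rw [Finset.sum_range_add, add_sub_cancel_left]
      apply Finset.sum_congr rfl; intro i _; rw [add_comm]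
    rw [e, sub_eq_add_neg]
    refine (abs_add_le _ _).trans ?_
    rw [abs_neg]
    have h2 := ff_sum_bound (κ := κ) hD hsq h1 (Z+1+j)
    have h3 := ff_sum_bound (κ := κ) hD hsq h1 (Z+1)
    linarith) (by
    intro i j hij
    apply Real.rpow_le_rpow_of_nonpos
    · positivity
    · exact_mod_cast Nat.add_le_add_right hij _
    · linarith) (by intro i; positivity) k
  refine this.trans ?_
  have hZ0 : (0:ℝ) < Z := by exact_mod_cast hZ
  rw [div_eq_mul_inv]
  gcongr
  rw [← Real.rpow_neg_one]
  calc ((0 + (Z+1) : ℕ):ℝ) ^ (-s) ≤ (Z:ℝ) ^ (-s) := by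
        apply Real.rpow_le_rpow_of_nonpos hZ0
        · push_cast; linarith
        · linarith
    _ ≤ _ := by
        apply Real.rpow_le_rpow_of_exponent_le
        · exact_mod_cast hZ
        · linarith

lemma ell_approx {κ D : ℕ} (hD : Odd D) (hsq : Squarefree D) (h1 : 1 < D) {g : ℝ}
    (hg : Filter.Tendsto (fun s : ℝ => ∑' n : ℕ, (ff κ D n : ℝ) * (n:ℝ) ^ (-s)) (nhdsWithin 1 (Set.Ioi 1)) (nhds g)) (Z : ℕ) (hZ : 1 ≤ Z) :
    |g - ellZ (psi κ) Z D| ≤ 16 * D / Z := by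
  have e : ellZ (psi κ) Z D = ∑ n ∈ range (Z+1), (ff κ D n : ℝ) * (n:ℝ) ^ (-(1:ℝ)) := by
    rw [ellZ, oddsZ, Finset.sum_filter]
    rw [Finset.range_eq_Ico, Finset.sum_eq_sum_Ico_succ_bot (by omega)]
    have : ff κ D 0 = 0 := by simp [ff]
    rw [this]
    simp only [Int.cast_zero, zero_mul, zero_add]
    apply Finset.sum_congr
    · ext n; simp only [mem_Icc, mem_Ico]; omega
    · intro n _
      rw [Real.rpow_neg_one, ff]
      split_ifs
      · push_cast; rw [div_eq_mul_inv]
      · simp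
  rw [e]
  have ht : Filter.Tendsto (fun s : ℝ => |∑' n : ℕ, (ff κ D n : ℝ) * (n:ℝ) ^ (-s) - ∑ n ∈ range (Z+1), (ff κ D n : ℝ) * (n:ℝ) ^ (-s)|)
      (nhdsWithin 1 (Set.Ioi 1)) (nhds |g - ∑ n ∈ range (Z+1), (ff κ D n : ℝ) * (n:ℝ) ^ (-(1:ℝ))|) := by
    refine (hg.sub ?_).abs
    refine tendsto_finsetSum _ fun n _ => ?_
    apply Filter.Tendsto.const_mul
    refine Filter.Tendsto.mono_left ?_ nhdsWithin_le_nhds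
    rcases Nat.eq_zero_or_pos n with rfl | hn
    · simp only [Nat.cast_zero]
      rw [Real.zero_rpow (by norm_num)]
      apply Filter.Tendsto.congr' _ tendsto_const_nhds
      filter_upwards [lt_mem_nhds (zero_lt_one : (0:ℝ) < 1)] with s hs
      rw [Real.zero_rpow (by linarith)]
    · have : Continuous (fun s : ℝ => (n:ℝ) ^ (-s)) := by
        apply Continuous.rpow continuous_const continuous_neg
        intro s; left; positivity
      exact this.tendsto 1
  refine le_of_tendsto ht ?_
  filter_upwards [self_mem_nhdsWithin] with s hs
  exact ff_tail hD hsq h1 hZ hs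

end CNM


namespace CNM

open Finset NumberField

lemma exists_basis (K : Type) [Field K] [NumberField K] (hK : Module.finrank ℚ K = 2) :
    ∃ (b : Module.Basis (Fin 2) ℤ (𝓞 K)) (t n : ℤ), b 0 = 1 ∧ b 1 * b 1 = (t : 𝓞 K) * b 1 - (n : 𝓞 K) ∧
      discr K = t ^ 2 - 4 * n := by
  have hrank : Module.finrank ℤ (𝓞 K) = 2 := by rw [RingOfIntegers.rank, hK]
  let c : Module.Basis (Fin 2) ℤ (𝓞 K) := Module.finBasisOfFinrankEq ℤ (𝓞 K) hrank
  set x := c.repr 1 0 with hx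
  set y := c.repr 1 1 with hy
  have h1 : (1 : 𝓞 K) = (x : 𝓞 K) * c 0 + (y : 𝓞 K) * c 1 := by
    conv_lhs => rw [← c.sum_repr 1]
    rw [Fin.sum_univ_two]; simp only [zsmul_eq_mul, hx, hy]
  have hcop : IsCoprime x y := by
    rw [Int.isCoprime_iff_gcd_eq_one]
    obtain ⟨x', hx'⟩ := Int.gcd_dvd_left x y
    obtain ⟨y', hy'⟩ := Int.gcd_dvd_right x y
    set d := Int.gcd x y
    have h2 : ((d : ℕ) : 𝓞 K) * ((x' : 𝓞 K) * c 0 + (y' : 𝓞 K) * c 1) = 1 := by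
      rw [h1, hx', hy']; push_cast; ring
    have h3 := congrArg (Algebra.norm ℤ) h2
    rw [map_mul, map_one (Algebra.norm ℤ)] at h3
    have h4 : Algebra.norm ℤ ((d : ℕ) : 𝓞 K) = (d:ℤ)^2 := by
      have := Algebra.norm_algebraMap_of_basis c (d : ℤ)
      simpa using this
    rw [h4] at h3
    have h5 : IsUnit ((d:ℤ)^2) := IsUnit.of_mul_eq_one _ h3
    have h6 := (isUnit_pow_iff two_ne_zero).mp h5
    rw [Int.isUnit_iff_natAbs_eq] at h6
    simpa using h6
  obtain ⟨u, v, huv⟩ := hcop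
  set w : Fin 2 → 𝓞 K := ![1, (-v : 𝓞 K) * c 0 + (u : 𝓞 K) * c 1] with hw
  have hz : ∀ a b : ℤ, (a : 𝓞 K) * c 0 + (b : 𝓞 K) * c 1 = 0 → a = 0 ∧ b = 0 := by
    intro a b hab
    have := c.linearIndependent
    rw [Fintype.linearIndependent_iff] at this
    have := this ![a, b] (by simpa [Fin.sum_univ_two] using hab)
    exact ⟨this 0, this 1⟩
  have huv' : (u : 𝓞 K) * x + v * y = 1 := by exact_mod_cast congrArg (Int.cast : ℤ → 𝓞 K) huv
  have hli : LinearIndependent ℤ w := by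
    rw [Fintype.linearIndependent_iff]
    intro g hg
    rw [Fin.sum_univ_two] at hg
    simp only [hw, Matrix.cons_val_zero, Matrix.cons_val_one, zsmul_eq_mul] at hg
    have := hz (g 0 * x - g 1 * v) (g 0 * y + g 1 * u) (by
      push_cast
      rw [← hg]
      linear_combination (-(g 0 : 𝓞 K)) * h1)
    obtain ⟨e1, e2⟩ := this
    have g0 : g 0 = 0 := by linear_combination u * e1 + v * e2 - g 0 * huv
    have g1 : g 1 = 0 := by linear_combination x * e2 - y * e1 - g 1 * huv
    intro i; fin_cases i
    · exact g0
    · exact g1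
  have hsp : ⊤ ≤ Submodule.span ℤ (Set.range w) := by
    have m0 : w 0 ∈ Submodule.span ℤ (Set.range w) := Submodule.subset_span ⟨0, rfl⟩
    have m1 : w 1 ∈ Submodule.span ℤ (Set.range w) := Submodule.subset_span ⟨1, rfl⟩
    rw [← c.span_eq, Submodule.span_le]
    rintro _ ⟨i, rfl⟩
    fin_cases i
    · have : c 0 = u • w 0 + (-y) • w 1 := by
        simp only [hw, Matrix.cons_val_zero, Matrix.cons_val_one, zsmul_eq_mul]
        push_cast
        linear_combination (-(u : 𝓞 K)) * h1 - c 0 * huv'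
      change c 0 ∈ Submodule.span ℤ (Set.range w)
      rw [this]
      exact Submodule.add_mem _ (Submodule.smul_mem _ _ m0) (Submodule.smul_mem _ _ m1)
    · have : c 1 = v • w 0 + x • w 1 := by
        simp only [hw, Matrix.cons_val_zero, Matrix.cons_val_one, zsmul_eq_mul]
        linear_combination (-(v : 𝓞 K)) * h1 - c 1 * huv'
      change c 1 ∈ Submodule.span ℤ (Set.range w)
      rw [this]
      exact Submodule.add_mem _ (Submodule.smul_mem _ _ m0) (Submodule.smul_mem _ _ m1)
  let b := Module.Basis.mk hli hsp
  have b0 : b 0 = 1 := by simp [b, hw]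
  refine ⟨b, b.repr (b 1 * b 1) 1, - b.repr (b 1 * b 1) 0, b0, ?_, ?_⟩
  · conv_lhs => rw [← b.sum_repr (b 1 * b 1)]
    rw [Fin.sum_univ_two, b0]; simp only [zsmul_eq_mul]; push_cast; ring
  · rw [← discr_eq_discr K b, Algebra.discr_def, Matrix.det_fin_two]
    simp only [Algebra.traceMatrix_apply, Algebra.traceForm_apply]
    set t := b.repr (b 1 * b 1) 1 with ht
    set n := b.repr (b 1 * b 1) 0 with hn
    have hb : b 1 * b 1 = (t : 𝓞 K) * b 1 + (n : 𝓞 K) := by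
      conv_lhs => rw [← b.sum_repr (b 1 * b 1)]
      rw [Fin.sum_univ_two, b0]; simp only [zsmul_eq_mul]; push_cast; ring
    have T0 : Algebra.trace ℤ (𝓞 K) 1 = 2 := by
      have := Algebra.trace_algebraMap_of_basis c (1:ℤ)
      simpa using this
    have T1 : Algebra.trace ℤ (𝓞 K) (b 1) = t := by
      rw [Algebra.trace_eq_matrix_trace b, Matrix.trace_fin_two, Algebra.leftMulMatrix_eq_repr_mul, Algebra.leftMulMatrix_eq_repr_mul, b0, mul_one]
      simp [ht]
    have T2 : Algebra.trace ℤ (𝓞 K) (b 1 * b 1) = t * t + 2 * n := by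
      rw [hb, map_add, show (t : 𝓞 K) * b 1 = t • b 1 by rw [zsmul_eq_mul], show (n : 𝓞 K) = n • 1 by rw [zsmul_eq_mul, mul_one], map_zsmul, map_zsmul, T1, T0, smul_eq_mul, smul_eq_mul]
      ring
    rw [T2, b0, mul_one, one_mul, mul_one, T0, T1]
    ring

end CNM


namespace CNM

open Finset NumberField

lemma units_pm (K : Type) [Field K] [NumberField K] (hK : Module.finrank ℚ K = 2) (hd : discr K < -4)
    (x : (𝓞 K)ˣ) : x = 1 ∨ x = -1 := by
  obtain ⟨b, t, n, b0, b1, hdis⟩ := exists_basis K hK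
  set a := b.repr (x : 𝓞 K) 0 with ha
  set c := b.repr (x : 𝓞 K) 1 with hc
  have hx : (x : 𝓞 K) = a + c * b 1 := by
    conv_lhs => rw [← b.sum_repr (x : 𝓞 K)]
    rw [Fin.sum_univ_two, b0]; simp only [zsmul_eq_mul, mul_one, ha, hc]
  have hN : Algebra.norm ℤ (x : 𝓞 K) = a ^ 2 + t * a * c + n * c ^ 2 := by
    have e1 : (x : 𝓞 K) * b 1 = ((-(n * c) : ℤ)) • b 0 + (a + t * c : ℤ) • b 1 := by
      rw [hx, b0]; simp only [zsmul_eq_mul]; push_cast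
      linear_combination (c : 𝓞 K) * b1
    rw [Algebra.norm_eq_matrix_det b, Matrix.det_fin_two]
    simp only [Algebra.leftMulMatrix_eq_repr_mul]
    rw [e1, b0, mul_one, ← b0, ← ha, ← hc]
    simp only [map_add, map_smul, Finsupp.add_apply, Finsupp.smul_apply, b.repr_self, Finsupp.single_apply]
    simp
    ring
  have hu : IsUnit (Algebra.norm ℤ (x : 𝓞 K)) := x.isUnit.map _
  rw [hN, Int.isUnit_iff] at hu
  have hc0 : c = 0 := by
    by_contra h
    have h1 : 1 ≤ c ^ 2 := by
      have := sq_pos_of_ne_zero h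
      omega
    have h2 : 4 * (a ^ 2 + t * a * c + n * c ^ 2) = (2 * a + t * c) ^ 2 + (-discr K) * c ^ 2 := by
      rw [hdis]; ring
    have h3 : 4 < (-discr K) * c ^ 2 := by nlinarith
    have h4 := sq_nonneg (2 * a + t * c)
    rcases hu with h | h <;> rw [h] at h2 <;> linarith
  rw [hc0] at hu hx
  have ha1 : a = 1 ∨ a = -1 := by
    rcases hu with h | h
    · have : (a - 1) * (a + 1) = 0 := by linear_combination h
      rcases mul_eq_zero.mp this with h | h
      · left; omega
      · right; omega
    · nlinarith [sq_nonneg a]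
  rcases ha1 with h | h <;> rw [h] at hx
  · left; ext; simp [hx]
  · right; ext; simp [hx]

lemma torsionOrder_two (K : Type) [Field K] [NumberField K] (hK : Module.finrank ℚ K = 2) (hd : discr K < -4) :
    Units.torsionOrder K = 2 := by
  rw [Units.torsionOrder]
  have hm : (-1 : (𝓞 K)ˣ) ∈ Units.torsion K := by
    rw [Units.torsion, CommGroup.mem_torsion, isOfFinOrder_iff_pow_eq_one]
    exact ⟨2, by norm_num, by simp⟩
  have hne : (1 : (𝓞 K)ˣ) ≠ -1 := by
    intro h
    have := congrArg (fun u : (𝓞 K)ˣ => (u : 𝓞 K)) h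
    simp only [Units.val_one, Units.val_neg] at this
    have h2 : (2 : 𝓞 K) = 0 := by linear_combination this
    exact two_ne_zero h2
  rw [Nat.card_eq_two_iff]
  refine ⟨1, ⟨-1, hm⟩, ?_, ?_⟩
  · intro h; exact hne (congrArg Subtype.val h)
  · ext ⟨u, hu⟩
    simp only [Set.mem_insert_iff, Set.mem_singleton_iff, Set.mem_univ, iff_true]
    rcases units_pm K hK hd u with h | h
    · left; ext; simp [h]
    · right; ext; simp [h]

lemma signature (K : Type) [Field K] [NumberField K] (hK : Module.finrank ℚ K = 2) (hd : discr K < 0) :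
    InfinitePlace.nrRealPlaces K = 0 ∧ InfinitePlace.nrComplexPlaces K = 1 := by
  have h1 := sign_discr K
  rw [Int.sign_eq_neg_one_of_neg hd] at h1
  have h2 := InfinitePlace.card_add_two_mul_card_eq_rank K
  rw [hK] at h2
  have h3 : InfinitePlace.nrComplexPlaces K ≠ 0 := by
    intro h; rw [h] at h1; norm_num at h1
  omega

lemma det_empty {ι : Type*} (_d : DecidableEq ι) (_f : Fintype ι) (h : IsEmpty ι) (M : Matrix ι ι ℝ) : |M.det| = 1 := by
  rw [Matrix.det_eq_one_of_card_eq_zero (Fintype.card_eq_zero_iff.mpr h), abs_one]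

lemma regulator_one (K : Type) [Field K] [NumberField K] (hK : Module.finrank ℚ K = 2) (hd : discr K < 0) :
    Units.regulator K = 1 := by
  obtain ⟨h1, h2⟩ := signature K hK hd
  have h3 : Fintype.card (InfinitePlace K) = 1 := by
    rw [InfinitePlace.card_eq_nrRealPlaces_add_nrComplexPlaces, h1, h2]
  have hr : Units.rank K = 0 := by rw [Units.rank, h3]
  obtain ⟨w', hw'⟩ := Fintype.card_eq_one_iff.mp h3
  have : IsEmpty {w : InfinitePlace K // w ≠ w'} := ⟨fun w => w.2 (hw' _)⟩
  have : IsEmpty (Fin (Units.rank K)) := by rw [hr]; infer_instance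
  rw [Units.regulator_eq_det K w' (Equiv.equivOfIsEmpty _ _)]
  exact det_empty _ _ ⟨fun w => w.2 (hw' _)⟩ _

lemma residue_eq (K : Type) [Field K] [NumberField K] (hK : Module.finrank ℚ K = 2) (hd : discr K < -4) :
    dedekindZeta_residue K = Real.pi * classNumber K / √(|discr K| : ℝ) := by
  obtain ⟨h1, h2⟩ := signature K hK (by omega)
  rw [dedekindZeta_residue_def, h1, h2, regulator_one K hK (by omega), torsionOrder_two K hK hd]
  push_cast
  have : 0 < √(|discr K| : ℝ) := by
    apply Real.sqrt_pos.mpr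
    have : discr K ≠ 0 := by omega
    positivity
  field_simp

lemma class_one (K : Type) [Field K] [NumberField K] (hK : Module.finrank ℚ K = 2) (hd : |discr K| ≤ 8) (hd0 : discr K < 0) :
    classNumber K = 1 := by
  rw [classNumber_eq_one_iff]
  obtain ⟨h1, h2⟩ := signature K hK hd0
  apply RingOfIntegers.isPrincipalIdealRing_of_abs_discr_lt
  rw [h2, hK]
  have hpi := Real.pi_gt_three
  have h8 : ((|discr K| : ℤ) : ℝ) ≤ 8 := by exact_mod_cast hd
  norm_num
  push_cast at h8
  nlinarith

end CNM


namespace CNM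

open Finset NumberField

section ideals

variable {K : Type} [Field K] [NumberField K]

noncomputable def AA (K : Type) [Field K] [NumberField K] (N : ℕ) : ℕ := Nat.card {I : Ideal (𝓞 K) // Ideal.absNorm I = N}

lemma absNorm_p (hK : Module.finrank ℚ K = 2) (m : ℕ) : Ideal.absNorm (Ideal.span {(m : 𝓞 K)}) = m ^ 2 := by
  obtain ⟨b, -⟩ := exists_basis K hK
  rw [Ideal.absNorm_span_singleton]
  have := Algebra.norm_algebraMap_of_basis b (m : ℤ)
  simp only [algebraMap_int_eq, eq_intCast, Int.cast_natCast, Fintype.card_fin] at this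
  rw [this]; simp

lemma dvd_span {I : Ideal (𝓞 K)} {m : ℕ} (h : Ideal.absNorm I = m) : I ∣ Ideal.span {(m : 𝓞 K)} := by
  rw [Ideal.dvd_span_singleton, ← h]
  exact Ideal.absNorm_mem I

lemma AA_mul (hK : Module.finrank ℚ K = 2) {m n : ℕ} (hm : m ≠ 0) (hn : n ≠ 0) (hmn : m.Coprime n) :
    AA K (m * n) = AA K m * AA K n := by
  rw [AA, AA, AA, ← Nat.card_prod]
  symm
  have hcop : ∀ I J : Ideal (𝓞 K), Ideal.absNorm I = m → Ideal.absNorm J = n → IsCoprime I J := by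
    intro I J hI hJ
    rw [Ideal.isCoprime_iff_exists]
    obtain ⟨u, v, huv⟩ := Nat.isCoprime_iff_coprime.mpr hmn
    refine ⟨(u : 𝓞 K) * m, Ideal.mul_mem_left _ _ (hI ▸ Ideal.absNorm_mem I), (v : 𝓞 K) * n, Ideal.mul_mem_left _ _ (hJ ▸ Ideal.absNorm_mem J), ?_⟩
    exact_mod_cast congrArg (Int.cast : ℤ → 𝓞 K) huv
  refine Nat.card_congr (Equiv.ofBijective (fun x => ⟨x.1.1 * x.2.1, by rw [map_mul, x.1.2, x.2.2]⟩) ⟨?_, ?_⟩)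
  · rintro ⟨⟨I, hI⟩, ⟨J, hJ⟩⟩ ⟨⟨I', hI'⟩, ⟨J', hJ'⟩⟩ h
    simp only [Subtype.mk.injEq] at h
    have h1 : I = I' := by
      apply associated_iff_eq.mp
      apply associated_of_dvd_dvd
      · exact (hcop I J' hI hJ').dvd_of_dvd_mul_right (h ▸ dvd_mul_right I J)
      · exact (hcop I' J hI' hJ).dvd_of_dvd_mul_right (h ▸ dvd_mul_right I' J')
    have h2 : J = J' := by
      apply associated_iff_eq.mp
      apply associated_of_dvd_dvd
      · exact (hcop I' J hI' hJ).symm.dvd_of_dvd_mul_left (h ▸ dvd_mul_left J I)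
      · exact (hcop I J' hI hJ').symm.dvd_of_dvd_mul_left (h ▸ dvd_mul_left J' I')
    subst h1; subst h2; rfl
  · rintro ⟨I, hI⟩
    have h1 := dvd_span hI
    rw [Nat.cast_mul, ← Ideal.span_singleton_mul_span_singleton] at h1
    obtain ⟨I₁, I₂, d1, d2, he⟩ := exists_dvd_and_dvd_of_dvd_mul h1
    have e1 : Ideal.absNorm I₁ ∣ m ^ 2 := by rw [← absNorm_p hK]; exact map_dvd _ d1
    have e2 : Ideal.absNorm I₂ ∣ n ^ 2 := by rw [← absNorm_p hK]; exact map_dvd _ d2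
    have e3 : Ideal.absNorm I₁ * Ideal.absNorm I₂ = m * n := by rw [← map_mul, ← he, hI]
    have f1 : Ideal.absNorm I₁ ∣ m := by
      apply (Nat.Coprime.coprime_dvd_left e1 (Nat.Coprime.pow_left 2 hmn)).dvd_of_dvd_mul_right
      exact ⟨_, e3.symm⟩
    have f2 : Ideal.absNorm I₂ ∣ n := by
      apply (Nat.Coprime.coprime_dvd_left e2 (Nat.Coprime.pow_left 2 hmn.symm)).dvd_of_dvd_mul_left
      exact ⟨Ideal.absNorm I₁, by rw [← e3, mul_comm]⟩
    obtain ⟨x, hx⟩ := f1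
    obtain ⟨y, hy⟩ := f2
    have hx1 : x * y = 1 := by
      have : m * n * (x * y) = m * n * 1 := by
        rw [mul_one]; nth_rewrite 2 [hx]; nth_rewrite 2 [hy]; rw [← e3]; ring
      exact Nat.eq_of_mul_eq_mul_left (by positivity) this
    have hxx : x = 1 := Nat.eq_one_of_mul_eq_one_right hx1
    have hyy : y = 1 := Nat.eq_one_of_mul_eq_one_left hx1
    rw [hxx, mul_one] at hx
    rw [hyy, mul_one] at hy
    exact ⟨⟨⟨I₁, hx.symm⟩, ⟨I₂, hy.symm⟩⟩, by simp [he]⟩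

lemma AA_one : AA K 1 = 1 := by
  rw [AA, Nat.card_eq_one_iff_unique]
  refine ⟨⟨?_⟩, ⟨⟨⊤, by simp⟩⟩⟩
  rintro ⟨I, hI⟩ ⟨J, hJ⟩
  rw [Ideal.absNorm_eq_one_iff] at hI hJ
  simp [hI, hJ]

lemma dvd_pow {p k : ℕ} {I : Ideal (𝓞 K)} (h : Ideal.absNorm I = p ^ k) : I ∣ (Ideal.span {(p : 𝓞 K)}) ^ k := by
  rw [Ideal.span_singleton_pow]
  have := dvd_span h
  push_cast at this
  exact this

lemma prime_of_norm {p : ℕ} (hp : p.Prime) {P : Ideal (𝓞 K)} (h : Ideal.absNorm P = p) : Prime P := by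
  have h0 : P ≠ ⊥ := by
    rintro rfl
    simp at h; exact hp.ne_zero h.symm
  rw [Ideal.prime_iff_isPrime h0]
  apply Ideal.isPrime_of_irreducible_absNorm
  rw [h]; exact hp

lemma norm_eq_of_dvd {I J : Ideal (𝓞 K)} (h : I ∣ J) (hJ : Ideal.absNorm J ≠ 0) (hN : Ideal.absNorm I = Ideal.absNorm J) : I = J := by
  obtain ⟨L, rfl⟩ := h
  rw [map_mul] at hN hJ
  have : Ideal.absNorm L = 1 := by
    have h1 : Ideal.absNorm I * Ideal.absNorm L = Ideal.absNorm I * 1 := by rw [mul_one, ← hN]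
    exact Nat.eq_of_mul_eq_mul_left (Nat.pos_of_ne_zero (left_ne_zero_of_mul hJ)) h1
  rw [Ideal.absNorm_eq_one_iff] at this
  rw [this, Ideal.mul_top]

lemma AA_pp_two (hK : Module.finrank ℚ K = 2) {p : ℕ} (hp : p.Prime) (hA : AA K p = 2) (k : ℕ) : AA K (p ^ k) = k + 1 := by
  rw [AA, Nat.card_eq_two_iff] at hA
  obtain ⟨⟨P, hP⟩, ⟨Q, hQ⟩, hne, -⟩ := hA
  have hne : P ≠ Q := by simpa using hne
  have pP := prime_of_norm hp hP
  have pQ := prime_of_norm hp hQ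
  have hPQ : ¬ P ∣ Q := by
    intro h
    exact hne (norm_eq_of_dvd h (by rw [hQ]; exact hp.ne_zero) (by rw [hP, hQ]))
  have hQP : ¬ Q ∣ P := by
    intro h
    exact hne.symm (norm_eq_of_dvd h (by rw [hP]; exact hp.ne_zero) (by rw [hP, hQ]))
  have hmul : P * Q = Ideal.span {(p : 𝓞 K)} := by
    apply norm_eq_of_dvd
    · obtain ⟨L, hL⟩ := dvd_span hP
      have h2 := dvd_span hQ
      rw [hL] at h2 ⊢
      rcases pQ.dvd_or_dvd h2 with h | h
      · exact absurd h hQP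
      · exact mul_dvd_mul_left P h
    · rw [absNorm_p hK]; exact pow_ne_zero 2 hp.ne_zero
    · rw [map_mul, hP, hQ, absNorm_p hK, sq]
  rw [AA]
  have key : ∀ i : ℕ, ∀ j : ℕ, Ideal.absNorm (P ^ i * Q ^ j) = p ^ (i + j) := by
    intro i j; rw [map_mul, map_pow, map_pow, hP, hQ, pow_add]
  rw [← Nat.card_fin (k+1)]
  symm
  refine Nat.card_congr (Equiv.ofBijective (fun i : Fin (k+1) => ⟨P ^ (i:ℕ) * Q ^ (k - i), by rw [key]; congr 1; omega⟩) ⟨?_, ?_⟩)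
  · have main : ∀ i j : ℕ, i < j → P ^ i * Q ^ (k - i) ≠ P ^ j * Q ^ (k - j) := by
      intro i j hij h
      have h1 : P ^ i * P ∣ P ^ i * Q ^ (k - i) := by
        rw [h, ← pow_succ]; exact Dvd.dvd.mul_right (pow_dvd_pow P hij) _
      have h2 := (mul_dvd_mul_iff_left (pow_ne_zero i pP.ne_zero)).mp h1
      exact hPQ (pP.dvd_of_dvd_pow h2)
    intro i j h
    simp only [Subtype.mk.injEq] at h
    rcases lt_trichotomy (i:ℕ) j with h' | h' | h'
    · exact absurd h (main _ _ h')
    · exact Fin.ext h'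
    · exact absurd h.symm (main _ _ h')
  · rintro ⟨I, hI⟩
    have h1 := dvd_pow hI
    rw [← hmul, mul_pow] at h1
    obtain ⟨I₁, I₂, d1, d2, he⟩ := exists_dvd_and_dvd_of_dvd_mul h1
    obtain ⟨i, hi, e1⟩ := (dvd_prime_pow pP k).mp d1
    obtain ⟨j, hj, e2⟩ := (dvd_prime_pow pQ k).mp d2
    rw [associated_iff_eq] at e1 e2
    rw [he, e1, e2, key] at hI
    have hij := Nat.pow_right_injective hp.two_le hI
    refine ⟨⟨i, by omega⟩, ?_⟩
    simp only [Subtype.mk.injEq]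
    rw [he, e1, e2]
    congr 2; omega

lemma AA_pp_one (hK : Module.finrank ℚ K = 2) {p : ℕ} (hp : p.Prime) (hA : AA K p = 1) (k : ℕ) : AA K (p ^ k) = 1 := by
  rw [AA, Nat.card_eq_one_iff_unique] at hA
  obtain ⟨⟨huniq⟩, ⟨⟨P, hP⟩⟩⟩ := hA
  have pP := prime_of_norm hp hP
  have hmul : P * P = Ideal.span {(p : 𝓞 K)} := by
    obtain ⟨L, hL⟩ := dvd_span hP
    have h2 := congrArg Ideal.absNorm hL
    rw [map_mul, hP, absNorm_p hK, sq] at h2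
    have h3 := Nat.eq_of_mul_eq_mul_left hp.pos h2
    have h4 := huniq ⟨P, hP⟩ ⟨L, h3.symm⟩
    simp only [Subtype.mk.injEq] at h4
    rw [hL, ← h4]
  rw [AA, Nat.card_eq_one_iff_unique]
  have key : ∀ I : Ideal (𝓞 K), Ideal.absNorm I = p ^ k → I = P ^ k := by
    intro I hI
    have h1 := dvd_pow hI
    rw [← hmul, ← sq, ← pow_mul] at h1
    obtain ⟨i, hi, e1⟩ := (dvd_prime_pow pP _).mp h1
    rw [associated_iff_eq] at e1
    rw [e1, map_pow, hP] at hI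
    rw [e1, Nat.pow_right_injective hp.two_le hI]
  exact ⟨⟨fun ⟨I, hI⟩ ⟨J, hJ⟩ => Subtype.ext ((key I hI).trans (key J hJ).symm)⟩, ⟨⟨P ^ k, by rw [map_pow, hP]⟩⟩⟩

lemma AA_pp_zero (hK : Module.finrank ℚ K = 2) {p : ℕ} (hp : p.Prime) (hA : AA K p = 0) (k : ℕ) :
    AA K (p ^ k) = if Even k then 1 else 0 := by
  have hfin : ∀ N : ℕ, Finite {I : Ideal (𝓞 K) // Ideal.absNorm I = N} := fun N =>
    (Ideal.finite_setOfPred_absNorm_eq N).to_subtype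
  have hno : ∀ P : Ideal (𝓞 K), Ideal.absNorm P ≠ p := by
    intro P hP
    have := hfin p
    rw [AA, Finite.card_eq_zero_iff] at hA
    exact hA.false ⟨P, hP⟩
  set S := Ideal.span {(p : 𝓞 K)} with hS
  have hSN : Ideal.absNorm S = p ^ 2 := absNorm_p hK p
  have pS : Prime S := by
    have hS1 : S ≠ ⊤ := by
      intro h; rw [h, Ideal.absNorm_top] at hSN
      have := hp.one_lt
      nlinarith
    obtain ⟨M, hM, hle⟩ := Ideal.exists_le_maximal S hS1
    have hd : M ∣ S := Ideal.dvd_iff_le.mpr hle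
    have hMN : Ideal.absNorm M ∣ p ^ 2 := by rw [← hSN]; exact map_dvd _ hd
    obtain ⟨i, hi, he⟩ := (Nat.dvd_prime_pow hp).mp hMN
    have : i = 2 := by
      interval_cases i
      · rw [pow_zero, Ideal.absNorm_eq_one_iff] at he
        exact absurd he hM.ne_top
      · rw [pow_one] at he; exact absurd he (hno M)
      · rfl
    subst this
    have hMS : M = S := norm_eq_of_dvd hd (by rw [hSN]; exact pow_ne_zero 2 hp.ne_zero) (by rw [he, hSN])
    rw [← hMS]
    rw [Ideal.prime_iff_isPrime]
    · exact hM.isPrime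
    · rintro rfl
      simp at he; exact absurd he.symm (pow_ne_zero 2 hp.ne_zero)
  have key : ∀ I : Ideal (𝓞 K), Ideal.absNorm I = p ^ k → ∃ i, I = S ^ i ∧ 2 * i = k := by
    intro I hI
    have h1 := dvd_pow hI
    obtain ⟨i, hi, e1⟩ := (dvd_prime_pow pS _).mp h1
    rw [associated_iff_eq] at e1
    rw [e1, map_pow, hSN, ← pow_mul] at hI
    exact ⟨i, e1, Nat.pow_right_injective hp.two_le hI⟩
  rw [AA]
  split_ifs with h
  · rw [Nat.card_eq_one_iff_unique]
    obtain ⟨m, hm⟩ := h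
    refine ⟨⟨fun ⟨I, hI⟩ ⟨J, hJ⟩ => Subtype.ext ?_⟩, ⟨⟨S ^ m, by rw [map_pow, hSN, ← pow_mul]; congr 1; omega⟩⟩⟩
    obtain ⟨i, h1, h2⟩ := key I hI
    obtain ⟨j, h3, h4⟩ := key J hJ
    simp only [h1, h3]
    congr 1; omega
  · have := hfin (p ^ k)
    rw [Finite.card_eq_zero_iff]
    refine ⟨fun ⟨I, hI⟩ => h ?_⟩
    obtain ⟨i, -, h2⟩ := key I hI
    exact ⟨i, by omega⟩

end ideals

end CNM


namespace CNM

open Finset NumberField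

section roots

variable {K : Type} [Field K] [NumberField K]

lemma b_decomp (b : Module.Basis (Fin 2) ℤ (𝓞 K)) (hb : b 0 = 1) (x : 𝓞 K) :
    x = (b.repr x 0 : 𝓞 K) + (b.repr x 1 : 𝓞 K) * b 1 := by
  conv_lhs => rw [← b.sum_repr x]
  rw [Fin.sum_univ_two, hb, zsmul_one, zsmul_eq_mul]

lemma exists_hom (b : Module.Basis (Fin 2) ℤ (𝓞 K)) (t n : ℤ) (hb : b 0 = 1)
    (hb1 : b 1 * b 1 = (t : 𝓞 K) * b 1 - (n : 𝓞 K)) (p : ℕ) (r : ZMod p)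
    (hr : r ^ 2 - t * r + n = 0) : ∃ φ : 𝓞 K →+* ZMod p, φ (b 1) = r := by
  let φ : 𝓞 K →ₗ[ℤ] ZMod p := b.constr ℤ ![1, r]
  have h0 : φ 1 = 1 := by rw [← hb]; simp [φ, Module.Basis.constr_basis]
  have h1 : φ (b 1) = r := by simp [φ, Module.Basis.constr_basis]
  have hc : ∀ (u v : ℤ), φ ((u : 𝓞 K) + (v : 𝓞 K) * b 1) = u + v * r := by
    intro u v
    have : (u : 𝓞 K) + (v : 𝓞 K) * b 1 = u • (1 : 𝓞 K) + v • b 1 := by simp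
    rw [this, map_add, map_smul, map_smul, h0, h1]; simp
  have hm : ∀ x y, φ (x * y) = φ x * φ y := by
    intro x y
    rw [b_decomp b hb x, b_decomp b hb y]
    generalize b.repr x 0 = u
    generalize b.repr x 1 = v
    generalize b.repr y 0 = u'
    generalize b.repr y 1 = v'
    have : ((u : 𝓞 K) + (v : 𝓞 K) * b 1) * ((u' : 𝓞 K) + (v' : 𝓞 K) * b 1) =
      ((u * u' - v * v' * n : ℤ) : 𝓞 K) + ((u * v' + v * u' + v * v' * t : ℤ) : 𝓞 K) * b 1 := by
      push_cast
      linear_combination (v * v' : 𝓞 K) * hb1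
    rw [this, hc, hc, hc]
    push_cast
    linear_combination -(v * v' : ZMod p) * hr
  exact ⟨{ toFun := φ, map_one' := h0, map_mul' := hm, map_zero' := map_zero φ, map_add' := map_add φ }, h1⟩

lemma AA_roots (b : Module.Basis (Fin 2) ℤ (𝓞 K)) (t n : ℤ) (hb : b 0 = 1)
    (hb1 : b 1 * b 1 = (t : 𝓞 K) * b 1 - (n : 𝓞 K)) (p : ℕ) (hp : p.Prime) :
    AA K p = Nat.card {r : ZMod p // r ^ 2 - t * r + n = 0} := by
  have := Fact.mk hp
  choose φ hφ using fun r : {r : ZMod p // r ^ 2 - t * r + n = 0} => exists_hom b t n hb hb1 p r.1 r.2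
  have surj : ∀ r, Function.Surjective (φ r) := fun r => ZMod.ringHom_surjective (φ r)
  symm
  rw [AA]
  refine Nat.card_congr (Equiv.ofBijective (fun r => ⟨RingHom.ker (φ r), ?_⟩) ⟨?_, ?_⟩)
  · rw [Ideal.absNorm_apply, Submodule.cardQuot_apply,
      Nat.card_congr (RingHom.quotientKerEquivOfSurjective (surj r)).toEquiv]
    simp
  · intro r r' h
    simp only [Subtype.mk.injEq] at h
    have h1 : b 1 - ((r.1.val : ℕ) : 𝓞 K) ∈ RingHom.ker (φ r) := by
      rw [RingHom.mem_ker, map_sub, hφ, map_natCast]; simp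
    rw [h, RingHom.mem_ker, map_sub, hφ, map_natCast] at h1
    simp only [ZMod.natCast_val, ZMod.cast_id', id_eq] at h1
    exact Subtype.ext (sub_eq_zero.mp h1).symm
  · rintro ⟨I, hI⟩
    have hcard : Nat.card (𝓞 K ⧸ I) = p := by
      rw [← hI, Ideal.absNorm_apply, Submodule.cardQuot_apply]
    have : Finite (𝓞 K ⧸ I) := Nat.finite_of_card_ne_zero (by rw [hcard]; exact hp.ne_zero)
    have := Fintype.ofFinite (𝓞 K ⧸ I)
    let e : ZMod p ≃+* (𝓞 K ⧸ I) := ZMod.ringEquivOfPrime _ hp (by rw [← Nat.card_eq_fintype_card, hcard])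
    let f : 𝓞 K →+* ZMod p := (e.symm : (𝓞 K ⧸ I) →+* ZMod p).comp (Ideal.Quotient.mk I)
    have hf : (f (b 1)) ^ 2 - t * f (b 1) + n = 0 := by
      have := congrArg f hb1
      simp only [map_mul, map_sub, map_intCast] at this
      linear_combination this
    refine ⟨⟨f (b 1), hf⟩, Subtype.ext ?_⟩
    have h2 : φ ⟨f (b 1), hf⟩ = f := by
      ext x
      rw [b_decomp b hb x]
      simp only [map_add, map_mul, map_intCast, hφ]
    simp only [h2]
    ext x
    rw [RingHom.mem_ker]
    simp [f, Ideal.Quotient.eq_zero_iff_mem]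

end roots

/-- Kronecker symbol at 2. -/
def k2 (Δ : ℤ) : ℤ := if Δ % 2 = 0 then 0 else if Δ % 8 = 1 then 1 else -1

lemma roots_odd (t n : ℤ) (p : ℕ) (hp : p.Prime) (hp2 : p ≠ 2) :
    (Nat.card {r : ZMod p // r ^ 2 - t * r + n = 0} : ℤ) = jacobiSym (t ^ 2 - 4 * n) p + 1 := by
  have := Fact.mk hp
  rw [← jacobiSym.legendreSym.to_jacobiSym, ← legendreSym.card_sqrts p hp2 (t ^ 2 - 4 * n), Set.toFinset_card, ← Nat.card_eq_fintype_card]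
  have h2 : (2 : ZMod p) ≠ 0 := by
    intro h
    have : ((2 : ℕ) : ZMod p) = 0 := by exact_mod_cast h
    rw [ZMod.natCast_eq_zero_iff] at this
    exact hp2 ((Nat.prime_dvd_prime_iff_eq hp Nat.prime_two).mp this)
  congr 1
  refine Nat.card_congr (Equiv.ofBijective (fun r => ⟨2 * r.1 - t, ?_⟩) ⟨?_, ?_⟩)
  · have := r.2
    simp only [Set.mem_setOf_eq]; push_cast
    linear_combination 4 * this
  · intro r r' h
    simp only [Subtype.mk.injEq] at h
    apply Subtype.ext
    apply mul_left_cancel₀ h2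
    linear_combination h
  · rintro ⟨x, hx⟩
    simp only [Set.mem_setOf_eq] at hx
    push_cast at hx
    refine ⟨⟨(x + t) / 2, ?_⟩, ?_⟩
    · field_simp
      linear_combination hx
    · apply Subtype.ext
      simp only
      field_simp
      ring

lemma roots_two (t n : ℤ) :
    (Nat.card {r : ZMod 2 // r ^ 2 - t * r + n = 0} : ℤ) = k2 (t ^ 2 - 4 * n) + 1 := by
  have ht : (t : ZMod 2) = ((t % 2 : ℤ) : ZMod 2) := (ZMod.intCast_mod t 2).symm
  have hn : (n : ZMod 2) = ((n % 2 : ℤ) : ZMod 2) := (ZMod.intCast_mod n 2).symm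
  rw [Nat.card_eq_fintype_card, ht, hn]
  have hk : k2 (t ^ 2 - 4 * n) = k2 ((t % 2) ^ 2 - 4 * (n % 2)) := by
    obtain ⟨u, hu⟩ : ∃ u, t = t % 2 + 2 * u := ⟨t / 2, by omega⟩
    obtain ⟨v, hv⟩ : ∃ v, n = n % 2 + 2 * v := ⟨n / 2, by omega⟩
    have h1 : t % 2 = 0 ∨ t % 2 = 1 := by omega
    rcases h1 with h | h
    · rw [h] at hu ⊢
      unfold k2
      have e1 : (t ^ 2 - 4 * n) % 2 = 0 := by rw [hu]; ring_nf; omega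
      have e2 : (0 ^ 2 - 4 * (n % 2)) % 2 = 0 := by ring_nf; omega
      rw [if_pos e1, if_pos e2]
    · rw [h] at hu ⊢
      unfold k2
      have hw : u * (u + 1) % 2 = 0 := by
        exact Int.even_iff.mp (Int.even_mul_succ_self u)
      have e1 : t ^ 2 - 4 * n = 4 * (u * (u + 1)) + 1 - 4 * n := by rw [hu]; ring
      rw [e1]
      generalize u * (u + 1) = w at *
      have q8 : (4 * w + 1 - 4 * n) % 8 = (1 ^ 2 - 4 * (n % 2)) % 8 := by ring_nf; omega
      have q2 : (4 * w + 1 - 4 * n) % 2 = (1 ^ 2 - 4 * (n % 2)) % 2 := by ring_nf; omega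
      rw [q8, q2]
  rw [hk]
  have h1 : t % 2 = 0 ∨ t % 2 = 1 := by omega
  have h2 : n % 2 = 0 ∨ n % 2 = 1 := by omega
  rcases h1 with h | h <;> rcases h2 with h' | h' <;> rw [h, h'] <;> decide

end CNM


namespace CNM

open Finset NumberField

/-- Kronecker symbol as an arithmetic function. -/
noncomputable def chi (Δ : ℤ) : ArithmeticFunction ℤ :=
  ⟨fun n => if n = 0 then 0 else k2 Δ ^ (n.factorization 2) * jacobiSym Δ (n / 2 ^ (n.factorization 2)), by simp⟩

lemma chi_apply (Δ : ℤ) {n : ℕ} (hn : n ≠ 0) :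
    chi Δ n = k2 Δ ^ (n.factorization 2) * jacobiSym Δ (n / 2 ^ (n.factorization 2)) := by
  simp [chi, hn]

lemma chi_one (Δ : ℤ) : chi Δ 1 = 1 := by
  rw [chi_apply _ one_ne_zero]; simp

lemma chi_mul (Δ : ℤ) (m n : ℕ) : chi Δ (m * n) = chi Δ m * chi Δ n := by
  rcases eq_or_ne m 0 with rfl | hm
  · simp
  rcases eq_or_ne n 0 with rfl | hn
  · simp
  rw [chi_apply _ (mul_ne_zero hm hn), chi_apply _ hm, chi_apply _ hn, Nat.ordCompl_mul, jacobiSym.mul_right',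
    Nat.factorization_mul hm hn, Finsupp.add_apply, pow_add]
  · ring
  · exact (Nat.ordCompl_pos 2 hm).ne'
  · exact (Nat.ordCompl_pos 2 hn).ne'

lemma chi_odd (Δ : ℤ) {n : ℕ} (hn : Odd n) : chi Δ n = jacobiSym Δ n := by
  rw [chi_apply _ hn.pos.ne', Nat.factorization_eq_zero_of_not_dvd]
  · simp
  · exact hn.not_two_dvd_nat

lemma chi_two (Δ : ℤ) : chi Δ 2 = k2 Δ := by
  rw [chi_apply _ two_ne_zero, Nat.Prime.factorization_self Nat.prime_two]; simp

lemma chi_pow (Δ : ℤ) (n k : ℕ) : chi Δ (n ^ k) = chi Δ n ^ k := by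
  induction k with
  | zero => simp [chi_one]
  | succ k ih => rw [pow_succ, chi_mul, ih, pow_succ]

lemma k2_tri (Δ : ℤ) : k2 Δ = 0 ∨ k2 Δ = 1 ∨ k2 Δ = -1 := by
  unfold k2; split_ifs <;> simp

lemma chi_tri (Δ : ℤ) (n : ℕ) : chi Δ n = 0 ∨ chi Δ n = 1 ∨ chi Δ n = -1 := by
  rcases eq_or_ne n 0 with rfl | hn
  · simp
  rw [chi_apply _ hn]
  have h1 := jacobiSym.trichotomy Δ (n / 2 ^ (n.factorization 2))
  have h2 : k2 Δ ^ (n.factorization 2) = 0 ∨ k2 Δ ^ (n.factorization 2) = 1 ∨ k2 Δ ^ (n.factorization 2) = -1 := by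
    rcases k2_tri Δ with h | h | h <;> rw [h]
    · rcases eq_or_ne (n.factorization 2) 0 with h0 | h0
      · simp [h0]
      · simp [h0]
    · simp
    · exact Or.inr (neg_one_pow_eq_or ℤ _)
  rcases h1 with h1 | h1 | h1 <;> rcases h2 with h2 | h2 | h2 <;> rw [h1, h2] <;> simp

lemma chi_mult (Δ : ℤ) : (chi Δ).IsMultiplicative := ⟨chi_one Δ, fun _ => chi_mul Δ _ _⟩

section

variable (K : Type) [Field K] [NumberField K]

lemma AA_prime (hK : Module.finrank ℚ K = 2) {p : ℕ} (hp : p.Prime) : (AA K p : ℤ) = chi (discr K) p + 1 := by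
  obtain ⟨b, t, n, hb, hb1, hd⟩ := exists_basis K hK
  rw [AA_roots b t n hb hb1 p hp, hd]
  rcases eq_or_ne p 2 with rfl | h2
  · rw [roots_two, chi_two]
  · rw [roots_odd _ _ _ hp h2, chi_odd _ (hp.odd_of_ne_two h2)]

noncomputable def AF : ArithmeticFunction ℤ := ⟨fun n => if n = 0 then 0 else (AA K n : ℤ), by simp⟩

lemma AF_apply {n : ℕ} (hn : n ≠ 0) : AF K n = AA K n := by simp [AF, hn]

lemma AF_mult (hK : Module.finrank ℚ K = 2) : (AF K).IsMultiplicative := by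
  rw [ArithmeticFunction.IsMultiplicative.iff_ne_zero]
  refine ⟨by rw [AF_apply _ one_ne_zero, AA_one]; simp, ?_⟩
  intro m n hm hn hmn
  rw [AF_apply _ (mul_ne_zero hm hn), AF_apply _ hm, AF_apply _ hn, AA_mul hK hm hn hmn]
  simp

lemma AF_eq (hK : Module.finrank ℚ K = 2) : AF K = chi (discr K) * (ArithmeticFunction.zeta : ArithmeticFunction ℤ) := by
  rw [ArithmeticFunction.IsMultiplicative.eq_iff_eq_on_prime_powers _ (AF_mult K hK) _
    ((chi_mult _).mul ArithmeticFunction.isMultiplicative_zeta.natCast)]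
  intro p i hp
  rw [AF_apply _ (pow_ne_zero _ hp.ne_zero), ArithmeticFunction.coe_mul_zeta_apply, Nat.sum_divisors_prime_pow hp]
  simp only [chi_pow]
  have h1 := AA_prime K hK hp
  rcases chi_tri (discr K) p with h | h | h
  · rw [h] at h1 ⊢
    rw [AA_pp_one hK hp (by exact_mod_cast h1)]
    simp [Finset.sum_range_succ']
  · rw [h] at h1 ⊢
    rw [AA_pp_two hK hp (by exact_mod_cast h1)]
    simp
  · rw [h] at h1 ⊢
    rw [AA_pp_zero hK hp (by omega)]
    rw [neg_one_geom_sum]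
    by_cases hi : Even i
    · simp [hi, Nat.even_add_one]
    · simp [hi, Nat.even_add_one]

lemma AA_eq (hK : Module.finrank ℚ K = 2) {n : ℕ} (hn : n ≠ 0) :
    (AA K n : ℤ) = ∑ d ∈ n.divisors, chi (discr K) d := by
  rw [← AF_apply K hn, AF_eq K hK, ArithmeticFunction.coe_mul_zeta_apply]

noncomputable def chiC (Δ : ℤ) : ArithmeticFunction ℂ := ⟨fun n => (chi Δ n : ℂ), by simp⟩

lemma chi_le (Δ : ℤ) (n : ℕ) : |(chi Δ n : ℝ)| ≤ 1 := by
  rcases chi_tri Δ n with h | h | h <;> rw [h] <;> simp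

lemma chi_summable (Δ : ℤ) {s : ℝ} (hs : 1 < s) : Summable (fun n : ℕ => (chi Δ n : ℝ) * (n:ℝ) ^ (-s)) := by
  refine Summable.of_norm_bounded (Real.summable_nat_rpow.mpr (by linarith : -s < -1)) fun n => ?_
  rw [norm_mul, Real.norm_eq_abs, Real.norm_of_nonneg (by positivity)]
  exact mul_le_of_le_one_left (by positivity) (chi_le Δ n)

lemma chiC_term (Δ : ℤ) (s : ℝ) (n : ℕ) :
    LSeries.term (chiC Δ) s n = (((chi Δ n : ℝ) * (n:ℝ) ^ (-s) : ℝ) : ℂ) := by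
  rcases eq_or_ne n 0 with rfl | hn
  · simp
  rw [LSeries.term_of_ne_zero hn]
  have : ((n : ℂ) ^ (s : ℂ)) = (((n : ℝ) ^ s : ℝ) : ℂ) := by
    rw [Complex.ofReal_cpow (by positivity)]; simp
  rw [this, Real.rpow_neg (by positivity)]
  push_cast
  rfl

lemma zetaK_eq (hK : Module.finrank ℚ K = 2) {s : ℝ} (hs : 1 < s) :
    dedekindZeta K s = ((∑' n : ℕ, (chi (discr K) n : ℝ) * (n:ℝ) ^ (-s) : ℝ) : ℂ) * riemannZeta s := by
  have hs' : 1 < (s : ℂ).re := by simpa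
  have e1 : LSeries (chiC (discr K)) s = ((∑' n : ℕ, (chi (discr K) n : ℝ) * (n:ℝ) ^ (-s) : ℝ) : ℂ) := by
    rw [LSeries, Complex.ofReal_tsum]
    exact tsum_congr fun n => chiC_term _ _ n
  have sm : LSeriesSummable (chiC (discr K)) s := by
    rw [LSeriesSummable]
    rw [show LSeries.term (chiC (discr K)) s = fun n : ℕ => (((chi (discr K) n : ℝ) * (n:ℝ) ^ (-s) : ℝ) : ℂ) from
      funext fun n => chiC_term _ _ n]
    exact Complex.summable_ofReal.mpr (chi_summable (discr K) hs)
  have z1 : (fun n => ((ArithmeticFunction.zeta n : ℕ) : ℂ)) = ⇑((ArithmeticFunction.zeta : ArithmeticFunction ℕ) : ArithmeticFunction ℂ) := by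
    funext n; rw [ArithmeticFunction.natCoe_apply]
  have z2 := ArithmeticFunction.LSeries_zeta_eq_riemannZeta hs'
  have z3 := ArithmeticFunction.LSeriesSummable_zeta_iff.mpr hs'
  rw [z1] at z2 z3
  have z4 := ArithmeticFunction.LSeries_mul' sm z3
  rw [← e1, ← z2, ← z4, dedekindZeta]
  apply LSeries_congr
  intro n hn
  rw [ArithmeticFunction.coe_mul_zeta_apply]
  have := congrArg (Int.cast : ℤ → ℂ) (AA_eq K hK hn)
  rw [AA] at this
  push_cast at this
  rw [this]
  rfl

end

lemma chi_ff {κ D : ℕ} (hκ : κ = 1 ∨ κ = 4 ∨ κ = 8) {n : ℕ} (hn : Odd n) :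
    chi (-((κ * D : ℕ) : ℤ)) n = ff κ D n := by
  rw [chi_odd _ hn, ff, if_pos hn, psi, ← jacobiSym.mul_left]
  have h4 : jacobiSym (2 ^ 2) n = 1 := by
    apply jacobiSym.sq_one'
    have : Nat.Coprime 2 n := (Nat.coprime_two_left).mpr hn
    simpa [Int.gcd] using this
  rcases hκ with rfl | rfl | rfl
  · simp [ek]
  · rw [show (-((4 * D : ℕ) : ℤ)) = 2 ^ 2 * (-1 * D) by push_cast; ring, jacobiSym.mul_left, h4, one_mul]; simp [ek]
  · rw [show (-((8 * D : ℕ) : ℤ)) = 2 ^ 2 * (-2 * D) by push_cast; ring, jacobiSym.mul_left, h4, one_mul]; simp [ek]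

lemma L_euler {κ D : ℕ} (hκ : κ = 1 ∨ κ = 4 ∨ κ = 8) {s : ℝ} (hs : 1 < s) :
    ∑' n : ℕ, (ff κ D n : ℝ) * (n:ℝ) ^ (-s) =
      (1 - (k2 (-((κ * D : ℕ) : ℤ)) : ℝ) * 2 ^ (-s)) * ∑' n : ℕ, (chi (-((κ * D : ℕ) : ℤ)) n : ℝ) * (n:ℝ) ^ (-s) := by
  set Δ := (-((κ * D : ℕ) : ℤ)) with hΔ
  have sf := ff_summable κ D hs
  have sc := chi_summable Δ hs
  have i2 : Function.Injective (fun k : ℕ => 2 * k) := fun a b h => by simpa using h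
  have i3 : Function.Injective (fun k : ℕ => 2 * k + 1) := fun a b h => by simpa using h
  have h1 := tsum_even_add_odd (f := fun n : ℕ => (ff κ D n : ℝ) * (n:ℝ) ^ (-s)) (sf.comp_injective i2) (sf.comp_injective i3)
  have h2 := tsum_even_add_odd (f := fun n : ℕ => (chi Δ n : ℝ) * (n:ℝ) ^ (-s)) (sc.comp_injective i2) (sc.comp_injective i3)
  have e1 : ∑' k : ℕ, (ff κ D (2 * k) : ℝ) * ((2 * k : ℕ) : ℝ) ^ (-s) = 0 := by
    rw [← tsum_zero (α := ℝ) (β := ℕ)]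
    refine tsum_congr fun k => ?_
    have : ¬ Odd (2 * k) := by simp
    simp [ff, this]
  have e2 : ∑' k : ℕ, (chi Δ (2 * k) : ℝ) * ((2 * k : ℕ) : ℝ) ^ (-s) =
      (k2 Δ : ℝ) * 2 ^ (-s) * ∑' n : ℕ, (chi Δ n : ℝ) * (n:ℝ) ^ (-s) := by
    rw [← tsum_mul_left]
    refine tsum_congr fun k => ?_
    rw [chi_mul, chi_two]
    push_cast
    rw [Real.mul_rpow (by norm_num) (by positivity)]
    ring
  have e3 : ∑' k : ℕ, (chi Δ (2 * k + 1) : ℝ) * ((2 * k + 1 : ℕ) : ℝ) ^ (-s) =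
      ∑' k : ℕ, (ff κ D (2 * k + 1) : ℝ) * ((2 * k + 1 : ℕ) : ℝ) ^ (-s) := by
    refine tsum_congr fun k => ?_
    rw [chi_ff hκ (by exact ⟨k, rfl⟩)]
  beta_reduce at h1 h2
  rw [e1] at h1
  rw [e2, e3] at h2
  linarith

open Filter Topology in
lemma limit_ff (K : Type) [Field K] [NumberField K] (hK : Module.finrank ℚ K = 2) {κ D : ℕ} (hκ : κ = 1 ∨ κ = 4 ∨ κ = 8)
    (hd : discr K = (-((κ * D : ℕ) : ℤ))) :
    Tendsto (fun s : ℝ => ∑' n : ℕ, (ff κ D n : ℝ) * (n:ℝ) ^ (-s)) (nhdsWithin 1 (Set.Ioi 1))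
      (nhds ((1 - (k2 (discr K) : ℝ) / 2) * dedekindZeta_residue K)) := by
  have h1 := tendsto_sub_one_mul_dedekindZeta_nhdsGT K
  have hz : Tendsto (fun s : ℝ => ((s : ℂ) - 1) * riemannZeta s) (𝓝[>] 1) (𝓝 1) := by
    refine riemannZeta_residue_one.comp ?_
    rw [tendsto_nhdsWithin_iff]
    refine ⟨?_, ?_⟩
    · have : Tendsto (fun s : ℝ => (s : ℂ)) (𝓝 1) (𝓝 ((1 : ℝ) : ℂ)) := Complex.continuous_ofReal.tendsto 1
      rw [Complex.ofReal_one] at this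
      exact this.mono_left nhdsWithin_le_nhds
    · filter_upwards [self_mem_nhdsWithin] with s hs
      simp only [Set.mem_compl_iff, Set.mem_singleton_iff]
      have : (1 : ℝ) < s := hs
      exact_mod_cast this.ne'
  have h2 := h1.div hz one_ne_zero
  rw [div_one] at h2
  have h3 : Tendsto (fun s : ℝ => ((∑' n : ℕ, (chi (discr K) n : ℝ) * (n:ℝ) ^ (-s) : ℝ) : ℂ)) (𝓝[>] 1)
      (𝓝 ((dedekindZeta_residue K : ℝ) : ℂ)) := by
    refine h2.congr' ?_
    filter_upwards [self_mem_nhdsWithin] with s hs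
    have hs1 : (1 : ℝ) < s := hs
    simp only [Pi.div_apply]
    rw [zetaK_eq K hK hs1]
    have hz0 : riemannZeta s ≠ 0 := riemannZeta_ne_zero_of_one_lt_re (by simpa)
    have hs0 : (s : ℂ) - 1 ≠ 0 := by
      rw [sub_ne_zero]; exact_mod_cast hs1.ne'
    field_simp
  have h4 := (Complex.continuous_re.tendsto _).comp h3
  simp only [Function.comp_def, Complex.ofReal_re] at h4
  have h5 : Tendsto (fun s : ℝ => (1 - (k2 (discr K) : ℝ) * 2 ^ (-s))) (𝓝[>] 1) (𝓝 (1 - (k2 (discr K) : ℝ) / 2)) := by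
    have : Continuous (fun s : ℝ => (1 - (k2 (discr K) : ℝ) * (2:ℝ) ^ (-s))) := by
      refine continuous_const.sub (continuous_const.mul ?_)
      exact Continuous.rpow continuous_const continuous_neg (fun _ => Or.inl two_ne_zero)
    have := (this.tendsto 1).mono_left (nhdsWithin_le_nhds (s := Set.Ioi 1))
    simpa [Real.rpow_neg_one, div_eq_mul_inv] using this
  refine (h5.mul h4).congr' ?_
  filter_upwards [self_mem_nhdsWithin] with s hs
  rw [L_euler hκ hs, hd]

end CNM


namespace CNM

open Finset NumberField

noncomputable def lam (p : ℕ × ℕ) : ℝ :=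
  √(p.1 : ℝ) / Real.pi * (1 - (k2 (-((p.1 * p.2 : ℕ) : ℤ)) : ℝ) / 2)⁻¹ + (if p.1 = 0 then 1 else 0)

lemma k2_pos (Δ : ℤ) : 0 < (1 - (k2 Δ : ℝ) / 2) := by
  rcases k2_tri Δ with h | h | h <;> rw [h] <;> norm_num

lemma lam_pos (p : ℕ × ℕ) : 0 < lam p := by
  unfold lam
  have h1 := inv_pos.mpr (k2_pos (-((p.1 * p.2 : ℕ) : ℤ)))
  split_ifs with h
  · have : 0 ≤ √(p.1 : ℝ) / Real.pi := div_nonneg (Real.sqrt_nonneg _) Real.pi_pos.le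
    positivity
  · have h3 : (0 : ℝ) < p.1 := by exact_mod_cast Nat.pos_of_ne_zero h
    have := Real.pi_pos
    have := Real.sqrt_pos.mpr h3
    rw [add_zero]; positivity

lemma k2_congr {κ D e : ℕ} (h : D % 8 = e) : k2 (-((κ * D : ℕ) : ℤ)) = k2 (-((κ * e : ℕ) : ℤ)) := by
  have h8 : (-((κ * D : ℕ) : ℤ)) % 8 = (-((κ * e : ℕ) : ℤ)) % 8 := by
    have : (κ * D) % 8 = (κ * e) % 8 := by rw [← h]; simp [Nat.mul_mod]
    omega
  have h2 : (-((κ * D : ℕ) : ℤ)) % 2 = (-((κ * e : ℕ) : ℤ)) % 2 := by omega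
  unfold k2
  rw [h8, h2]

lemma class_formula {p : ℕ × ℕ} (hp : p ∈ cls) {D : ℕ} (hD : D % 8 = p.2) (hsq : Squarefree D)
    (K : Type) [Field K] [NumberField K] (hK : Module.finrank ℚ K = 2) (hd : discr K = -((p.1 * D : ℕ) : ℤ)) :
    (p.1 * D ≤ 8 ∧ (classNumber K : ℝ) = 1) ∨ ∃ g : ℝ, (classNumber K : ℝ) = lam p * √(D:ℝ) * g ∧
      ∀ Z : ℕ, 1 ≤ Z → |g - ellZ (psi p.1) Z D| ≤ 16 * D / Z := by
  have hκ : (p.1 = 1 ∨ p.1 = 4 ∨ p.1 = 8) ∧ p.2 % 2 = 1 := by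
    exact (by unfold cls; decide : ∀ p ∈ cls, (p.1 = 1 ∨ p.1 = 4 ∨ p.1 = 8) ∧ p.2 % 2 = 1) p hp
  obtain ⟨hκ, ho⟩ := hκ
  have hodd : Odd D := Nat.odd_iff.mpr (by omega)
  have hDpos : 0 < D := hodd.pos
  by_cases h8 : p.1 * D ≤ 8
  · left
    refine ⟨h8, ?_⟩
    have : 0 < p.1 * D := by
      have : 0 < p.1 := by omega
      positivity
    rw [class_one K hK (by rw [hd, abs_neg, Nat.abs_cast]; exact_mod_cast h8) (by rw [hd]; omega)]
    simp
  · right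
    have h1 : 1 < D := by
      by_contra h
      have : D = 1 := by omega
      subst this; omega
    refine ⟨(1 - (k2 (discr K) : ℝ) / 2) * dedekindZeta_residue K, ?_, fun Z hZ =>
      ell_approx hodd hsq h1 (limit_ff K hK hκ hd) Z hZ⟩
    rw [residue_eq K hK (by rw [hd]; omega), lam, if_neg (by omega), hd, k2_congr hD]
    have hk := k2_pos (-((p.1 * p.2 : ℕ) : ℤ))
    have habs : |((-((p.1 * D : ℕ) : ℤ) : ℤ) : ℝ)| = p.1 * D := by
      push_cast; rw [abs_neg, abs_of_nonneg]; positivity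
    rw [habs, Real.sqrt_mul (by positivity)]
    have e1 : 0 < √(p.1 : ℝ) := Real.sqrt_pos.mpr (by exact_mod_cast (by omega : 0 < p.1))
    have e2 : 0 < √(D : ℝ) := Real.sqrt_pos.mpr (by exact_mod_cast hDpos)
    have e3 := Real.pi_pos
    set q := (1 - (k2 (-((p.1 * p.2 : ℕ) : ℤ)) : ℝ) / 2) with hq
    field_simp
    ring

end CNM

open scoped Classical in
/-- For every fundamental discriminant `Δ` let `K Δ` be the quadratic number field of
discriminant `Δ` (such a family exists, and all choices are isomorphic). Then
`∑_{−Y ≤ Δ < 0 fund.} h(K_Δ)^r = c·Y^{r/2+1} + O_{r,ε}(Y^{r/2+2/3+ε})`. -/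
theorem statement_1 (r : ℕ) (hr : 1 ≤ r) :
    ∃ c : ℝ, 0 < c ∧ ∀ ε : ℝ, 0 < ε → ∃ C : ℝ, 0 < C ∧
      ∀ (K : ℤ → Type) (instF : ∀ Δ, Field (K Δ)) (instN : ∀ Δ, @NumberField (K Δ) (instF Δ)),
        (∀ Δ, IsFundamentalDiscriminant Δ →
          (letI := instF Δ; letI := instN Δ;
            Module.finrank ℚ (K Δ) = 2 ∧ NumberField.discr (K Δ) = Δ)) →
        ∀ Y : ℝ, 1 ≤ Y →
          |(∑ Δ ∈ Finset.Icc ⌈-Y⌉ (-1 : ℤ),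
              if IsFundamentalDiscriminant Δ then
                (letI := instF Δ; letI := instN Δ;
                  ((NumberField.classNumber (K Δ) : ℝ)) ^ r)
              else 0) - c * Y ^ ((r : ℝ) / 2 + 1)|
            ≤ C * Y ^ ((r : ℝ) / 2 + 2 / 3 + ε) := by
  obtain ⟨c, hc, H⟩ := CNM.assemble r hr CNM.psi (fun p _ => CNM.Psi_psi p.1) CNM.lam CNM.lam_pos
  refine ⟨c, hc, fun ε hε => ?_⟩
  obtain ⟨C, hC, H2⟩ := H ε hε
  refine ⟨C, hC, fun K instF instN hKK Y hY => ?_⟩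
  refine H2 (fun Δ => letI := instF Δ; letI := instN Δ; (NumberField.classNumber (K Δ) : ℝ)) ?_ Y hY
  intro p hp D hD hsq
  have hfund := CNM.fund_of hp hD hsq
  obtain ⟨h1, h2⟩ := hKK _ hfund
  letI := instF (-((p.1 * D : ℕ) : ℤ))
  letI := instN (-((p.1 * D : ℕ) : ℤ))
  exact CNM.class_formula hp hD hsq (K (-((p.1 * D : ℕ) : ℤ))) h1 h2
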